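/- Let 2 ≤ m_1 ≤ m_2 ≤ m_3 be integers such that OP*(m_1, m_2) has a solution and m_3 ≥ m_1 + m_2 + δ(m_1) + δ(m_2). Then OP*(m_1, m_2, m_3) has a solution. -/

import Mathlib

/-- A solution to the directed Oberwolfach problem OP*(m₁, …, m_k). -/
def HasOPSolution (m : List ℕ) : Prop :=
  ∃ σ : Fin (m.sum - 1) → Equiv.Perm (Fin m.sum),
    (∀ i, (σ i).cycleType = (m : Multiset ℕ)) ∧
    ∀ x y : Fin m.sum, x ≠ y → ∃! i, σ i x = y

/-- δ(m) = 0 if m is even, 1 if m is odd. -/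
def deltaOdd (m : ℕ) : ℕ := m % 2

namespace OP

section

open Equiv Equiv.Perm

/-- A permutation all of whose points lie on one cycle. -/
def Full {V : Type*} (σ : Perm V) : Prop := ∀ u v, σ.SameCycle u v

/-- `u` and `v` are neighbours on a cycle of `σ`, in either direction. -/
def Adj {V : Type*} (σ : Perm V) (u v : V) : Prop := σ u = v ∨ σ v = u

/-- The pairs in `W` are covered by `k` one-cycle permutations. -/
def Cov {V : Type*} (W : V → V → Prop) (k : ℕ) : Prop :=
  ∃ L : List (Perm V), L.length = k ∧ (∀ σ ∈ L, Full σ) ∧ ∀ x y, W x y → ∃ σ ∈ L, σ x = y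

section Surgery

variable {V : Type*}

theorem Adj.symm {σ : Perm V} {u v : V} (h : Adj σ u v) : Adj σ v u := Or.symm h

theorem Adj.sameCycle {σ : Perm V} {u v : V} (h : Adj σ u v) : σ.SameCycle u v := by
  rcases h with h | h
  · exact ⟨1, by simpa using h⟩
  · exact (show σ.SameCycle v u from ⟨1, by simpa using h⟩).symm

theorem sameCycle_le {σ : Perm V} {R : V → V → Prop} (hR : Equivalence R)
    (h : ∀ x, R x (σ x)) {u v : V} (huv : σ.SameCycle u v) : R u v := by
  obtain ⟨i, rfl⟩ := huv
  induction i with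
  | zero => exact hR.refl _
  | succ i ih =>
    have e : (σ ^ ((i : ℤ) + 1)) u = σ ((σ ^ (i : ℤ)) u) := by
      rw [add_comm, zpow_add, zpow_one, Perm.mul_apply]
    rw [e]; exact hR.trans ih (h _)
  | pred i ih =>
    have e : σ ((σ ^ (-(i : ℤ) - 1)) u) = (σ ^ (-(i : ℤ))) u := by
      rw [← Perm.mul_apply, ← zpow_one_add]; congr 2; ring
    have := h ((σ ^ (-(i : ℤ) - 1)) u)
    rw [e] at this
    exact hR.trans ih (hR.symm this)

theorem sameCycle_equivalence (σ : Perm V) : Equivalence σ.SameCycle :=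
  ⟨SameCycle.refl σ, SameCycle.symm, SameCycle.trans⟩

theorem mem_of_sameCycle [Finite V] {σ : Perm V} {S : V → Prop} (h : ∀ x, S x → S (σ x)) {u v : V}
    (huv : σ.SameCycle u v) (hu : S u) : S v := by
  obtain ⟨n, rfl⟩ := huv.exists_nat_pow_eq
  induction n with
  | zero => simpa
  | succ n ih =>
    rw [pow_succ', Perm.mul_apply]
    exact h _ (ih ⟨n, by simp⟩)

variable [DecidableEq V]

theorem sameCycle_mul_swap {σ : Perm V} {p q u v : V} (h : σ.SameCycle u v) :
    (σ * swap p q).SameCycle u v ∨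
      (((σ * swap p q).SameCycle u p ∨ (σ * swap p q).SameCycle u q) ∧
        ((σ * swap p q).SameCycle v p ∨ (σ * swap p q).SameCycle v q)) := by
  set τ := σ * swap p q with hτ
  have hq : τ q = σ p := by simp [hτ]
  have hp : τ p = σ q := by simp [hτ]
  refine sameCycle_le (σ := σ) (R := fun u v => τ.SameCycle u v ∨
      ((τ.SameCycle u p ∨ τ.SameCycle u q) ∧ (τ.SameCycle v p ∨ τ.SameCycle v q)))
    ⟨fun x => Or.inl (SameCycle.refl _ _), ?_, ?_⟩ ?_ h
  · rintro x y (h | ⟨h, h'⟩)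
    · exact Or.inl h.symm
    · exact Or.inr ⟨h', h⟩
  · rintro x y z (h | ⟨h, h'⟩) (k | ⟨k, k'⟩)
    · exact Or.inl (h.trans k)
    · exact Or.inr ⟨k.imp h.trans h.trans, k'⟩
    · exact Or.inr ⟨h, h'.imp k.symm.trans k.symm.trans⟩
    · exact Or.inr ⟨h, k'⟩
  · intro x
    by_cases h1 : x = p
    · subst h1
      exact Or.inr ⟨Or.inl (SameCycle.refl _ _), Or.inr (Adj.sameCycle (Or.inr hq))⟩
    by_cases h2 : x = q
    · subst h2
      exact Or.inr ⟨Or.inr (SameCycle.refl _ _), Or.inl (Adj.sameCycle (Or.inr hp))⟩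
    · refine Or.inl (Adj.sameCycle (Or.inl ?_))
      simp [hτ, swap_apply_of_ne_of_ne h1 h2]

theorem sameCycle_mul_swap_of_not [Finite V] {σ : Perm V} {p q : V} (h : ¬ σ.SameCycle p q) :
    (σ * swap p q).SameCycle p q := by
  set τ := σ * swap p q with hτ
  have hq : τ q = σ p := by simp [hτ]
  have key : ∀ k : ℕ, τ.SameCycle q p ∨ τ.SameCycle q ((σ ^ (k + 1)) p) := by
    intro k
    induction k with
    | zero => exact Or.inr (Adj.sameCycle (Or.inl (by simpa using hq)))
    | succ k ih =>
      rcases ih with ih | ih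
      · exact Or.inl ih
      · by_cases e : (σ ^ (k + 1)) p = p
        · rw [e] at ih; exact Or.inl ih
        · have e2 : (σ ^ (k + 1)) p ≠ q := fun e2 => h ⟨(k + 1 : ℕ), by rw [zpow_natCast]; exact e2⟩
          refine Or.inr (ih.trans (Adj.sameCycle (Or.inl ?_)))
          rw [pow_succ' σ (k + 1), hτ, Perm.mul_apply, Perm.mul_apply, swap_apply_of_ne_of_ne e e2]
  obtain ⟨n, hn, hn'⟩ := (isOfFinOrder_of_finite σ).exists_pow_eq_one
  rcases key (n - 1) with k | k
  · exact k.symm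
  · rw [Nat.sub_add_cancel hn, hn'] at k
    exact SameCycle.symm (by simpa using k)

theorem not_sameCycle_mul_swap [Finite V] {σ : Perm V} {p q : V} (hpq : p ≠ q)
    (h : σ.SameCycle p q) : ¬ (σ * swap p q).SameCycle p q := by
  classical
  intro hc
  have ex : ∃ k : ℕ, (σ ^ k) p = q := by
    obtain ⟨n, hn⟩ := h.exists_nat_pow_eq
    exact ⟨n, hn⟩
  set k := Nat.find ex with hk
  have hkq : (σ ^ k) p = q := Nat.find_spec ex
  have hmin : ∀ i < k, (σ ^ i) p ≠ q := fun i hi => Nat.find_min ex hi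
  have hk0 : k ≠ 0 := by
    intro h0; rw [h0] at hkq; exact hpq (by simpa using hkq)
  have hnp : ∀ i, 1 ≤ i → i ≤ k → (σ ^ i) p ≠ p := by
    intro i hi hik e
    have : (σ ^ (k - i)) p = q := by
      rw [← hkq]
      conv_rhs => rw [← Nat.sub_add_cancel hik, pow_add, Perm.mul_apply, e]
    exact hmin (k - i) (by omega) this
  have := mem_of_sameCycle (S := fun w => ∃ i, 1 ≤ i ∧ i ≤ k ∧ (σ ^ i) p = w)
    (σ := σ * swap p q) ?_ hc.symm ⟨k, by omega, le_rfl, hkq⟩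
  · obtain ⟨i, h1, h2, h3⟩ := this
    exact hnp i h1 h2 h3
  · rintro w ⟨i, h1, h2, rfl⟩
    rcases h2.eq_or_lt with rfl | h2
    · exact ⟨1, le_rfl, h1, by simp [hkq]⟩
    · refine ⟨i + 1, by omega, h2, ?_⟩
      rw [Perm.mul_apply, swap_apply_of_ne_of_ne (hnp i h1 h2.le) (hmin i h2), pow_succ',
        Perm.mul_apply]

omit [DecidableEq V] in
theorem exists_reverse [Finite V] (σ : Perm V) (q : V) : ∃ τ : Perm V,
    (∀ u v, τ.SameCycle u v ↔ σ.SameCycle u v) ∧ (∀ u v, Adj σ u v → Adj τ u v) ∧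
    (∀ u, ¬ σ.SameCycle q u → τ u = σ u) ∧ ∀ u, σ.SameCycle q u → τ (σ u) = u := by
  classical
  have hc1 : ∀ u, σ.SameCycle q u → (cycleOf σ q)⁻¹ (σ u) = u := fun u hu => by
    rw [Perm.inv_eq_iff_eq, SameCycle.cycleOf_apply hu]
  have hc2 : ∀ u, ¬ σ.SameCycle q u → (cycleOf σ q)⁻¹ u = u := fun u hu => by
    rw [Perm.inv_eq_iff_eq, cycleOf_apply_of_not_sameCycle hu]
  set τ := σ * (cycleOf σ q)⁻¹ * (cycleOf σ q)⁻¹ with hτ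
  have h1 : ∀ u, σ.SameCycle q u → τ (σ u) = u := by
    intro u hu
    have hu' : σ.SameCycle q (σ⁻¹ u) := by simpa using hu
    have := hc1 _ hu'
    rw [show σ (σ⁻¹ u) = u from σ.apply_symm_apply u] at this
    rw [hτ, Perm.mul_apply, Perm.mul_apply, hc1 _ hu, this,
      show σ (σ⁻¹ u) = u from σ.apply_symm_apply u]
  have h2 : ∀ u, ¬ σ.SameCycle q u → τ u = σ u := by
    intro u hu
    rw [hτ, Perm.mul_apply, Perm.mul_apply, hc2 _ hu, hc2 _ hu]
  have h3 : ∀ u, Adj τ u (σ u) := by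
    intro u
    by_cases hu : σ.SameCycle q u
    · exact Or.inr (h1 u hu)
    · exact Or.inl (h2 u hu)
  refine ⟨τ, fun u v => ⟨fun h => ?_, fun h => ?_⟩, ?_, h2, h1⟩
  · refine sameCycle_le (sameCycle_equivalence σ) (fun x => ?_) h
    by_cases hu : σ.SameCycle q x
    · have hu' : σ.SameCycle q (σ⁻¹ x) := by simpa using hu
      have := h1 _ hu'
      rw [show σ (σ⁻¹ x) = x from σ.apply_symm_apply x] at this
      rw [this]; exact Adj.sameCycle (Or.inr (σ.apply_symm_apply x))
    · rw [h2 x hu]; exact Adj.sameCycle (Or.inl rfl)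
  · exact sameCycle_le (sameCycle_equivalence τ) (fun x => (h3 x).sameCycle) h
  · rintro u v (rfl | rfl)
    · exact h3 u
    · exact (h3 v).symm

theorem exists_merge_oriented [Finite V] {σ : Perm V} {p p' q q' : V} (hp : σ p = p')
    (hq : σ q' = q) (hn : ¬ σ.SameCycle p q) : ∃ τ : Perm V,
    (∀ u v, σ.SameCycle u v → τ.SameCycle u v) ∧ τ.SameCycle p q ∧ Adj τ p q ∧ Adj τ p' q' ∧
    (∀ u v, Adj σ u v → Adj τ u v ∨ s(u, v) = s(p, p') ∨ s(u, v) = s(q, q')) ∧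
    (∀ u, ¬ σ.SameCycle u p → ¬ σ.SameCycle u q → τ u = σ u) ∧
    ∀ u, σ (σ u) = u → u ≠ σ u → Adj τ u (σ u) := by
  have hq' : σ.SameCycle q' q := Adj.sameCycle (Or.inl hq)
  have hn' : ¬ σ.SameCycle p q' := fun h => hn (h.trans hq')
  have hm := sameCycle_mul_swap_of_not hn'
  have h1 : (σ * swap p q') p = q := by simp [hq]
  have h2 : (σ * swap p q') q' = p' := by simp [hp]
  have h3 : ∀ u, u ≠ p → u ≠ q' → (σ * swap p q') u = σ u := fun u a b => by
    rw [Perm.mul_apply, swap_apply_of_ne_of_ne a b]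
  have h4 : ∀ u, Adj (σ * swap p q') u (σ u) ∨ s(u, σ u) = s(p, p') ∨ s(u, σ u) = s(q, q') := by
    intro u
    by_cases a : u = p
    · subst a; exact Or.inr (Or.inl (by rw [hp]))
    by_cases b : u = q'
    · subst b; exact Or.inr (Or.inr (by rw [hq, Sym2.eq_swap]))
    · exact Or.inl (Or.inl (h3 u a b))
  refine ⟨σ * swap p q', fun u v h => ?_, Adj.sameCycle (Or.inl h1), Or.inl h1, Or.inr h2,
    ?_, ?_, ?_⟩
  · rcases sameCycle_mul_swap (p := p) (q := q') h with h | ⟨h, h'⟩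
    · exact h
    · have e : (σ * swap p q').SameCycle u p := h.elim id (fun h => h.trans hm.symm)
      have e' : (σ * swap p q').SameCycle v p := h'.elim id (fun h => h.trans hm.symm)
      exact e.trans e'.symm
  · rintro u v (rfl | rfl)
    · exact h4 u
    · rw [Sym2.eq_swap (a := σ v)]
      exact (h4 v).imp Adj.symm id
  · intro u hu hu'
    exact h3 u (fun e => hu (e ▸ SameCycle.refl _ _)) (fun e => hu' (e ▸ hq'))
  · intro u hu hne
    have hs : σ.SameCycle u (σ u) := Adj.sameCycle (Or.inl rfl)
    by_cases a : u = p ∨ u = q'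
    · refine Or.inr ?_
      rw [h3 (σ u), hu]
      · rintro e
        rcases a with rfl | rfl
        · exact hne e.symm
        · exact hn' (e ▸ hs.symm)
      · rintro e
        rcases a with rfl | rfl
        · exact hn' (e ▸ hs)
        · exact hne e.symm
    · push Not at a
      exact Or.inl (h3 u a.1 a.2)

/-- Two edges on different cycles can be exchanged for the opposite sides of a square. -/
theorem exists_merge [Finite V] {σ : Perm V} {p p' q q' : V} (hp : Adj σ p p')
    (hq : Adj σ q q') (hn : ¬ σ.SameCycle p q) : ∃ τ : Perm V,
    (∀ u v, σ.SameCycle u v → τ.SameCycle u v) ∧ τ.SameCycle p q ∧ Adj τ p q ∧ Adj τ p' q' ∧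
    (∀ u v, Adj σ u v → Adj τ u v ∨ s(u, v) = s(p, p') ∨ s(u, v) = s(q, q')) ∧
    (∀ u, ¬ σ.SameCycle u p → ¬ σ.SameCycle u q → τ u = σ u) ∧
    ∀ u, σ (σ u) = u → u ≠ σ u → Adj τ u (σ u) := by
  have main : ∀ σ' : Perm V, (∀ u v, σ'.SameCycle u v ↔ σ.SameCycle u v) →
      (∀ u v, Adj σ u v → Adj σ' u v) →
      (∀ u, ¬ σ.SameCycle u p → ¬ σ.SameCycle u q → σ' u = σ u) →
      (∀ u, σ (σ u) = u → σ' u = σ u) →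
      σ' p = p' → σ' q' = q → ∃ τ : Perm V,
    (∀ u v, σ.SameCycle u v → τ.SameCycle u v) ∧ τ.SameCycle p q ∧ Adj τ p q ∧ Adj τ p' q' ∧
    (∀ u v, Adj σ u v → Adj τ u v ∨ s(u, v) = s(p, p') ∨ s(u, v) = s(q, q')) ∧
    (∀ u, ¬ σ.SameCycle u p → ¬ σ.SameCycle u q → τ u = σ u) ∧
    ∀ u, σ (σ u) = u → u ≠ σ u → Adj τ u (σ u) := by
    intro σ' h1 h2 h3 hi h4 h5
    obtain ⟨τ, k1, k2, k3, k4, k5, k6, k7⟩ := exists_merge_oriented h4 h5 (by rwa [h1])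
    refine ⟨τ, fun u v h => k1 u v ((h1 u v).2 h), k2, k3, k4, fun u v h => k5 u v (h2 u v h),
      fun u a b => ?_, fun u hu hne => ?_⟩
    · rw [k6 u (by rwa [h1]) (by rwa [h1]), h3 u a b]
    · have := k7 u
      rw [hi u hu, hi (σ u) (by rw [hu])] at this
      exact this hu hne
  have fixp : ∀ σ' : Perm V, (∀ u v, σ'.SameCycle u v ↔ σ.SameCycle u v) →
      (∀ u v, Adj σ u v → Adj σ' u v) →
      (∀ u, ¬ σ.SameCycle u p → ¬ σ.SameCycle u q → σ' u = σ u) →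
      (∀ u, σ (σ u) = u → σ' u = σ u) →
      (σ' p = p' ∨ σ' p' = p) → σ' q' = q → ∃ τ : Perm V,
    (∀ u v, σ.SameCycle u v → τ.SameCycle u v) ∧ τ.SameCycle p q ∧ Adj τ p q ∧ Adj τ p' q' ∧
    (∀ u v, Adj σ u v → Adj τ u v ∨ s(u, v) = s(p, p') ∨ s(u, v) = s(q, q')) ∧
    (∀ u, ¬ σ.SameCycle u p → ¬ σ.SameCycle u q → τ u = σ u) ∧
    ∀ u, σ (σ u) = u → u ≠ σ u → Adj τ u (σ u) := by
    intro σ' h1 h2 h3 hi h4 h5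
    rcases h4 with h4 | h4
    · exact main σ' h1 h2 h3 hi h4 h5
    · obtain ⟨ρ, r1, r2, r3, r4⟩ := exists_reverse σ' p
      refine main ρ (fun u v => (r1 u v).trans (h1 u v)) (fun u v h => r2 _ _ (h2 _ _ h))
        (fun u a b => ?_) (fun u hu => ?_) ?_ ?_
      · rw [r3 u, h3 u a b]
        rw [h1]; exact fun h => a h.symm
      · by_cases c : σ'.SameCycle p u
        · have := r4 (σ u) (by
            rw [h1] at c ⊢; exact c.trans (Adj.sameCycle (Or.inl rfl)))
          rwa [hi (σ u) (by rw [hu]), hu] at this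
        · rw [r3 u c, hi u hu]
      · have := r4 p' (Adj.sameCycle (Or.inr h4))
        rwa [h4] at this
      · rw [r3 q', h5]
        rw [h1]
        exact fun h => hn (h.trans ((h1 _ _).1 (Adj.sameCycle (Or.inl h5))))
  rcases hq with hq | hq
  · obtain ⟨ρ, r1, r2, r3, r4⟩ := exists_reverse σ q
    refine fixp ρ r1 r2 (fun u a b => r3 u fun h => b h.symm) (fun u hu => ?_) (r2 _ _ hp) ?_
    · by_cases c : σ.SameCycle q u
      · have := r4 (σ u) (c.trans (Adj.sameCycle (Or.inl rfl)))
        rwa [hu] at this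
      · exact r3 u c
    have := r4 q (SameCycle.refl _ _)
    rwa [hq] at this
  · exact fixp σ (fun _ _ => Iff.rfl) (fun _ _ h => h) (fun _ _ _ => rfl) (fun _ _ => rfl) hp hq

/-- Two edges traversed in parallel can be exchanged for the opposite sides of a square. -/
theorem exists_switch [Finite V] {σ : Perm V} {p p' q q' : V} (hp : σ p = p')
    (hq : σ q = q') (hpq : p ≠ q) (hs : σ.SameCycle p q) : ∃ τ : Perm V,
    (∀ u v, σ.SameCycle u v → τ.SameCycle u v) ∧ Adj τ p q ∧ Adj τ p' q' ∧
    (∀ u v, Adj σ u v → Adj τ u v ∨ s(u, v) = s(p, p') ∨ s(u, v) = s(q, q')) := by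
  have hn := not_sameCycle_mul_swap hpq hs
  have hp1 : (σ * swap p q) p = q' := by simp [hq]
  have hq1 : (σ * swap p q) q = p' := by simp [hp]
  obtain ⟨τ, k1, k2, k3, k4, k5, -, k7⟩ := exists_merge (Or.inl hp1) (Or.inl hq1) hn
  refine ⟨τ, fun u v h => ?_, k3, k4.symm, ?_⟩
  · rcases sameCycle_mul_swap (p := p) (q := q) h with h | ⟨h, h'⟩
    · exact k1 _ _ h
    · have e : τ.SameCycle u p := h.elim (k1 _ _) (fun h => (k1 _ _ h).trans k2.symm)
      have e' : τ.SameCycle v p := h'.elim (k1 _ _) (fun h => (k1 _ _ h).trans k2.symm)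
      exact e.trans e'.symm
  · have main : ∀ u, Adj τ u (σ u) ∨ s(u, σ u) = s(p, p') ∨ s(u, σ u) = s(q, q') := by
      intro u
      by_cases a : u = p
      · subst a; exact Or.inr (Or.inl (by rw [hp]))
      by_cases b : u = q
      · subst b; exact Or.inr (Or.inr (by rw [hq]))
      have e : (σ * swap p q) u = σ u := by
        rw [Perm.mul_apply, swap_apply_of_ne_of_ne a b]
      rcases k5 u (σ u) (Or.inl e) with h | h | h
      · exact Or.inl h
      · rcases Sym2.eq_iff.1 h with ⟨h, -⟩ | ⟨h, h'⟩
        · exact absurd h a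
        · have := k7 u (by rw [e, h', hp1, h]) (by rwa [e, h'])
          rw [e] at this
          exact Or.inl this
      · rcases Sym2.eq_iff.1 h with ⟨h, -⟩ | ⟨h, h'⟩
        · exact absurd h b
        · have := k7 u (by rw [e, h', hq1, h]) (by rwa [e, h'])
          rw [e] at this
          exact Or.inl this
    rintro u v (rfl | rfl)
    · exact main u
    · rw [Sym2.eq_swap (a := σ v)]
      exact (main v).imp Adj.symm id

end Surgery

end

section

open Equiv Equiv.Perm

theorem full_inv {V : Type*} {σ : Perm V} (h : Full σ) : Full σ⁻¹ := fun u v => (h u v).inv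

section Grid

variable {V : Type*} [AddCommGroup V] {d : ℕ} [NeZero d]

/-- `V` is swept by translates of the cyclic rows generated by `a`, the element `b` leading from
each row to the next one. -/
structure GridData (φ : V →+ ZMod d) (a b : V) : Prop where
  map_a : φ a = 0
  map_b : φ b = 1
  ker : ∀ x, φ x = 0 → ∃ k : ℤ, x = k • a
  two_a : a + a ≠ 0
  two_b : b + b ≠ 0

/-- The permutation `ρ` joins the rows `0, …, i`, having exchanged the `a`-edges starting in `EA`
for the `b`-edges starting in `EB`. -/
structure GridState (φ : V →+ ZMod d) (a b : V) (i : ℕ) (ρ : Perm V) (EA EB : Set V) (z : V) :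
    Prop where
  keepA : ∀ x, x ∉ EA → Adj ρ x (x + a)
  flipB : ∀ x ∈ EB, Adj ρ x (x + b)
  rowB : ∀ x ∈ EB, (φ x).val < i
  rowA : ∀ x ∈ EA, (φ x).val ≤ i
  uniqA : ∀ x ∈ EA, (φ x).val = i → x = z
  above : ∀ x, i < (φ x).val → ρ x = x + a
  joined : ∀ x y, (φ x).val ≤ i → (φ y).val ≤ i → ρ.SameCycle x y

/-- The permutation `τ` has the `a`-edges starting in `EA` and lacks at most the `b`-edges starting
in `EB`. -/
structure CrossState (a b : V) (τ : Perm V) (EA EB : Set V) : Prop where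
  flipA : ∀ x ∈ EA, Adj τ x (x + a)
  keepB : ∀ x, x ∉ EB → Adj τ x (x + b)

variable {φ : V →+ ZMod d} {a b : V}

omit [NeZero d] in
theorem sameRow_sameCycle (G : GridData φ a b) {ρ : Perm V} {x y : V}
    (h : ∀ x', φ x' = φ x → ρ x' = x' + a) (hxy : φ y = φ x) : ρ.SameCycle x y := by
  obtain ⟨k, hk⟩ := G.ker (y - x) (by simp [hxy])
  have main : ∀ k : ℤ, ρ.SameCycle x (x + k • a) := by
    intro k
    have hφ : ∀ k : ℤ, φ (x + k • a) = φ x := fun k => by simp [G.map_a]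
    induction k with
    | zero => simpa using SameCycle.refl _ _
    | succ k ih =>
      refine ih.trans (Adj.sameCycle (Or.inl ?_))
      rw [h _ (hφ _)]
      simp [add_smul, add_assoc]
    | pred k ih =>
      refine ih.trans (Adj.sameCycle (Or.inr ?_))
      rw [h _ (hφ _)]
      simp [sub_smul, add_assoc]
  have := main k
  rwa [← hk, add_sub_cancel] at this

theorem gridState_zero (G : GridData φ a b) (z : V) :
    GridState φ a b 0 (Equiv.addRight a) ∅ ∅ z where
  keepA x _ := Or.inl rfl
  flipB x hx := hx.elim
  rowB x hx := hx.elim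
  rowA x hx := hx.elim
  uniqA x hx := hx.elim
  above _ _ := rfl
  joined x y hx hy := by
    refine sameRow_sameCycle G (fun _ _ => rfl) ?_
    rw [(ZMod.val_eq_zero _).1 (Nat.le_zero.1 hx), (ZMod.val_eq_zero _).1 (Nat.le_zero.1 hy)]

theorem crossState_zero : CrossState a b (Equiv.addRight b) ∅ ∅ where
  flipA x hx := hx.elim
  keepB _ _ := Or.inl rfl

omit [NeZero d] in
theorem val_map_add_b (G : GridData φ a b) {y : V} (hy : (φ y).val + 1 < d) :
    (φ (y + b)).val = (φ y).val + 1 := by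
  have : Fact (1 < d) := ⟨by omega⟩
  rw [map_add, G.map_b, ZMod.val_add_of_lt] <;> rw [ZMod.val_one]
  exact hy

variable [DecidableEq V] [Finite V]

theorem GridState.succ (G : GridData φ a b) {i : ℕ} {ρ : Perm V} {EA EB : Set V} {z y : V}
    (S : GridState φ a b i ρ EA EB z) (hy : (φ y).val = i) (hyA : y ∉ EA) (hi : i + 1 < d) :
    ∃ ρ', GridState φ a b (i + 1) ρ' (insert y (insert (y + b) EA))
      (insert y (insert (y + a) EB)) (y + b) := by
  have : Fact (1 < d) := ⟨by omega⟩
  have h10 : (1 : ZMod d) ≠ 0 := one_ne_zero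
  have hyb : (φ (y + b)).val = i + 1 := by rw [val_map_add_b G (by omega), hy]
  have hybA : y + b ∉ EA := fun h => by have := S.rowA _ h; omega
  have hφa : ∀ x, φ (x + a) = φ x := fun x => by simp [G.map_a]
  have hφb : ∀ x, φ (x + b) ≠ φ x := fun x => by simp [G.map_b, h10]
  -- rows are respected by the cycles of `ρ`
  have hrow : ∀ u v, ρ.SameCycle u v →
      ((φ u).val ≤ i ∧ (φ v).val ≤ i) ∨ φ u = φ v := by
    intro u v h
    refine sameCycle_le (R := fun u v => ((φ u).val ≤ i ∧ (φ v).val ≤ i) ∨ φ u = φ v)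
      ⟨fun x => Or.inr rfl, ?_, ?_⟩ ?_ h
    · rintro x y (⟨h, h'⟩ | h)
      exacts [Or.inl ⟨h', h⟩, Or.inr h.symm]
    · rintro x y w (⟨h, h'⟩ | h) (⟨k, k'⟩ | k)
      · exact Or.inl ⟨h, k'⟩
      · exact Or.inl ⟨h, k ▸ h'⟩
      · exact Or.inl ⟨h ▸ k, k'⟩
      · exact Or.inr (h.trans k)
    · intro x
      by_cases hx : i < (φ x).val
      · rw [S.above x hx, hφa]; exact Or.inr rfl
      by_cases hx' : i < (φ (ρ x)).val
      · exfalso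
        have e : φ (ρ x - a) = φ (ρ x) := by simp [G.map_a]
        have := S.above (ρ x - a) (by rwa [e])
        rw [sub_add_cancel] at this
        have := ρ.injective this
        rw [this] at e
        rw [e] at hx
        exact hx hx'
      · exact Or.inl ⟨by omega, by omega⟩
  have hns : ¬ ρ.SameCycle y (y + b) := by
    intro h
    rcases hrow _ _ h with h | h
    · omega
    · exact hφb y h.symm
  obtain ⟨ρ', k1, k2, k3, k4, k5, k6, -⟩ := exists_merge (S.keepA y hyA) (S.keepA _ hybA) hns
  have e2 : y + b + a = y + a + b := by abel
  refine ⟨ρ', ?_, ?_, ?_, ?_, ?_, ?_, ?_⟩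
  · intro x hx
    simp only [Set.mem_insert_iff, not_or] at hx
    rcases k5 _ _ (S.keepA x hx.2.2) with h | h | h
    · exact h
    · exfalso
      rcases Sym2.eq_iff.1 h with ⟨h, -⟩ | ⟨h, h'⟩
      · exact hx.1 h
      · rw [h, add_assoc, add_eq_left] at h'; exact G.two_a h'
    · exfalso
      rcases Sym2.eq_iff.1 h with ⟨h, -⟩ | ⟨h, h'⟩
      · exact hx.2.1 h
      · rw [h, add_assoc (y + b), add_eq_left] at h'; exact G.two_a h'
  · rintro x (rfl | rfl | hx)
    · exact k3
    · rw [← e2]; exact k4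
    · have hx' := S.rowB x hx
      rcases k5 _ _ (S.flipB x hx) with h | h | h
      · exact h
      · exfalso
        rcases Sym2.eq_iff.1 h with ⟨h, -⟩ | ⟨h, -⟩
        · rw [h] at hx'; omega
        · rw [h, hφa] at hx'; omega
      · exfalso
        rcases Sym2.eq_iff.1 h with ⟨h, -⟩ | ⟨h, -⟩
        · rw [h] at hx'; omega
        · rw [h, hφa] at hx'; omega
  · rintro x (rfl | rfl | hx)
    · omega
    · rw [hφa]; omega
    · have := S.rowB x hx; omega
  · rintro x (rfl | rfl | hx)
    · omega
    · omega
    · have := S.rowA x hx; omega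
  · rintro x (rfl | rfl | hx) h
    · omega
    · rfl
    · have := S.rowA x hx; omega
  · intro x hx
    rw [k6 x, S.above x (by omega)]
    · intro h
      rcases hrow _ _ h with h | h
      · omega
      · rw [h] at hx; omega
    · intro h
      rcases hrow _ _ h with h | h
      · omega
      · rw [h] at hx; omega
  · have main : ∀ x, (φ x).val ≤ i + 1 → ρ'.SameCycle y x := by
      intro x hx
      rcases Nat.lt_or_ge i (φ x).val with h | h
      · refine k2.trans (k1 _ _ (sameRow_sameCycle G ?_ ?_))
        · intro x' hx'
          exact S.above x' (by rw [hx']; omega)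
        · exact ZMod.val_injective d (by omega)
      · exact k1 _ _ (S.joined y x hy.le h)
    intro x x' hx hx'
    exact (main x hx).symm.trans (main x' hx')

omit [NeZero d] [DecidableEq V] [Finite V] in
theorem CrossState.succ (G : GridData φ a b) (hd : 1 < d) {τ τ' : Perm V} {EA EB : Set V} {y : V}
    (C : CrossState a b τ EA EB) (h1 : Adj τ' y (y + a)) (h2 : Adj τ' (y + b) (y + b + a))
    (h3 : ∀ u v, Adj τ u v → Adj τ' u v ∨ s(u, v) = s(y, y + b) ∨ s(u, v) = s(y + a, y + b + a)) :
    CrossState a b τ' (insert y (insert (y + b) EA)) (insert y (insert (y + a) EB)) := by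
  have : Fact (1 < d) := ⟨hd⟩
  have h10 : (1 : ZMod d) ≠ 0 := one_ne_zero
  have hφa : ∀ x, φ (x + a) = φ x := fun x => by simp [G.map_a]
  have hφb : ∀ x, φ (x + b) ≠ φ x := fun x => by simp [G.map_b, h10]
  have e2 : y + b + a = y + a + b := by abel
  have hsym : ∀ x w, s(x, x + a) ≠ s(w, w + b) := by
    intro x w h
    have := congrArg (Sym2.map φ) h
    simp only [Sym2.map_mk, hφa] at this
    rcases Sym2.eq_iff.1 this with ⟨h, h'⟩ | ⟨h, h'⟩
    · exact hφb w (h'.symm.trans h)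
    · exact hφb w (h.symm.trans h')
  rw [e2] at h3
  have hsymb : ∀ x w, s(x, x + b) = s(w, w + b) → x = w := by
    intro x w h
    rcases Sym2.eq_iff.1 h with ⟨h, h'⟩ | ⟨h, h'⟩
    · exact h
    · rw [h, add_assoc, add_eq_left] at h'; exact absurd h' G.two_b
  refine ⟨?_, ?_⟩
  · rintro x (rfl | rfl | hx)
    · exact h1
    · exact h2
    · rcases h3 _ _ (C.flipA x hx) with h | h | h
      · exact h
      · exact absurd h (hsym _ _)
      · exact absurd h (hsym _ _)
  · intro x hx
    simp only [Set.mem_insert_iff, not_or] at hx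
    rcases h3 _ _ (C.keepB x hx.2.2) with h | h | h
    · exact h
    · exact absurd (hsymb _ _ h) hx.1
    · exact absurd (hsymb _ _ h) hx.2.1

/-- Steps by `a` or `b` in either direction. -/
def Steps (a b x y : V) : Prop := y = x + a ∨ y = x - a ∨ y = x + b ∨ y = x - b

omit [DecidableEq V] [Finite V] in
theorem cov_of_states {ρ τ : Perm V} {EA EB : Set V} {z : V}
    (S : GridState φ a b (d - 1) ρ EA EB z) (C : CrossState a b τ EA EB) (hτ : Full τ) :
    Cov (Steps a b) 4 := by
  have hρ : Full ρ := fun u v => S.joined u v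
    (Nat.le_pred_of_lt (ZMod.val_lt _)) (Nat.le_pred_of_lt (ZMod.val_lt _))
  have inv : ∀ (σ : Perm V) u v, σ u = v → σ⁻¹ v = u := by
    rintro σ u v rfl; exact σ.symm_apply_apply u
  have key : ∀ u v, (Adj ρ u v ∨ Adj τ u v) → ∃ σ ∈ [ρ, ρ⁻¹, τ, τ⁻¹], σ u = v := by
    rintro u v ((h | h) | (h | h))
    · exact ⟨ρ, by simp, h⟩
    · exact ⟨ρ⁻¹, by simp, inv _ _ _ h⟩
    · exact ⟨τ, by simp, h⟩
    · exact ⟨τ⁻¹, by simp, inv _ _ _ h⟩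
  have hA : ∀ x, Adj ρ x (x + a) ∨ Adj τ x (x + a) := fun x => by
    by_cases h : x ∈ EA
    · exact Or.inr (C.flipA x h)
    · exact Or.inl (S.keepA x h)
  have hB : ∀ x, Adj ρ x (x + b) ∨ Adj τ x (x + b) := fun x => by
    by_cases h : x ∈ EB
    · exact Or.inl (S.flipB x h)
    · exact Or.inr (C.keepB x h)
  refine ⟨[ρ, ρ⁻¹, τ, τ⁻¹], rfl, ?_, ?_⟩
  · simp [hρ, hτ, full_inv]
  · rintro x y (rfl | rfl | rfl | rfl)
    · exact key _ _ (hA x)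
    · refine key _ _ ?_
      have := hA (x - a); rw [sub_add_cancel] at this
      exact this.imp Adj.symm Adj.symm
    · exact key _ _ (hB x)
    · refine key _ _ ?_
      have := hB (x - b); rw [sub_add_cancel] at this
      exact this.imp Adj.symm Adj.symm

end Grid

end

section

open Equiv Equiv.Perm

section Grid

variable {V : Type*} [AddCommGroup V] {d : ℕ} [NeZero d]
variable {φ : V →+ ZMod d} {a b : V}
variable [DecidableEq V] [Finite V]

theorem GridState.cross_odd (G : GridData φ a b) (ha : Odd (addOrderOf a)) {i : ℕ}
    {ρ τ : Perm V} {EA EB : Set V} {z : V} (S : GridState φ a b i ρ EA EB z)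
    (C : CrossState a b τ EA EB) (hb : ∀ x, τ.SameCycle x (x + b)) (hi : i + 1 < d) :
    ∃ y τ', (φ y).val = i ∧ y ∉ EA ∧ CrossState a b τ' (insert y (insert (y + b) EA))
      (insert y (insert (y + a) EB)) ∧ (∀ u v, τ.SameCycle u v → τ'.SameCycle u v) ∧
      (Full τ ∨ ∃ u v, ¬ τ.SameCycle u v ∧ τ'.SameCycle u v) := by
  have : Fact (1 < d) := ⟨by omega⟩
  have h10 : (1 : ZMod d) ≠ 0 := one_ne_zero
  have e2 : ∀ y, y + b + a = y + a + b := fun y => by abel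
  have hφa : ∀ x, φ (x + a) = φ x := fun x => by simp [G.map_a]
  have hab : a ≠ b := fun h => by
    have := congrArg φ h; rw [G.map_a, G.map_b] at this; exact h10 this.symm
  have hab' : a + b ≠ 0 := fun h => by
    have := congrArg φ h; simp [G.map_a, G.map_b] at this
  have hEB : ∀ y, (φ y).val = i → y ∉ EB := fun y hy h => by have := S.rowB y h; omega
  have hK : ∀ y, (φ y).val = i → Adj τ y (y + b) := fun y hy => C.keepB y (hEB y hy)
  by_cases hA : ∃ y, (φ y).val = i ∧ ¬ τ.SameCycle y (y + a)
  · obtain ⟨y, hy, hns⟩ := hA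
    have hyA : y ∉ EA := fun h => hns (C.flipA y h).sameCycle
    obtain ⟨τ', k1, k2, k3, k4, k5, -⟩ :=
      exists_merge (hK y hy) (hK (y + a) (by rwa [hφa])) hns
    refine ⟨y, τ', hy, hyA, C.succ G (by omega) k3 (by rwa [e2]) ?_, k1, Or.inr ⟨_, _, hns, k2⟩⟩
    rwa [e2]
  · push Not at hA
    obtain ⟨y₀, hy₀⟩ : ∃ y₀ : V, (φ y₀).val = i := by
      refine ⟨i • b, ?_⟩
      rw [map_nsmul, G.map_b, nsmul_one, ZMod.val_natCast_of_lt (by omega)]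
    have hrow : ∀ y, φ y = φ y₀ → τ.SameCycle y₀ y := by
      intro y hy
      obtain ⟨k, hk⟩ := G.ker (y - y₀) (by simp [hy])
      have main : ∀ k : ℤ, τ.SameCycle y₀ (y₀ + k • a) := by
        intro k
        have hφ : ∀ k : ℤ, (φ (y₀ + k • a)).val = i := fun k => by simp [G.map_a, hy₀]
        induction k with
        | zero => simpa using SameCycle.refl _ _
        | succ k ih =>
          refine ih.trans ?_
          rw [add_smul, ← add_assoc, one_smul]
          exact hA _ (hφ _)
        | pred k ih =>
          refine ih.trans ?_
          have := hA _ (hφ (-(k : ℤ) - 1))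
          rw [add_assoc, ← add_one_zsmul, sub_add_cancel] at this
          exact this.symm
      have := main k
      rwa [← hk, add_sub_cancel] at this
    have hb' : ∀ (k : ℕ) x, τ.SameCycle x (x + k • b) := by
      intro k x
      induction k with
      | zero => simpa using SameCycle.refl _ _
      | succ k ih =>
        refine ih.trans ?_
        rw [add_smul, ← add_assoc, one_smul]
        exact hb _
    have hfull : Full τ := by
      have : ∀ x, τ.SameCycle x y₀ := by
        intro x
        refine (hb' (φ y₀ - φ x).val x).trans (hrow _ ?_).symm
        simp [G.map_b]
      exact fun u v => (this u).trans (this v).symm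
    obtain ⟨y, hy, hpar⟩ : ∃ y, (φ y).val = i ∧ (τ y = y + b ↔ τ (y + a) = y + a + b) := by
      by_contra hc
      push Not at hc
      have alt : ∀ k : ℕ, (τ (y₀ + k • a) = y₀ + k • a + b) ↔ (Even k ↔ τ y₀ = y₀ + b) := by
        intro k
        induction k with
        | zero => simp
        | succ k ih =>
          have := hc (y₀ + k • a) (by simp [G.map_a, hy₀])
          rw [add_smul, ← add_assoc, one_smul]
          rw [Nat.even_add_one]
          tauto
      have := alt (addOrderOf a)
      rw [addOrderOf_nsmul_eq_zero, add_zero] at this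
      have := Nat.not_even_iff_odd.2 ha
      tauto
    have hya : (φ (y + a)).val = i := by rwa [hφa]
    have hne : y ≠ y + a := fun h => G.two_a (by
      rw [left_eq_add] at h; simp [h])
    have hyA : y ∉ EA := by
      intro h
      have hf := C.flipA y h
      by_cases h1 : τ y = y + b
      · have h2 := hpar.1 h1
        rcases hf with hf | hf
        · rw [h1, add_right_inj] at hf; exact hab hf.symm
        · rw [h2, add_assoc, add_eq_left] at hf; exact hab' hf
      · have h2 := fun h => h1 (hpar.2 h)
        have h1' := (hK y hy).resolve_left h1
        have h2' := (hK _ hya).resolve_left h2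
        rcases hf with hf | hf
        · rw [← h2'] at hf
          have := τ.injective hf
          rw [add_assoc, left_eq_add] at this
          exact hab' this
        · have := τ.injective (hf.trans h1'.symm)
          rw [add_right_inj] at this; exact hab this
    by_cases h1 : τ y = y + b
    · have h2 := hpar.1 h1
      obtain ⟨τ', k1, k3, k4, k5⟩ := exists_switch h1 h2 hne (hfull _ _)
      refine ⟨y, τ', hy, hyA, C.succ G (by omega) k3 (by rwa [e2]) ?_, k1, Or.inl hfull⟩
      rwa [e2]
    · have h2 := fun h => h1 (hpar.2 h)
      have h1' := (hK y hy).resolve_left h1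
      have h2' := (hK _ hya).resolve_left h2
      obtain ⟨τ', k1, k3, k4, k5⟩ := exists_switch h1' h2'
        (fun h => hne (add_right_cancel h)) (hfull _ _)
      refine ⟨y, τ', hy, hyA, C.succ G (by omega) k4 (by rwa [e2]) ?_, k1, Or.inl hfull⟩
      rw [e2, Sym2.eq_swap (a := y), Sym2.eq_swap (a := y + a)]
      exact k5

/-- The `±a`- and `±b`-steps split into four directed Hamilton cycles when `a` has odd order and
the subgroup of `b` has at most as many cosets as the subgroup of `a`. -/
theorem cov_steps_of_odd (G : GridData φ a b) (ha : Odd (addOrderOf a)) (T : Finset V)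
    (hT : ∀ x, ∃ s ∈ T, ∃ k : ℕ, x = s + k • b) (hcard : T.card ≤ d) : Cov (Steps a b) 4 := by
  classical
  have main : ∀ i, i < d → ∃ (ρ τ : Perm V) (EA EB : Set V) (z : V), GridState φ a b i ρ EA EB z ∧
      CrossState a b τ EA EB ∧ (∀ x, τ.SameCycle x (x + b)) ∧
      (Full τ ∨ ∃ S : Finset V, S.card + i ≤ d ∧ ∀ x, ∃ s ∈ S, τ.SameCycle x s) := by
    intro i
    induction i with
    | zero =>
      intro _
      refine ⟨_, _, _, _, 0, gridState_zero G 0, crossState_zero,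
        fun x => Adj.sameCycle (Or.inl rfl), Or.inr ⟨T, by simpa using hcard, fun x => ?_⟩⟩
      obtain ⟨s, hs, k, rfl⟩ := hT x
      refine ⟨s, hs, SameCycle.symm ?_⟩
      induction k with
      | zero => simpa using SameCycle.refl _ _
      | succ k ih =>
        refine ih.trans (Adj.sameCycle (Or.inl ?_))
        simp [add_smul, add_assoc]
    | succ i ih =>
      intro hi
      obtain ⟨ρ, τ, EA, EB, z, S, C, hb, hF⟩ := ih (by omega)
      obtain ⟨y, τ', hy, hyA, C', hle, hF'⟩ := S.cross_odd G ha C hb hi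
      obtain ⟨ρ', S'⟩ := S.succ G hy hyA hi
      refine ⟨ρ', τ', _, _, _, S', C', fun x => hle _ _ (hb x), ?_⟩
      rcases hF with hF | ⟨R, hR, hR'⟩
      · exact Or.inl fun u v => hle _ _ (hF u v)
      rcases hF' with hF' | ⟨u, v, huv, huv'⟩
      · exact Or.inl fun u v => hle _ _ (hF' u v)
      obtain ⟨s, hs, hus⟩ := hR' u
      obtain ⟨s', hs', hvs⟩ := hR' v
      have hne : s ≠ s' := by
        rintro rfl; exact huv (hus.trans hvs.symm)
      refine Or.inr ⟨R.erase s', ?_, fun x => ?_⟩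
      · rw [Finset.card_erase_of_mem hs']
        have : 0 < R.card := Finset.card_pos.2 ⟨_, hs'⟩
        omega
      · obtain ⟨r, hr, hxr⟩ := hR' x
        by_cases h : r = s'
        · subst h
          exact ⟨s, Finset.mem_erase.2 ⟨hne, hs⟩, (hle _ _ (hxr.trans hvs.symm)).trans
            (huv'.symm.trans (hle _ _ hus))⟩
        · exact ⟨r, Finset.mem_erase.2 ⟨h, hr⟩, hle _ _ hxr⟩
  have hd : 0 < d := Nat.pos_of_ne_zero (NeZero.ne d)
  obtain ⟨ρ, τ, EA, EB, z, S, C, hb, hF⟩ := main (d - 1) (by omega)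
  refine cov_of_states S C ?_
  rcases hF with hF | ⟨R, hR, hR'⟩
  · exact hF
  · have : R.card ≤ 1 := by omega
    rw [Finset.card_le_one] at this
    intro u v
    obtain ⟨s, hs, hus⟩ := hR' u
    obtain ⟨s', hs', hvs⟩ := hR' v
    rw [this s hs s' hs'] at hus
    exact hus.trans hvs.symm

omit [NeZero d] in
/-- Two squares at once, splitting off a four-cycle and merging it back elsewhere. -/
theorem CrossState.double_square (G : GridData φ a b) (hd : 1 < d) {τ : Perm V} {EA EB : Set V}
    {z : V} (C : CrossState a b τ EA EB) (hτ : Full τ) (hz : z ∈ EA)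
    (h0 : z - a ∉ EB) (h1 : z ∉ EB) (h1' : z + a ∉ EB) (h2 : z + b ∉ EB) (h2' : z + b + a ∉ EB) :
    ∃ τ', Full τ' ∧ CrossState a b τ'
      (insert (z + b) (insert (z + b + b) (insert (z - a) (insert (z - a + b) EA))))
      (insert (z + b) (insert (z + b + a) (insert (z - a) (insert (z - a + a) EB)))) := by
  have : Fact (1 < d) := ⟨hd⟩
  have h10 : (1 : ZMod d) ≠ 0 := one_ne_zero
  have ha0 : a ≠ 0 := fun h => G.two_a (by simp [h])
  have hφa : ∀ x, φ (x + a) = φ x := fun x => by simp [G.map_a]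
  have hφa' : ∀ x, φ (x - a) = φ x := fun x => by simp [G.map_a]
  have hφb : ∀ x, φ (x + b) = φ x + 1 := fun x => by simp [G.map_b]
  have main : ∀ π : Perm V, Full π → (∀ u v, Adj τ u v → Adj π u v) →
      π (z + b + b) = z + b → ∃ τ', Full τ' ∧ CrossState a b τ'
      (insert (z + b) (insert (z + b + b) (insert (z - a) (insert (z - a + b) EA))))
      (insert (z + b) (insert (z + b + a) (insert (z - a) (insert (z - a + a) EB)))) := by
    intro π hπ hadj p0
    have C' : CrossState a b π EA EB :=
      ⟨fun x hx => hadj _ _ (C.flipA x hx), fun x hx => hadj _ _ (C.keepB x hx)⟩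
    have go : ∀ u v w : V, π u = v → Adj π v w → w ≠ u → π v = w := by
      rintro u v w h (h' | h') hne
      · exact h'
      · exact absurd (π.injective (h'.trans h.symm)) hne
    have p1 : π (z + b) = z := go _ _ _ p0 (C'.keepB z h1).symm (fun h => by
      rw [add_assoc, left_eq_add] at h; exact G.two_b h)
    have p2 : π z = z + a := go _ _ _ p1 (C'.flipA z hz) (fun h => by
      have := congrArg φ h; simp [G.map_a, G.map_b] at this)
    have p3 : π (z + a) = z + a + b := go _ _ _ p2 (C'.keepB _ h1') (fun h => by
      have := congrArg φ h; simp [G.map_a, G.map_b] at this)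
    have eab : z + a + b = z + b + a := by abel
    have p4 : π (z + a + b) = z + b + a + b := go _ _ _ p3 (by
      rw [eab]; exact C'.keepB _ h2') (fun h => by
      have : b + b = 0 := by
        have : z + b + a + b = (z + a) + (b + b) := by abel
        rw [this, add_eq_left] at h; exact h
      exact G.two_b this)
    set κ := π * swap (z + b + b) (z + a + b) with hκ
    have hne04 : z + b + b ≠ z + a + b := fun h => by
      have := congrArg φ h; simp [G.map_a, G.map_b] at this
    have q0 : κ (z + b + b) = z + b + a + b := by simp [hκ, p4]
    have q4 : κ (z + a + b) = z + b := by simp [hκ, p0]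
    have qo : ∀ x, x ≠ z + b + b → x ≠ z + a + b → κ x = π x := fun x hx hx' => by
      rw [hκ, Perm.mul_apply, swap_apply_of_ne_of_ne hx hx']
    have nφ : ∀ x y : V, φ x + 1 = φ y → x ≠ y := by
      rintro x y h rfl; simp at h
    have q1 : κ (z + b) = z := by
      rw [qo _ _ _, p1]
      · exact nφ _ _ (by simp [G.map_b])
      · rw [eab]; simpa using ha0
    have n2 : z ≠ z + b + b := fun h => by
      rw [add_assoc, left_eq_add] at h; exact G.two_b h
    have q2 : κ z = z + a := by
      rw [qo _ n2 _, p2]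
      exact nφ _ _ (by simp [G.map_b, G.map_a])
    have q3 : κ (z + a) = z + a + b := by
      by_cases h : z + a = z + b + b
      · exfalso
        rw [← h, p3] at p0
        rw [eab, add_eq_left] at p0
        exact ha0 p0
      rw [qo _ h _, p3]
      exact nφ _ _ (by simp [G.map_b, G.map_a])
    have hv0 : ∀ x, κ.SameCycle z x → x = z ∨ x = z + a ∨ x = z + a + b ∨ x = z + b := by
      intro x hx
      refine mem_of_sameCycle (S := fun x => x = z ∨ x = z + a ∨ x = z + a + b ∨ x = z + b)
        ?_ hx (Or.inl rfl)
      rintro x (rfl | rfl | rfl | rfl)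
      · simp [q2]
      · simp [q3]
      · simp [q4]
      · simp [q1]
    have hns : ¬ κ.SameCycle (z - a) z := by
      intro h
      rcases hv0 _ h.symm with h | h | h | h
      · rw [sub_eq_self] at h; exact ha0 h
      · rw [sub_eq_iff_eq_add, add_assoc, left_eq_add] at h; exact G.two_a h
      · have := congrArg φ h; simp [G.map_a, G.map_b] at this
      · have := congrArg φ h; simp [G.map_a, G.map_b] at this
    have keep : ∀ u v, Adj π u v → Adj κ u v ∨ s(u, v) = s(z + b, z + b + b) ∨
        s(u, v) = s(z + b + a, z + b + a + b) := by
      have : ∀ u, Adj κ u (π u) ∨ s(u, π u) = s(z + b, z + b + b) ∨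
        s(u, π u) = s(z + b + a, z + b + a + b) := by
        intro u
        by_cases h : u = z + b + b
        · subst h; rw [p0, Sym2.eq_swap]; exact Or.inr (Or.inl rfl)
        by_cases h' : u = z + a + b
        · subst h'; rw [p4, eab]; exact Or.inr (Or.inr rfl)
        · exact Or.inl (Or.inl (qo u h h'))
      rintro u v (rfl | rfl)
      · exact this u
      · rw [Sym2.eq_swap (a := π v)]
        exact (this v).imp Adj.symm id
    have C1 : CrossState a b κ (insert (z + b) (insert (z + b + b) EA))
        (insert (z + b) (insert (z + b + a) EB)) := by
      refine C'.succ G hd ?_ ?_ ?_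
      · rw [← eab]; exact Or.inr q4
      · have : z + b + a + b = z + b + b + a := by abel
        rw [← this]; exact Or.inl q0
      · have : z + b + a + b = z + b + b + a := by abel
        rw [← this]; exact keep
    have hv : Adj κ (z - a) (z - a + b) := by
      refine C1.keepB _ ?_
      simp only [Set.mem_insert_iff, not_or]
      refine ⟨fun h => ?_, fun h => ?_, h0⟩
      · have := congrArg φ h; simp [G.map_a, G.map_b] at this
      · have := congrArg φ h; simp [G.map_a, G.map_b] at this
    obtain ⟨τ', k1, k2, k3, k4, k5, -⟩ := exists_merge hv (Or.inr q1) hns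
    refine ⟨τ', ?_, ?_⟩
    · have hz4 : κ.SameCycle (z + a + b) z :=
        (Adj.sameCycle (Or.inl q4)).trans (Adj.sameCycle (Or.inl q1))
      have hall : ∀ u, κ.SameCycle u (z + b + b) ∨ κ.SameCycle u z := by
        intro u
        rcases sameCycle_mul_swap (p := z + b + b) (q := z + a + b) (hπ u (z + b + b)) with
          h | ⟨h, -⟩
        · exact Or.inl h
        · exact h.imp id fun h => h.trans hz4
      have h0z : τ'.SameCycle (z + b + b) z := by
        rcases hall (z - a) with h | h
        · exact (k1 _ _ h.symm).trans k2
        · exact absurd h hns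
      have : ∀ u, τ'.SameCycle u z := fun u =>
        (hall u).elim (fun h => (k1 _ _ h).trans h0z) (k1 _ _)
      exact fun u v => (this u).trans (this v).symm
    · have e3 : z - a + b + a = z + b := by abel
      have := C1.succ (τ' := τ') (y := z - a) G hd (by rwa [sub_add_cancel]) (by rwa [e3]) (by
        rwa [e3, sub_add_cancel])
      convert this using 1
      · ext x; simp only [Set.mem_insert_iff]; tauto
      · ext x; simp only [Set.mem_insert_iff]; tauto
  rcases C.keepB _ h2 with h | h
  · refine main τ⁻¹ (full_inv hτ) ?_ (by rw [← h]; exact τ.symm_apply_apply _)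
    rintro u v (rfl | rfl)
    · exact Or.inr (τ.symm_apply_apply _)
    · exact Or.inl (τ.symm_apply_apply _)
  · exact main τ hτ (fun _ _ h => h) h

/-- The `±a`- and `±b`-steps split into four directed Hamilton cycles when `b` generates and the
subgroup of `a` has an even number of cosets. -/
theorem cov_steps_of_even (G : GridData φ a b) (hd : Even d)
    (hb : Full (Equiv.addRight b : Perm V)) : Cov (Steps a b) 4 := by
  have hd2 : 2 ≤ d := by
    have := NeZero.ne d
    obtain ⟨k, rfl⟩ := hd; omega
  have : Fact (1 < d) := ⟨by omega⟩
  have ha0 : a ≠ 0 := fun h => G.two_a (by simp [h])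
  have main : ∀ k, 2 * k + 1 < d → ∃ (ρ τ : Perm V) (EA EB : Set V) (z : V),
      GridState φ a b (2 * k + 1) ρ EA EB z ∧ CrossState a b τ EA EB ∧ Full τ ∧ z ∈ EA ∧
        (φ z).val = 2 * k + 1 := by
    intro k
    induction k with
    | zero =>
      intro _
      have S := gridState_zero G (0 : V)
      obtain ⟨ρ, S'⟩ := S.succ G (y := 0) (by simp) (by simp) (by omega)
      obtain ⟨τ', k1, k3, k4, k5⟩ := exists_switch (σ := (Equiv.addRight b : Perm V))
        (p := 0) (p' := 0 + b) (q := 0 + a) (q' := 0 + b + a) rfl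
        (by simp [add_comm]) (by simpa using ha0.symm) (hb _ _)
      refine ⟨ρ, τ', _, _, _, S', crossState_zero.succ G (by omega) k3 k4 k5,
        fun u v => k1 _ _ (hb u v), by simp, ?_⟩
      rw [val_map_add_b G (by simp; omega)]; simp
    | succ k ih =>
      intro hk
      obtain ⟨ρ, τ, EA, EB, z, S, C, hF, hz, hrz⟩ := ih (by omega)
      have hφa : ∀ x, φ (x + a) = φ x := fun x => by simp [G.map_a]
      have hφa' : ∀ x, φ (x - a) = φ x := fun x => by simp [G.map_a]
      have hEB : ∀ y, 2 * k + 1 ≤ (φ y).val → y ∉ EB := fun y hy h => by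
        have := S.rowB y h; omega
      have hrzb : (φ (z + b)).val = 2 * k + 2 := by rw [val_map_add_b G (by omega), hrz]
      obtain ⟨τ', F', C'⟩ := C.double_square G (by omega) hF hz
        (hEB _ (by rw [hφa']; omega)) (hEB _ (by omega)) (hEB _ (by rw [hφa]; omega))
        (hEB _ (by omega)) (hEB _ (by rw [hφa]; omega))
      have hza : z - a ∉ EA := by
        intro h
        have h1 := S.uniqA _ h (by rw [hφa', hrz])
        have h2 := S.uniqA _ hz hrz
        rw [← h2, sub_eq_self] at h1
        exact ha0 h1
      obtain ⟨ρ₁, S₁⟩ := S.succ G (y := z - a) (by rw [hφa', hrz]) hza (by omega)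
      have hzb : z + b ∉ insert (z - a) (insert (z - a + b) EA) := by
        simp only [Set.mem_insert_iff, not_or]
        refine ⟨fun h => ?_, fun h => ?_, fun h => ?_⟩
        · rw [h, hφa'] at hrzb; omega
        · rw [add_left_inj, eq_comm, sub_eq_self] at h; exact ha0 h
        · have := S.rowA _ h; omega
      obtain ⟨ρ₂, S₂⟩ := S₁.succ G (y := z + b) (by omega) hzb (by omega)
      refine ⟨ρ₂, τ', _, _, _, S₂, C', F', by simp, ?_⟩
      rw [val_map_add_b G (by omega)]; omega
  obtain ⟨e, he⟩ := hd
  obtain ⟨ρ, τ, EA, EB, z, S, C, hF, -⟩ := main (e - 1) (by omega)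
  have : 2 * (e - 1) + 1 = d - 1 := by omega
  rw [this] at S
  exact cov_of_states S C hF

end Grid

end

section

open Equiv Equiv.Perm

theorem full_addRight {t : ℕ} [NeZero t] {u : ZMod t} (hu : IsUnit u) :
    Full (Equiv.addRight u : Perm (ZMod t)) := by
  have key : ∀ (k : ℕ) (x : ZMod t),
      (Equiv.addRight u : Perm (ZMod t)).SameCycle x (x + k * u) := by
    intro k x
    induction k with
    | zero => simpa using SameCycle.refl _ _
    | succ k ih =>
      refine ih.trans (Adj.sameCycle (Or.inl ?_))
      simp [add_mul, add_assoc]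
  intro x y
  obtain ⟨v, hv⟩ := hu.exists_left_inv
  have := key ((y - x) * v).val x
  rwa [ZMod.natCast_zmod_val, mul_assoc, hv, mul_one, add_sub_cancel] at this

theorem exists_mul_of_gcd_dvd {t h : ℕ} [NeZero t] (n : ℕ) (hn : Nat.gcd h t ∣ n) :
    ∃ k : ℤ, (n : ZMod t) = k * h := by
  obtain ⟨q, rfl⟩ := hn
  refine ⟨q * Nat.gcdA h t, ?_⟩
  have := congrArg (Int.cast : ℤ → ZMod t) (Nat.gcd_eq_gcd_ab h t)
  push_cast at this ⊢
  rw [this, ZMod.natCast_self]; ring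

theorem gridData_zmod {t h : ℕ} [NeZero t] {w : ℤ}
    (hw : (w : ZMod (Nat.gcd h t)) = 1) (ha : (h : ZMod t) + h ≠ 0)
    (hb : (w : ZMod t) + w ≠ 0) :
    GridData (ZMod.castHom (Nat.gcd_dvd_right h t) (ZMod (Nat.gcd h t))).toAddMonoidHom
      (h : ZMod t) (w : ZMod t) where
  map_a := by
    have := (ZMod.natCast_eq_zero_iff h (Nat.gcd h t)).2 (Nat.gcd_dvd_left h t)
    simpa using this
  map_b := by simpa using hw
  ker x hx := by
    have hx' : ((x.val : ℕ) : ZMod (Nat.gcd h t)) = 0 := by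
      have e : (x : ZMod t) = (x.val : ZMod t) := (ZMod.natCast_zmod_val x).symm
      rw [e] at hx
      simpa using hx
    obtain ⟨k, hk⟩ := exists_mul_of_gcd_dvd (t := t) (h := h) _
      ((ZMod.natCast_eq_zero_iff _ _).1 hx')
    refine ⟨k, ?_⟩
    rw [ZMod.natCast_zmod_val] at hk
    rw [hk, zsmul_eq_mul]
  two_a := ha
  two_b := hb

theorem natCast_ne_zero {t n : ℕ} (h0 : 0 < n) (ht : n < t) : (n : ZMod t) ≠ 0 := by
  rw [Ne, ZMod.natCast_eq_zero_iff]
  exact fun h => absurd (Nat.le_of_dvd h0 h) (by omega)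

theorem natCast_add_self_ne_zero {t n : ℕ} (hodd : Odd t) (h0 : 0 < n) (ht : n < t) :
    (n : ZMod t) + n ≠ 0 := by
  intro h
  have : ((2 * n : ℕ) : ZMod t) = 0 := by push_cast; rw [two_mul]; exact h
  rw [ZMod.natCast_eq_zero_iff] at this
  have := (Nat.Coprime.dvd_of_dvd_mul_left (Nat.coprime_two_right.2 hodd) this)
  exact absurd (Nat.le_of_dvd h0 this) (by omega)

theorem exists_coset_rep {t w : ℕ} [NeZero t] (x : ZMod t) :
    ∃ s ∈ (Finset.range (Nat.gcd w t)).image (Nat.cast : ℕ → ZMod t), ∃ k : ZMod t,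
      x = s + k * w := by
  have hg : 0 < Nat.gcd w t := Nat.gcd_pos_of_pos_right _ (NeZero.pos t)
  obtain ⟨k, hk⟩ := exists_mul_of_gcd_dvd (t := t) (h := w) (Nat.gcd w t * (x.val / Nat.gcd w t))
    (Dvd.intro _ rfl)
  refine ⟨((x.val % Nat.gcd w t : ℕ) : ZMod t), Finset.mem_image_of_mem _
    (Finset.mem_range.2 (Nat.mod_lt _ hg)), k, ?_⟩
  rw [← hk, ← Nat.cast_add, Nat.mod_add_div, ZMod.natCast_zmod_val]

theorem cov_consecutive_of_odd {t h : ℕ} (ht : Odd t) (h0 : 0 < h) (h1 : h + 1 < t) :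
    Cov (Steps (h : ZMod t) ((h + 1 : ℕ) : ZMod t)) 4 := by
  have : NeZero t := ⟨by omega⟩
  have hord : ∀ a : ZMod t, Odd (addOrderOf a) := fun a => by
    have := addOrderOf_dvd_card (x := a)
    rw [ZMod.card] at this
    exact Odd.of_dvd_nat ht this
  have a2 := natCast_add_self_ne_zero ht h0 (by omega)
  have b2 := natCast_add_self_ne_zero ht (Nat.succ_pos h) h1
  rcases le_total (Nat.gcd (h + 1) t) (Nat.gcd h t) with hle | hle
  · have : NeZero (Nat.gcd h t) := ⟨(Nat.gcd_pos_of_pos_left _ h0).ne'⟩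
    have G := gridData_zmod (t := t) (h := h) (w := (h + 1 : ℕ)) (by
      have := (ZMod.natCast_eq_zero_iff h (Nat.gcd h t)).2 (Nat.gcd_dvd_left h t)
      push_cast; rw [this, zero_add]) a2 (by simpa using b2)
    have := cov_steps_of_odd G (hord _)
      ((Finset.range (Nat.gcd (h + 1) t)).image (Nat.cast : ℕ → ZMod t)) (fun x => ?_)
      (Finset.card_image_le.trans (by rw [Finset.card_range]; exact hle))
    · simpa using this
    · obtain ⟨s, hs, k, hk⟩ := exists_coset_rep (w := h + 1) x
      refine ⟨s, hs, k.val, ?_⟩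
      rw [hk, nsmul_eq_mul, ZMod.natCast_zmod_val]; simp
  · have : NeZero (Nat.gcd (h + 1) t) := ⟨(Nat.gcd_pos_of_pos_left _ (Nat.succ_pos h)).ne'⟩
    have G := gridData_zmod (t := t) (h := h + 1) (w := -(h : ℤ)) (by
      have := (ZMod.natCast_eq_zero_iff (h + 1) (Nat.gcd (h + 1) t)).2 (Nat.gcd_dvd_left _ t)
      push_cast at this ⊢
      exact (eq_neg_of_add_eq_zero_right this).symm) b2 (by
        push_cast
        rw [← neg_add, neg_ne_zero]; exact a2)
    have := cov_steps_of_odd G (hord _)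
      ((Finset.range (Nat.gcd h t)).image (Nat.cast : ℕ → ZMod t)) (fun x => ?_)
      (Finset.card_image_le.trans (by rw [Finset.card_range]; exact hle))
    · obtain ⟨L, h1, h2, h3⟩ := this
      refine ⟨L, h1, h2, fun x y hxy => h3 x y ?_⟩
      simp only [Steps, Int.cast_neg, Int.cast_natCast, ← sub_eq_add_neg, sub_neg_eq_add] at hxy ⊢
      tauto
    · obtain ⟨s, hs, k, hk⟩ := exists_coset_rep (w := h) x
      refine ⟨s, hs, (-k).val, ?_⟩
      rw [hk, nsmul_eq_mul, ZMod.natCast_zmod_val]; simp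

theorem cov_one_of_even {t h : ℕ} (ht : Even t) (hh : Even h) (h0 : 0 < h) (h1 : 2 * h < t) :
    Cov (Steps (h : ZMod t) 1) 4 := by
  have : NeZero t := ⟨by omega⟩
  have : NeZero (Nat.gcd h t) := ⟨(Nat.gcd_pos_of_pos_left _ h0).ne'⟩
  have G := gridData_zmod (t := t) (h := h) (w := 1) (by simp)
    (by rw [← Nat.cast_add]; exact natCast_ne_zero (by omega) (by omega))
    (by
      have := natCast_ne_zero (t := t) (n := 2) (by omega) (by obtain ⟨k, rfl⟩ := hh; omega)
      push_cast at this ⊢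
      rwa [one_add_one_eq_two])
  have := cov_steps_of_even G ((Nat.dvd_gcd hh.two_dvd ht.two_dvd).elim fun k hk =>
    ⟨k, by rw [hk, two_mul]⟩) (by simpa using full_addRight isUnit_one)
  simpa using this

end

section

open Equiv Equiv.Perm

section Cov

variable {V : Type*}

theorem Cov.mono {W W' : V → V → Prop} {k : ℕ} (h : Cov W k) (hW : ∀ x y, W' x y → W x y) :
    Cov W' k := by
  obtain ⟨L, h1, h2, h3⟩ := h
  exact ⟨L, h1, h2, fun x y hxy => h3 x y (hW x y hxy)⟩

theorem Cov.or {W W' : V → V → Prop} {k l : ℕ} (h : Cov W k) (h' : Cov W' l) :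
    Cov (fun x y => W x y ∨ W' x y) (k + l) := by
  obtain ⟨L, h1, h2, h3⟩ := h
  obtain ⟨L', h1', h2', h3'⟩ := h'
  refine ⟨L ++ L', by simp [h1, h1'], ?_, ?_⟩
  · intro σ hσ
    rcases List.mem_append.1 hσ with hσ | hσ
    exacts [h2 σ hσ, h2' σ hσ]
  · rintro x y (h | h)
    · obtain ⟨σ, hσ, e⟩ := h3 x y h
      exact ⟨σ, List.mem_append_left _ hσ, e⟩
    · obtain ⟨σ, hσ, e⟩ := h3' x y h
      exact ⟨σ, List.mem_append_right _ hσ, e⟩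

theorem Cov.empty {W : V → V → Prop} (h : ∀ x y, ¬ W x y) : Cov W 0 :=
  ⟨[], rfl, by simp, fun x y hxy => absurd hxy (h x y)⟩

theorem cov_of_full {σ : Perm V} (h : Full σ) : Cov (fun x y => σ x = y) 1 :=
  ⟨[σ], rfl, by simpa using h, fun x y hxy => ⟨σ, by simp, hxy⟩⟩

theorem full_conj {σ : Perm V} (h : Full σ) (g : Perm V) : Full (g * σ * g⁻¹) := fun _ _ =>
  sameCycle_conj.2 (h _ _)

theorem Cov.conj {W : V → V → Prop} {k : ℕ} (h : Cov W k) (g : Perm V) :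
    Cov (fun x y => W (g⁻¹ x) (g⁻¹ y)) k := by
  obtain ⟨L, h1, h2, h3⟩ := h
  refine ⟨L.map fun σ => g * σ * g⁻¹, by simpa using h1, ?_, ?_⟩
  · intro σ hσ
    obtain ⟨σ', hσ', rfl⟩ := List.mem_map.1 hσ
    exact full_conj (h2 σ' hσ') g
  · intro x y hxy
    obtain ⟨σ, hσ, e⟩ := h3 _ _ hxy
    refine ⟨_, List.mem_map_of_mem hσ, ?_⟩
    rw [Perm.mul_apply, Perm.mul_apply, e]
    exact g.apply_symm_apply y

end Cov

/-- The arcs with difference in `S` are covered by `k` one-cycle permutations. -/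
def CovDiff {t : ℕ} (S : Set (ZMod t)) (k : ℕ) : Prop := Cov (fun x y : ZMod t => y - x ∈ S) k

/-- The residues `± j` with `lo < j ≤ hi`. -/
def symIoc (t lo hi : ℕ) : Set (ZMod t) :=
  {x | ∃ j : ℕ, lo < j ∧ j ≤ hi ∧ (x = j ∨ x = -j)}

variable {t : ℕ}

theorem CovDiff.union_of_subset {S S' T : Set (ZMod t)} {k l n : ℕ} (h : CovDiff S k)
    (h' : CovDiff S' l) (hT : T ⊆ S ∪ S') (hn : n = k + l) : CovDiff T n := by
  subst hn
  exact (Cov.or h h').mono fun x y hxy => hT hxy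

theorem CovDiff.mono {S T : Set (ZMod t)} {k : ℕ} (h : CovDiff S k) (hT : T ⊆ S) : CovDiff T k :=
  Cov.mono h fun _ _ hxy => hT hxy

theorem covDiff_of_steps {a b : ZMod t} {k : ℕ} (h : Cov (Steps a b) k) :
    CovDiff {a, -a, b, -b} k := by
  refine h.mono fun x y hxy => ?_
  simp only [Set.mem_insert_iff, Set.mem_singleton_iff, sub_eq_iff_eq_add] at hxy
  rcases hxy with h | h | h | h <;> rw [h] <;> unfold Steps
  · left; ring
  · right; left; ring
  · right; right; left; ring
  · right; right; right; ring

theorem covDiff_unit [NeZero t] {u : ZMod t} (hu : IsUnit u) : CovDiff {u} 1 :=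
  (cov_of_full (full_addRight hu)).mono fun x y hxy => by
    rw [Set.mem_singleton_iff, sub_eq_iff_eq_add'] at hxy
    exact hxy.symm

theorem covDiff_unit_symm [NeZero t] {u : ZMod t} (hu : IsUnit u) : CovDiff {u, -u} 2 :=
  (covDiff_unit hu).union_of_subset (covDiff_unit hu.neg) (fun _ hx => hx) rfl

theorem covDiff_symIoc_of_odd {M : ℕ} (n : ℕ) (hn : n ≤ M) :
    CovDiff (symIoc (2 * M + 1) (M - n) M) (2 * n) := by
  induction n using Nat.strong_induction_on with
  | _ n ih =>
    match n, ih with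
    | 0, _ =>
      refine Cov.empty ?_
      rintro x y ⟨j, h1, h2, -⟩
      omega
    | 1, _ =>
      have hu : IsUnit ((M : ℕ) : ZMod (2 * M + 1)) := by
        rw [ZMod.isUnit_iff_coprime]
        have : Nat.Coprime M (1 + M * 2) := by simp
        convert this using 1; ring
      refine (covDiff_unit_symm hu).mono ?_
      rintro x ⟨j, h1, h2, hj⟩
      have : j = M := by omega
      subst this
      simpa using hj
    | n + 2, ih =>
      refine (ih n (by omega) (by omega)).union_of_subset
        (covDiff_of_steps (cov_consecutive_of_odd (t := 2 * M + 1) (h := M - n - 1) ⟨M, rfl⟩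
          (by omega) (by omega))) ?_ (by ring)
      rintro x ⟨j, h1, h2, hj⟩
      by_cases hjn : M - n < j
      · exact Or.inl ⟨j, hjn, h2, hj⟩
      · right
        have : j = M - n - 1 ∨ j = M - n - 1 + 1 := by omega
        simp only [Set.mem_insert_iff, Set.mem_singleton_iff]
        rcases this with rfl | rfl <;> tauto

section Even

/-- The parity of a residue modulo an even number. -/
def par (ht : 2 ∣ t) : ZMod t →+* ZMod 2 := ZMod.castHom ht (ZMod 2)

/-- Translate even residues by `w` and odd residues by `v`. -/
def twist (ht : 2 ∣ t) (w v : ZMod t) (h : par ht w = par ht v) : Perm (ZMod t) where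
  toFun x := if par ht x = 0 then x + w else x + v
  invFun y := if par ht (y - w) = 0 then y - w else y - v
  left_inv x := by
    by_cases hx : par ht x = 0 <;> simp [hx, h]
  right_inv y := by
    by_cases hy : par ht (y - w) = 0 <;> simp only [hy, if_true, if_false]
    · simp
    · have : par ht (y - v) ≠ 0 := by rw [map_sub, ← h, ← map_sub]; exact hy
      rw [if_neg this, sub_add_cancel]

theorem twist_even {ht : 2 ∣ t} {w v : ZMod t} {h : par ht w = par ht v} {x : ZMod t}
    (hx : par ht x = 0) : twist ht w v h x = x + w := if_pos hx

theorem twist_odd {ht : 2 ∣ t} {w v : ZMod t} {h : par ht w = par ht v} {x : ZMod t}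
    (hx : par ht x ≠ 0) : twist ht w v h x = x + v := if_neg hx

theorem twist_inv_even {ht : 2 ∣ t} {c : ZMod t} {h : par ht 0 = par ht c} {x : ZMod t}
    (hx : par ht x = 0) : (twist ht 0 c h)⁻¹ x = x := by
  change (if par ht (x - 0) = 0 then x - 0 else x - c) = x
  simp [hx]

theorem twist_inv_odd {ht : 2 ∣ t} {c : ZMod t} {h : par ht 0 = par ht c} {x : ZMod t}
    (hx : par ht x ≠ 0) : (twist ht 0 c h)⁻¹ x = x - c := by
  change (if par ht (x - 0) = 0 then x - 0 else x - c) = x - c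
  simp [hx]

theorem par_eq_one {ht : 2 ∣ t} {x : ZMod t} (hx : par ht x ≠ 0) : par ht x = 1 := by
  have : ∀ y : ZMod 2, y ≠ 0 → y = 1 := by decide
  exact this _ hx

theorem par_natCast (ht : 2 ∣ t) (n : ℕ) : par ht (n : ZMod t) = 0 ↔ Even n := by
  rw [map_natCast, ZMod.natCast_eq_zero_iff, even_iff_two_dvd]

/-- The arcs of the Hamilton cycle alternating between steps `1 + c` and `1 - c`, in both
directions. -/
def HostArc (ht : 2 ∣ t) (c x y : ZMod t) : Prop :=
  (par ht x = 0 ∧ (y - x = c + 1 ∨ y - x = c - 1)) ∨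
    (par ht x ≠ 0 ∧ (y - x = -c + 1 ∨ y - x = -c - 1))

theorem hostArc_inv {ht : 2 ∣ t} {c x y : ZMod t} (hc : par ht 0 = par ht c)
    (h : HostArc ht c x y) :
    (twist ht 0 c hc)⁻¹ y = (twist ht 0 c hc)⁻¹ x + 1 ∨
      (twist ht 0 c hc)⁻¹ y = (twist ht 0 c hc)⁻¹ x - 1 := by
  have h2 : (1 : ZMod 2) + 1 = 0 := rfl
  rw [map_zero] at hc
  rcases h with ⟨hx, h⟩ | ⟨hx, h⟩
  · have hy : par ht y ≠ 0 := by
      rcases h with h | h <;> rw [sub_eq_iff_eq_add] at h <;> simp [h, hx, ← hc]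
    rw [twist_inv_even hx, twist_inv_odd hy]
    rcases h with h | h <;> rw [sub_eq_iff_eq_add] at h <;> rw [h]
    · left; ring
    · right; ring
  · have hx1 := par_eq_one hx
    have hy : par ht y = 0 := by
      rcases h with h | h <;> rw [sub_eq_iff_eq_add] at h <;> simp [h, hx1, ← hc, h2]
    rw [twist_inv_odd hx, twist_inv_even hy]
    rcases h with h | h <;> rw [sub_eq_iff_eq_add] at h <;> rw [h]
    · left; ring
    · right; ring

theorem cov_host [NeZero t] (ht : 2 ∣ t) {c : ZMod t} (hc : par ht c = 0) :
    Cov (HostArc ht c) 2 := by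
  have hc' : par ht 0 = par ht c := by rw [hc, map_zero]
  refine ((covDiff_unit_symm (t := t) isUnit_one).conj (twist ht 0 c hc')).mono ?_
  intro x y h
  rcases hostArc_inv hc' h with h | h <;> simp [h]

theorem cov_host_even (ht : 2 ∣ t) {c : ZMod t} (hc : par ht c = 0) {e : ℕ} (he : Even e)
    (h0 : 0 < e) (h1 : 2 * e < t) :
    Cov (fun x y => HostArc ht c x y ∨ y - x = e ∨ y - x = -e) 4 := by
  have hc' : par ht 0 = par ht c := by rw [hc, map_zero]
  refine ((cov_one_of_even (even_iff_two_dvd.2 ht) he h0 h1).conj (twist ht 0 c hc')).mono ?_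
  have hpe := (par_natCast ht e).2 he
  rintro x y (h | h | h)
  · rcases hostArc_inv hc' h with h | h <;> simp [h, Steps]
  · rw [sub_eq_iff_eq_add] at h
    left
    by_cases hx : par ht x = 0
    · have hy : par ht y = 0 := by simp [h, hx, hpe]
      rw [twist_inv_even hx, twist_inv_even hy, h]; ring
    · have hy : par ht y ≠ 0 := by simp [h, hx, hpe]
      rw [twist_inv_odd hx, twist_inv_odd hy, h]; ring
  · rw [sub_eq_iff_eq_add] at h
    right; left
    by_cases hx : par ht x = 0
    · have hy : par ht y = 0 := by simp [h, hx, hpe]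
      rw [twist_inv_even hx, twist_inv_even hy, h]; ring
    · have hy : par ht y ≠ 0 := by simp [h, hx, hpe]
      rw [twist_inv_odd hx, twist_inv_odd hy, h]; ring

theorem hostArc_or {ht : 2 ∣ t} {c x y : ZMod t}
    (h : y - x = c + 1 ∨ y - x = -(c + 1) ∨ y - x = c - 1 ∨ y - x = -(c - 1)) :
    HostArc ht c x y ∨ HostArc ht (-c) x y := by
  have e1 : -(c + 1) = -c - 1 := by ring
  have e2 : -(c - 1) = -c + 1 := by ring
  rw [e1, e2] at h
  unfold HostArc
  rw [neg_neg]
  by_cases hx : par ht x = 0 <;> simp only [hx] <;> tauto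

theorem covDiff_block (ht : 2 ∣ t) {c e e' : ℕ} (hc : Even c) (he : Even e) (h0 : 0 < e)
    (h1 : 2 * e < t) (he' : Even e') (h0' : 0 < e') (h1' : 2 * e' < t) :
    CovDiff {x : ZMod t | (x = (c : ZMod t) + 1 ∨ x = -((c : ZMod t) + 1) ∨ x = (c : ZMod t) - 1 ∨
      x = -((c : ZMod t) - 1)) ∨ (x = e ∨ x = -e) ∨ (x = e' ∨ x = -e')} 8 := by
  have hc' := (par_natCast ht c).2 hc
  refine ((cov_host_even ht hc' he h0 h1).or (cov_host_even ht (c := -(c : ZMod t))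
    (by rw [map_neg, hc', neg_zero]) he' h0' h1')).mono ?_
  rintro x y (h | h | h)
  · rcases hostArc_or (ht := ht) h with h | h <;> tauto
  · tauto
  · tauto

theorem covDiff_symIoc_of_even {m : ℕ} (q : ℕ) (hq : q < m) :
    CovDiff (symIoc (2 * m) 0 q) (2 * q) := by
  have : NeZero (2 * m) := ⟨by omega⟩
  have ht : 2 ∣ 2 * m := Dvd.intro _ rfl
  induction q using Nat.strong_induction_on with
  | _ q ih =>
    match q, ih with
    | 0, _ =>
      refine Cov.empty ?_
      rintro x y ⟨j, h1, h2, -⟩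
      omega
    | 1, _ =>
      refine (covDiff_unit_symm isUnit_one).mono ?_
      rintro x ⟨j, h1, h2, hj⟩
      have : j = 1 := by omega
      subst this
      simpa using hj
    | 2, _ =>
      refine (covDiff_of_steps (cov_one_of_even (t := 2 * m) (h := 2) (even_iff_two_dvd.2 ht)
        even_two (by omega) (by omega))).mono ?_
      rintro x ⟨j, h1, h2, hj⟩
      simp only [Set.mem_insert_iff, Set.mem_singleton_iff]
      have : j = 1 ∨ j = 2 := by omega
      rcases this with rfl | rfl
      · rw [Nat.cast_one] at hj; tauto
      · tauto
    | 3, _ =>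
      have hc := (par_natCast ht 2).2 even_two
      refine ((cov_host_even ht hc even_two (by omega) (by omega)).or
        (cov_host ht (c := -((2 : ℕ) : ZMod (2 * m))) (by rw [map_neg, hc, neg_zero]))).mono ?_
      rintro x y ⟨j, h1, h2, hj⟩
      have : j = 2 ∨ j = 1 ∨ j = 3 := by omega
      rcases this with rfl | h
      · tauto
      have e : y - x = ((2 : ℕ) : ZMod (2 * m)) + 1 ∨ y - x = -(((2 : ℕ) : ZMod (2 * m)) + 1) ∨
          y - x = ((2 : ℕ) : ZMod (2 * m)) - 1 ∨ y - x = -(((2 : ℕ) : ZMod (2 * m)) - 1) := by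
        have e1 : ((2 : ℕ) : ZMod (2 * m)) - 1 = 1 := by push_cast; ring
        have e3 : ((2 : ℕ) : ZMod (2 * m)) + 1 = 3 := by push_cast; ring
        rw [e1, e3]
        rcases h with rfl | rfl <;> push_cast at hj <;> tauto
      rcases hostArc_or (ht := ht) e with h | h <;> tauto
    | n + 4, ih =>
      have key : ∀ c e e' : ℕ, Even c → Even e → Even e' → 0 < e → 0 < e' → e ≤ n + 4 →
          e' ≤ n + 4 → 0 < c → (∀ j, n < j → j ≤ n + 4 → j = c + 1 ∨ j + 1 = c ∨ j = e ∨ j = e') →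
          CovDiff (symIoc (2 * m) 0 (n + 4)) (2 * (n + 4)) := by
        intro c e e' hc he he' h0 h0' h1 h1' hc0 H
        refine (ih n (by omega) (by omega)).union_of_subset
          (covDiff_block ht hc he h0 (by omega) he' h0' (by omega)) ?_ (by ring)
        rintro x ⟨j, h1, h2, hj⟩
        by_cases hjn : j ≤ n
        · exact Or.inl ⟨j, h1, hjn, hj⟩
        · right
          simp only [Set.mem_ofPred_eq]
          rcases H j (by omega) h2 with rfl | rfl | rfl | rfl
          · push_cast at hj; tauto
          · push_cast; rw [add_sub_cancel_right]; tauto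
          · tauto
          · tauto
      rcases Nat.even_or_odd n with hn | hn
      · exact key (n + 2) (n + 2) (n + 4) (by obtain ⟨k, rfl⟩ := hn; exact ⟨k + 1, by ring⟩)
          (by obtain ⟨k, rfl⟩ := hn; exact ⟨k + 1, by ring⟩)
          (by obtain ⟨k, rfl⟩ := hn; exact ⟨k + 2, by ring⟩) (by omega) (by omega)
          (by omega) (by omega) (by omega) (by omega)
      · exact key (n + 3) (n + 1) (n + 3) (by obtain ⟨k, rfl⟩ := hn; exact ⟨k + 2, by ring⟩)
          (by obtain ⟨k, rfl⟩ := hn; exact ⟨k + 1, by ring⟩)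
          (by obtain ⟨k, rfl⟩ := hn; exact ⟨k + 2, by ring⟩) (by omega) (by omega)
          (by omega) (by omega) (by omega) (by omega)

theorem full_twist [NeZero t] (ht : 2 ∣ t) {w v : ZMod t} (hw : par ht w = 1)
    (hv : par ht v = 1) (hgen : ∀ x, ∃ k : ZMod t, 2 * x = k * (w + v)) :
    Full (twist ht w v (hw.trans hv.symm)) := by
  have h2 : (1 : ZMod 2) + 1 = 0 := rfl
  set κ := twist ht w v (hw.trans hv.symm) with hκ
  have two : ∀ x, par ht x = 0 → κ.SameCycle x (x + (w + v)) := by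
    intro x hx
    have e1 : κ x = x + w := twist_even hx
    have e2 : κ (x + w) = x + (w + v) := by
      rw [hκ, twist_odd, add_assoc]
      rw [map_add, hx, hw]; decide
    exact (Adj.sameCycle (Or.inl e1)).trans (Adj.sameCycle (Or.inl e2))
  have many : ∀ k : ℕ, κ.SameCycle 0 (k * (w + v)) := by
    intro k
    induction k with
    | zero => simpa using SameCycle.refl _ _
    | succ k ih =>
      refine ih.trans ?_
      have := two (k * (w + v)) (by rw [map_mul, map_add, hw, hv, h2, mul_zero])
      rwa [Nat.cast_add_one, add_mul, one_mul]
  have even : ∀ x, par ht x = 0 → κ.SameCycle 0 x := by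
    intro x hx
    have hx' : Even x.val := by
      rw [← par_natCast ht, ZMod.natCast_zmod_val]; exact hx
    obtain ⟨n, hn⟩ := hx'
    have e : x = 2 * (n : ZMod t) := by
      rw [two_mul, ← Nat.cast_add, ← hn, ZMod.natCast_zmod_val]
    obtain ⟨k, hk⟩ := hgen n
    have := many k.val
    rwa [ZMod.natCast_zmod_val, ← hk, ← e] at this
  have all : ∀ x, κ.SameCycle 0 x := by
    intro x
    by_cases hx : par ht x = 0
    · exact even x hx
    · have e1 : κ x = x + v := twist_odd hx
      refine (even (x + v) ?_).trans (Adj.sameCycle (Or.inr e1))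
      rw [map_add, par_eq_one hx, hv, h2]
  exact fun u v => (all u).symm.trans (all v)

theorem covDiff_triple {m : ℕ} (hm : Odd m) (h2 : 2 ≤ m) :
    CovDiff {(m : ZMod (2 * m)) - 2, (m : ZMod (2 * m)), (m : ZMod (2 * m)) + 2} 3 := by
  have : NeZero (2 * m) := ⟨by omega⟩
  have ht : 2 ∣ 2 * m := Dvd.intro _ rfl
  have e2 : par ht (2 : ZMod (2 * m)) = 0 := by
    have := (par_natCast ht 2).2 even_two
    exact_mod_cast this
  have p0 : par ht (m : ZMod (2 * m)) = 1 :=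
    par_eq_one (by rw [Ne, par_natCast]; exact Nat.not_even_iff_odd.2 hm)
  have p1 : par ht ((m : ZMod (2 * m)) - 2) = 1 := by rw [map_sub, p0, e2, sub_zero]
  have hmm : (m : ZMod (2 * m)) + m = 0 := by
    have := ZMod.natCast_self (2 * m)
    rw [← Nat.cast_add, ← two_mul]; exact this
  have F1 := full_twist ht p1 p0 (fun x => ⟨-x, by linear_combination x * hmm⟩)
  have F2 := full_twist ht p0 p1 (fun x => ⟨-x, by linear_combination x * hmm⟩)
  have hu : IsUnit ((m : ZMod (2 * m)) + 2) := by
    have : IsUnit ((m + 2 : ℕ) : ZMod (2 * m)) := by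
      rw [ZMod.isUnit_iff_coprime]
      refine Nat.Coprime.mul_right ?_ ?_
      · rw [Nat.coprime_two_right]; exact hm.add_even even_two
      · simpa [Nat.coprime_comm] using hm
    simpa using this
  refine ((cov_of_full F1).or ((cov_of_full F2).or (covDiff_unit hu))).mono ?_
  rintro x y (h | h | h)
  · rw [sub_eq_iff_eq_add'] at h
    by_cases hx : par ht x = 0
    · exact Or.inl (by rw [twist_even hx, h])
    · exact Or.inr (Or.inl (by rw [twist_odd hx, h]))
  · rw [sub_eq_iff_eq_add'] at h
    by_cases hx : par ht x = 0
    · exact Or.inr (Or.inl (by rw [twist_even hx, h]))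
    · exact Or.inl (by rw [twist_odd hx, h])
  · exact Or.inr (Or.inr h)

theorem isUnit_half_add_one {m : ℕ} (hm : Even m) : IsUnit ((m : ZMod (2 * m)) + 1) := by
  obtain ⟨k, rfl⟩ := hm
  have : ((2 * (k + k) : ℕ) : ZMod (2 * (k + k))) = 0 := ZMod.natCast_self _
  push_cast at this ⊢
  exact IsUnit.of_mul_eq_one (k + k + 1) (by linear_combination (k + 1) * this)

end Even

end

section

open Equiv Equiv.Perm

theorem cycleType_permCongr {V W : Type*} [Fintype V] [DecidableEq V] [Fintype W] [DecidableEq W]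
    (e : V ≃ W) (σ : Perm V) : (e.permCongr σ).cycleType = σ.cycleType := by
  have := cycleType_extendDomain (p := fun _ : W => True)
    (e.trans (Equiv.subtypeUnivEquiv (fun _ => trivial)).symm) (g := σ)
  rw [← this]
  congr 1

/-- A covering family of permutations with the right size and cycle type is a solution. -/
theorem hasOPSolution_of_cover {ι V : Type*} [Fintype ι] [Fintype V] [DecidableEq V] {m : List ℕ}
    (hV : Fintype.card V = m.sum) (hι : Fintype.card ι = m.sum - 1) (F : ι → Perm V)
    (hF : ∀ i, (F i).cycleType = (m : Multiset ℕ)) (hcov : ∀ x y, x ≠ y → ∃ i, F i x = y) :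
    HasOPSolution m := by
  have hne : ∀ i x, F i x ≠ x := by
    intro i x
    have h1 := sum_cycleType (F i)
    rw [hF i, Multiset.sum_coe, ← hV] at h1
    have : (F i).support = Finset.univ := (Finset.card_eq_iff_eq_univ _).1 h1.symm
    exact mem_support.1 (this ▸ Finset.mem_univ x)
  have huniq : ∀ x y, x ≠ y → ∃! i, F i x = y := by
    intro x y hxy
    let f : ι → {z // z ≠ x} := fun i => ⟨F i x, hne i x⟩
    have hs : Function.Surjective f := fun ⟨z, hz⟩ => by
      obtain ⟨i, hi⟩ := hcov x z (Ne.symm hz)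
      exact ⟨i, Subtype.ext hi⟩
    have hb : Function.Bijective f := by
      rw [Fintype.bijective_iff_surjective_and_card]
      refine ⟨hs, ?_⟩
      rw [hι, ← hV, Fintype.card_subtype_compl, Fintype.card_subtype_eq]
    obtain ⟨i, hi⟩ := hcov x y hxy
    exact ⟨i, hi, fun j hj => hb.1 (Subtype.ext (hj.trans hi.symm))⟩
  let e : V ≃ Fin m.sum := Fintype.equivFinOfCardEq hV
  let g : ι ≃ Fin (m.sum - 1) := Fintype.equivFinOfCardEq hι
  refine ⟨fun i => e.permCongr (F (g.symm i)), fun i => ?_, fun x y hxy => ?_⟩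
  · rw [cycleType_permCongr, hF]
  · obtain ⟨i, hi, hu⟩ := huniq (e.symm x) (e.symm y) (e.symm.injective.ne hxy)
    refine ⟨g i, by simp [hi], fun j hj => ?_⟩
    have := hu (g.symm j) (by
      have hj' : e (F (g.symm j) (e.symm x)) = y := hj
      rw [← hj', Equiv.symm_apply_apply])
    rw [← this, Equiv.apply_symm_apply]

theorem cycleType_of_full {V : Type*} [Fintype V] [DecidableEq V] {σ : Perm V} (h : Full σ)
    (hV : 2 ≤ Fintype.card V) : σ.cycleType = {Fintype.card V} := by
  obtain ⟨x, y, hxy⟩ := Fintype.exists_pair_of_one_lt_card (by omega : 1 < Fintype.card V)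
  have hne : ∀ z, σ z ≠ z := by
    intro z hz
    have : ∀ w, w = z := fun w => by
      obtain ⟨n, hn⟩ := h z w
      rw [← hn, zpow_apply_eq_self_of_apply_eq_self hz]
    exact hxy ((this x).trans (this y).symm)
  have hc : σ.IsCycle := ⟨x, hne x, fun w _ => h x w⟩
  have hs : σ.support = Finset.univ := Finset.eq_univ_iff_forall.2 fun z => mem_support.2 (hne z)
  rw [hc.cycleType, hs, Finset.card_univ]

theorem cycleType_sumCongr {V W : Type*} [Fintype V] [DecidableEq V] [Fintype W] [DecidableEq W]
    (σ : Perm V) (ρ : Perm W) :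
    (Perm.sumCongr σ ρ).cycleType = σ.cycleType + ρ.cycleType := by
  have h : (Perm.sumCongr σ ρ) =
      (Perm.sumCongr σ 1 : Perm (V ⊕ W)) * (Perm.sumCongr 1 ρ : Perm (V ⊕ W)) := by
    ext (x | x) <;> rfl
  have hd : Perm.Disjoint (Perm.sumCongr σ 1 : Perm (V ⊕ W))
      (Perm.sumCongr 1 ρ : Perm (V ⊕ W)) := by
    rintro (x | x)
    · exact Or.inr rfl
    · exact Or.inl rfl
  rw [h, hd.cycleType_mul]
  congr 1
  · classical
    rw [← cycleType_extendDomain (Equiv.ofInjective (Sum.inl : V → V ⊕ W) Sum.inl_injective)]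
    congr 1
    ext (x | x) : 1
    · exact (Perm.extendDomain_apply_image σ (Equiv.ofInjective _ Sum.inl_injective) x).symm
    · exact (Perm.extendDomain_apply_not_subtype _ _ (by simp)).symm
  · classical
    rw [← cycleType_extendDomain (Equiv.ofInjective (Sum.inr : W → V ⊕ W) Sum.inr_injective)]
    congr 1
    ext (x | x) : 1
    · exact (Perm.extendDomain_apply_not_subtype _ _ (by simp)).symm
    · exact (Perm.extendDomain_apply_image ρ (Equiv.ofInjective _ Sum.inr_injective) x).symm

theorem formPerm_apply_of_infix {α : Type*} [DecidableEq α] {l : List α} (hl : l.Nodup) {x y : α}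
    (h : [x, y] <:+: l) : l.formPerm x = y := by
  obtain ⟨a, b, rfl⟩ := h
  have := List.formPerm_apply_lt_getElem _ hl a.length (by simp)
  simpa using this

theorem cycleType_formPerm {α : Type*} [Fintype α] [DecidableEq α] {l : List α} (hl : l.Nodup)
    (h : 2 ≤ l.length) : l.formPerm.cycleType = {l.length} := by
  rw [(List.isCycle_formPerm hl h).cycleType, List.support_formPerm_of_nodup l hl
    (fun x e => by rw [e] at h; simp at h), List.toFinset_card_of_nodup hl]

theorem cycleType_formPerm_three {α : Type*} [Fintype α] [DecidableEq α] {l₁ l₂ l₃ : List α}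
    (hl : (l₁ ++ l₂ ++ l₃).Nodup) (h₁ : 2 ≤ l₁.length) (h₂ : 2 ≤ l₂.length)
    (h₃ : 2 ≤ l₃.length) : (l₁.formPerm * l₂.formPerm * l₃.formPerm).cycleType =
      (([l₁.length, l₂.length, l₃.length] : List ℕ) : Multiset ℕ) := by
  obtain ⟨hl12, hn3, hd3⟩ := List.nodup_append'.1 hl
  obtain ⟨hn1, hn2, hd12⟩ := List.nodup_append'.1 hl12
  rw [List.disjoint_append_left] at hd3
  have d12 := (List.formPerm_disjoint_iff hn1 hn2 h₁ h₂).2 hd12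
  have d13 := (List.formPerm_disjoint_iff hn1 hn3 h₁ h₃).2 hd3.1
  have d23 := (List.formPerm_disjoint_iff hn2 hn3 h₂ h₃).2 hd3.2
  rw [(d13.mul_left d23).cycleType_mul, d12.cycleType_mul, cycleType_formPerm hn1 h₁,
    cycleType_formPerm hn2 h₂, cycleType_formPerm hn3 h₃]
  rfl

/-- Three disjoint lists give a permutation with three cycles. -/
theorem exists_perm_of_lists {α : Type*} [Fintype α] [DecidableEq α] {l₁ l₂ l₃ : List α}
    (hl : (l₁ ++ l₂ ++ l₃).Nodup) (h₁ : 2 ≤ l₁.length) (h₂ : 2 ≤ l₂.length)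
    (h₃ : 2 ≤ l₃.length) : ∃ π : Perm α,
    π.cycleType = (([l₁.length, l₂.length, l₃.length] : List ℕ) : Multiset ℕ) ∧
    ∀ x y, ([x, y] <:+: l₁ ∨ [x, y] <:+: l₂ ∨ [x, y] <:+: l₃) → π x = y := by
  obtain ⟨hl12, hn3, hd3⟩ := List.nodup_append'.1 hl
  obtain ⟨hn1, hn2, hd12⟩ := List.nodup_append'.1 hl12
  rw [List.disjoint_append_left] at hd3
  refine ⟨l₁.formPerm * l₂.formPerm * l₃.formPerm, cycleType_formPerm_three hl h₁ h₂ h₃, ?_⟩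
  · rintro x y (h | h | h)
    all_goals
      have hx := h.subset (by simp : x ∈ [x, y])
      have hy := h.subset (by simp : y ∈ [x, y])
      rw [Perm.mul_apply, Perm.mul_apply]
    · rw [List.formPerm_apply_of_notMem (fun h => hd3.1 hx h),
        List.formPerm_apply_of_notMem (fun h => hd12 hx h), formPerm_apply_of_infix hn1 h]
    · rw [List.formPerm_apply_of_notMem (fun h => hd3.2 hx h), formPerm_apply_of_infix hn2 h,
        List.formPerm_apply_of_notMem (fun h => hd12 h hy)]
    · rw [formPerm_apply_of_infix hn3 h, List.formPerm_apply_of_notMem (fun h => hd3.2 h hy),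
        List.formPerm_apply_of_notMem (fun h => hd3.1 h hy)]

/-- If a starter permutation of `Fin s ⊕ ZMod t` exists for the differences outside `S`, and
the differences in `S` are covered by one-cycle permutations, the solution extends. -/
theorem hasOPSolution_of_starter {m₁ m₂ t : ℕ} [NeZero t] (ht : 2 ≤ t) (hs : 0 < m₁ + m₂)
    (hsol : HasOPSolution [m₁, m₂]) {S : Set (ZMod t)} (hS : CovDiff S (m₁ + m₂ - 1))
    (π : Perm (Fin [m₁, m₂].sum ⊕ ZMod t))
    (hπ : π.cycleType = (([m₁, m₂, t] : List ℕ) : Multiset ℕ))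
    (hA : ∀ a, ∃ b, π (Sum.inl a) = Sum.inr b)
    (hB : ∀ d ∉ S, d ≠ 0 → ∃ b, π (Sum.inr b) = Sum.inr (b + d)) :
    HasOPSolution [m₁, m₂, t] := by
  obtain ⟨σ, hσ, hσc⟩ := hsol
  obtain ⟨L, hL, hLf, hLc⟩ := hS
  let T : ZMod t → Perm (Fin [m₁, m₂].sum ⊕ ZMod t) := fun j => Perm.sumCongr 1 (Equiv.addRight j)
  let F : Fin ([m₁, m₂].sum - 1) ⊕ ZMod t → Perm (Fin [m₁, m₂].sum ⊕ ZMod t) :=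
    Sum.elim (fun i => Perm.sumCongr (σ i) (L.get (i.cast (by simp [hL]))))
      (fun j => T j * π * (T j)⁻¹)
  have hTF : ∀ j x, F (Sum.inr j) (T j x) = T j (π x) := by
    intro j x
    change T j (π ((T j).symm (T j x))) = _
    rw [(T j).symm_apply_apply]
  have hTl : ∀ j a, T j (Sum.inl a) = Sum.inl a := fun _ _ => rfl
  have hTr : ∀ j b, T j (Sum.inr b) = Sum.inr (b + j) := fun _ _ => rfl
  have hF : ∀ i, (F i).cycleType = (([m₁, m₂, t] : List ℕ) : Multiset ℕ) := by
    rintro (i | j)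
    · change (Perm.sumCongr (σ i) _).cycleType = _
      rw [cycleType_sumCongr, hσ, cycleType_of_full (hLf _ (List.get_mem _ _))
        (by rw [ZMod.card]; exact ht), ZMod.card]
      rfl
    · change (T j * π * (T j)⁻¹).cycleType = _
      rw [cycleType_conj, hπ]
  refine hasOPSolution_of_cover (ι := Fin ([m₁, m₂].sum - 1) ⊕ ZMod t) ?_ ?_ F hF ?_
  · simp [ZMod.card]; ring
  · simp [ZMod.card]; omega
  rintro (a | x) (a' | y) hxy
  · obtain ⟨i, hi, -⟩ := hσc a a' (fun h => hxy (by rw [h]))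
    exact ⟨Sum.inl i, congrArg Sum.inl hi⟩
  · obtain ⟨b, hb⟩ := hA a
    refine ⟨Sum.inr (y - b), ?_⟩
    have := hTF (y - b) (Sum.inl a)
    rw [hb, hTl, hTr, add_sub_cancel] at this
    exact this
  · obtain ⟨z, hz⟩ := π.surjective (Sum.inl a')
    obtain (a | b) := z
    · obtain ⟨b, hb⟩ := hA a
      rw [hb] at hz; simp at hz
    · refine ⟨Sum.inr (x - b), ?_⟩
      have := hTF (x - b) (Sum.inr b)
      rw [hz, hTl, hTr, add_sub_cancel] at this
      exact this
  · have hd : y - x ≠ 0 := fun h => hxy (by rw [sub_eq_zero.1 h])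
    by_cases hyx : y - x ∈ S
    · obtain ⟨ρ, hρ, e⟩ := hLc x y hyx
      obtain ⟨n, rfl⟩ := List.get_of_mem hρ
      exact ⟨Sum.inl (n.cast (by simp [hL])), congrArg Sum.inr e⟩
    · obtain ⟨b, hb⟩ := hB _ hyx hd
      refine ⟨Sum.inr (x - b), ?_⟩
      have := hTF (x - b) (Sum.inr b)
      rw [hb, hTr, hTr, add_sub_cancel] at this
      rw [this]
      congr 1
      ring

end

section

open Equiv Equiv.Perm

section Weave

variable {α β : Type*}

/-- Insert the `a`s before the successive blocks of `b`s. -/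
def weave : List α → List (List β) → List (α ⊕ β)
  | a :: as, p :: ps => Sum.inl a :: (p.map Sum.inr ++ weave as ps)
  | _, _ => []

theorem weave_perm : ∀ (as : List α) (ps : List (List β)), as.length = ps.length →
    (weave as ps).Perm (as.map Sum.inl ++ ps.flatten.map Sum.inr)
  | [], [], _ => by simp [weave]
  | a :: as, p :: ps, h => by
    simp only [weave, List.map_cons, List.flatten_cons, List.map_append, List.cons_append]
    refine List.Perm.cons _ ?_
    refine ((weave_perm as ps (by simpa using h)).append_left _).trans ?_
    rw [← List.append_assoc, ← List.append_assoc]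
    exact List.perm_append_comm.append_right _

theorem append_interchange_perm (a₁ b₁ a₂ b₂ a₃ b₃ : List α) :
    ((a₁ ++ b₁) ++ (a₂ ++ b₂) ++ (a₃ ++ b₃)).Perm ((a₁ ++ a₂ ++ a₃) ++ (b₁ ++ b₂ ++ b₃)) := by
  classical
  rw [List.perm_iff_count]
  intro x
  simp only [List.count_append]
  ring

theorem weave_length (as : List α) (ps : List (List β)) (h : as.length = ps.length) :
    (weave as ps).length = as.length + ps.flatten.length := by
  rw [(weave_perm as ps h).length_eq, List.length_append, List.length_map, List.length_map]

theorem exists_infix_weave_left : ∀ (as : List α) (ps : List (List β)), as.length = ps.length →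
    (∀ p ∈ ps, p ≠ []) → ∀ a ∈ as, ∃ b, [Sum.inl a, Sum.inr b] <:+: weave as ps
  | a' :: as, [] :: ps, _, hp, a, ha => absurd rfl (hp [] (by simp))
  | a' :: as, (b :: p) :: ps, h, hp, a, ha => by
    rcases List.mem_cons.1 ha with rfl | ha
    · exact ⟨b, [], p.map Sum.inr ++ weave as ps, by simp [weave]⟩
    · obtain ⟨b', hb'⟩ := exists_infix_weave_left as ps (by simpa using h)
        (fun p hp' => hp p (by simp [hp'])) a ha
      refine ⟨b', hb'.trans ⟨Sum.inl a' :: (b :: p).map Sum.inr, [], by simp [weave]⟩⟩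

theorem infix_weave_right : ∀ (as : List α) (ps : List (List β)), as.length = ps.length →
    ∀ p ∈ ps, ∀ x y, [x, y] <:+: p → [Sum.inr x, Sum.inr y] <:+: weave as ps
  | a :: as, p' :: ps, h, p, hp, x, y, hxy => by
    rcases List.mem_cons.1 hp with rfl | hp
    · refine (hxy.map Sum.inr).trans ⟨[Sum.inl a], weave as ps, by simp [weave]⟩
    · exact (infix_weave_right as ps (by simpa using h) p hp x y hxy).trans
        ⟨Sum.inl a :: p'.map Sum.inr, [], by simp [weave]⟩
  | [], [], _, p, hp, _, _, _ => by simp at hp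

end Weave

theorem hasOPSolution_of_blocks {m₁ m₂ t : ℕ} [NeZero t] (h₁ : 2 ≤ m₁) (h₂ : 2 ≤ m₂) (ht : 2 ≤ t)
    (hsol : HasOPSolution [m₁, m₂]) {S : Set (ZMod t)} (hS : CovDiff S (m₁ + m₂ - 1))
    (ps₁ ps₂ ps₃ : List (List (ZMod t)))
    (hlen : ps₁.length + ps₂.length + ps₃.length = m₁ + m₂)
    (hl₁ : ps₁.length + ps₁.flatten.length = m₁) (hl₂ : ps₂.length + ps₂.flatten.length = m₂)
    (hl₃ : ps₃.length + ps₃.flatten.length = t)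
    (hne : ∀ p ∈ ps₁ ++ ps₂ ++ ps₃, p ≠ [])
    (hnd : (ps₁.flatten ++ ps₂.flatten ++ ps₃.flatten).Nodup)
    (hB : ∀ d ∉ S, d ≠ 0 → ∃ b, ∃ p ∈ ps₁ ++ ps₂ ++ ps₃, [b, b + d] <:+: p) :
    HasOPSolution [m₁, m₂, t] := by
  have hsum : [m₁, m₂].sum = m₁ + m₂ := by simp
  set A := List.finRange [m₁, m₂].sum with hA
  have hAlen : A.length = m₁ + m₂ := by rw [hA, List.length_finRange, hsum]
  set A₁ := A.take ps₁.length with hA₁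
  set A₂ := (A.drop ps₁.length).take ps₂.length with hA₂
  set A₃ := (A.drop ps₁.length).drop ps₂.length with hA₃
  have hAA : A₁ ++ A₂ ++ A₃ = A := by
    rw [List.append_assoc, hA₂, hA₃, List.take_append_drop, hA₁, List.take_append_drop]
  have e₁ : A₁.length = ps₁.length := by rw [hA₁, List.length_take]; omega
  have e₂ : A₂.length = ps₂.length := by rw [hA₂, List.length_take, List.length_drop]; omega
  have e₃ : A₃.length = ps₃.length := by rw [hA₃, List.length_drop, List.length_drop]; omega
  have hnodup : (weave A₁ ps₁ ++ weave A₂ ps₂ ++ weave A₃ ps₃).Nodup := by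
    have hp : (weave A₁ ps₁ ++ weave A₂ ps₂ ++ weave A₃ ps₃).Perm
        ((A₁ ++ A₂ ++ A₃).map Sum.inl ++
          (ps₁.flatten ++ ps₂.flatten ++ ps₃.flatten).map Sum.inr) := by
      refine (((weave_perm _ _ e₁).append (weave_perm _ _ e₂)).append
        (weave_perm _ _ e₃)).trans ?_
      simp only [List.map_append]
      exact append_interchange_perm _ _ _ _ _ _
    rw [hp.nodup_iff, hAA, List.nodup_append']
    refine ⟨(List.nodup_finRange _).map Sum.inl_injective, hnd.map Sum.inr_injective, ?_⟩
    intro x hx hx'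
    obtain ⟨a, -, rfl⟩ := List.mem_map.1 hx
    obtain ⟨b, -, hb⟩ := List.mem_map.1 hx'
    cases hb
  obtain ⟨π, hπ, hinf⟩ := exists_perm_of_lists hnodup
    (by rw [weave_length _ _ e₁]; omega) (by rw [weave_length _ _ e₂]; omega)
    (by rw [weave_length _ _ e₃]; omega)
  rw [weave_length _ _ e₁, weave_length _ _ e₂, weave_length _ _ e₃, e₁, e₂, e₃, hl₁, hl₂,
    hl₃] at hπ
  refine hasOPSolution_of_starter ht (by omega) hsol hS π hπ ?_ ?_
  · intro a
    have ha : a ∈ A₁ ++ A₂ ++ A₃ := by rw [hAA]; exact List.mem_finRange a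
    simp only [List.mem_append] at ha hne
    rcases ha with (ha | ha) | ha
    · obtain ⟨b, hb⟩ := exists_infix_weave_left _ _ e₁ (fun p hp => hne p (by tauto)) a ha
      exact ⟨b, hinf _ _ (Or.inl hb)⟩
    · obtain ⟨b, hb⟩ := exists_infix_weave_left _ _ e₂ (fun p hp => hne p (by tauto)) a ha
      exact ⟨b, hinf _ _ (Or.inr (Or.inl hb))⟩
    · obtain ⟨b, hb⟩ := exists_infix_weave_left _ _ e₃ (fun p hp => hne p (by tauto)) a ha
      exact ⟨b, hinf _ _ (Or.inr (Or.inr hb))⟩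
  · intro d hd hd0
    obtain ⟨b, p, hp, hbp⟩ := hB d hd hd0
    simp only [List.mem_append] at hp
    refine ⟨b, hinf _ _ ?_⟩
    rcases hp with (hp | hp) | hp
    · exact Or.inl (infix_weave_right _ _ e₁ p hp _ _ hbp)
    · exact Or.inr (Or.inl (infix_weave_right _ _ e₂ p hp _ _ hbp))
    · exact Or.inr (Or.inr (infix_weave_right _ _ e₃ p hp _ _ hbp))

theorem flatten_map_singleton' {α : Type*} (l : List α) : (l.map fun x => [x]).flatten = l := by
  induction l with
  | nil => rfl
  | cons a l ih => simpa using ih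

/-- Two long paths and a few disjoint arcs, realizing every difference outside `S`, suffice. -/
theorem hasOPSolution_of_paths {m₁ m₂ t u : ℕ} (h₁ : 2 ≤ m₁) (h₂ : 2 ≤ m₂)
    (htu : t = m₁ + m₂ + u) (hsol : HasOPSolution [m₁, m₂]) {S : Set (ZMod t)}
    (hS : CovDiff S (m₁ + m₂ - 1)) (P Q : List (ZMod t)) (E : List (List (ZMod t)))
    (hP : P ≠ []) (hQ : Q ≠ []) (hE : ∀ e ∈ E, e.length = 2)
    (hEl : E.length = m₁ % 2 + m₂ % 2) (hlen : P.length + Q.length + E.length = u + 2)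
    (hnd : (P ++ Q ++ E.flatten).Nodup)
    (hB : ∀ d ∉ S, d ≠ 0 → ∃ b, ∃ p ∈ P :: Q :: E, [b, b + d] <:+: p) :
    HasOPSolution [m₁, m₂, t] := by
  classical
  have : NeZero t := ⟨by omega⟩
  have hflat : ∀ l : List (List (ZMod t)), (∀ e ∈ l, e.length = 2) →
      l.flatten.length = 2 * l.length := by
    intro l hl
    induction l with
    | nil => rfl
    | cons a l ih =>
      rw [List.flatten_cons, List.length_append, ih fun e he => hl e (by simp [he]),
        hl a (by simp), List.length_cons]; ring
  set R := (Finset.univ \ (P ++ Q ++ E.flatten).toFinset).toList with hR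
  have hRlen : R.length + (P.length + Q.length + 2 * E.length) = t := by
    rw [hR, Finset.length_toList, Finset.card_sdiff_of_subset (Finset.subset_univ _),
      List.toFinset_card_of_nodup hnd, Finset.card_univ, ZMod.card]
    have := hnd.length_le_card
    rw [ZMod.card] at this
    simp only [List.length_append, hflat E hE] at this ⊢
    omega
  have hRnd : (P ++ Q ++ E.flatten ++ R).Nodup := by
    rw [List.nodup_append']
    refine ⟨hnd, Finset.nodup_toList _, fun x hx hx' => ?_⟩
    rw [hR, Finset.mem_toList, Finset.mem_sdiff, List.mem_toFinset] at hx'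
    exact hx'.2 hx
  set a := m₁ / 2 - m₁ % 2 with ha
  set b := m₂ / 2 - m₂ % 2 with hb
  set R₁ := R.take a with hR₁
  set R₂ := (R.drop a).take b with hR₂
  set R₃ := (R.drop a).drop b with hR₃
  have hRR : R₁ ++ R₂ ++ R₃ = R := by
    rw [List.append_assoc, hR₂, hR₃, List.take_append_drop, hR₁, List.take_append_drop]
  have l₁ : R₁.length = a := by rw [hR₁, List.length_take]; omega
  have l₂ : R₂.length = b := by rw [hR₂, List.length_take, List.length_drop]; omega
  have l₃ : R₃.length = R.length - a - b := by rw [hR₃, List.length_drop, List.length_drop]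
  set E₁ := E.take (m₁ % 2) with hE₁
  set E₂ := E.drop (m₁ % 2) with hE₂
  have hEE : E₁ ++ E₂ = E := List.take_append_drop _ _
  have n₁ : E₁.length = m₁ % 2 := by rw [hE₁, List.length_take]; omega
  have n₂ : E₂.length = m₂ % 2 := by rw [hE₂, List.length_drop]; omega
  have f₁ := hflat E₁ fun e he => hE e (List.mem_of_mem_take he)
  have f₂ := hflat E₂ fun e he => hE e (List.mem_of_mem_drop he)
  refine hasOPSolution_of_blocks h₁ h₂ (by omega) hsol hS (E₁ ++ R₁.map fun x => [x])
    (E₂ ++ R₂.map fun x => [x]) (P :: Q :: R₃.map fun x => [x]) ?_ ?_ ?_ ?_ ?_ ?_ ?_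
  · simp only [List.length_append, List.length_map, List.length_cons]
    omega
  · simp only [List.length_append, List.length_map, List.flatten_append,
      flatten_map_singleton']
    omega
  · simp only [List.length_append, List.length_map, List.flatten_append,
      flatten_map_singleton']
    omega
  · simp only [List.length_append, List.length_map, List.flatten_cons, List.length_cons,
      flatten_map_singleton']
    omega
  · have key : ∀ e ∈ E, e ≠ [] := fun e he h => by
      have := hE e he
      rw [h] at this; simp at this
    simp only [List.mem_append, List.mem_map, List.mem_cons]
    rintro p ((((hp | ⟨x, -, rfl⟩) | (hp | ⟨x, -, rfl⟩)) | rfl | rfl | ⟨x, -, rfl⟩))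
    · exact key p (List.mem_of_mem_take hp)
    · simp
    · exact key p (List.mem_of_mem_drop hp)
    · simp
    · exact hP
    · exact hQ
    · simp
  · have hp : ((E₁ ++ R₁.map fun x => [x]).flatten ++ (E₂ ++ R₂.map fun x => [x]).flatten ++
        (P :: Q :: R₃.map fun x => [x]).flatten).Perm (P ++ Q ++ E.flatten ++ R) := by
      rw [← hEE, ← hRR, List.perm_iff_count]
      intro x
      simp only [List.flatten_append, List.flatten_cons, flatten_map_singleton',
        List.count_append]
      ring
    exact hp.nodup_iff.2 hRnd
  · intro d hd hd0
    obtain ⟨c, p, hp, hcp⟩ := hB d hd hd0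
    refine ⟨c, p, ?_, hcp⟩
    rw [← hEE] at hp
    simp only [List.mem_append, List.mem_cons] at hp ⊢
    tauto

end

section

theorem infix_map_range {α : Type*} (f : ℕ → α) {n i : ℕ} (h : i + 1 < n) :
    [f i, f (i + 1)] <:+: (List.range n).map f := by
  obtain ⟨k, rfl⟩ := Nat.exists_eq_add_of_lt h
  refine ⟨(List.range i).map f, (List.range k).map fun x => f (i + 2 + x), ?_⟩
  rw [show i + 1 + k + 1 = i + 2 + k by ring, List.range_add, List.map_append, List.map_map,
    List.range_succ, List.range_succ]
  simp [Function.comp_def]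

/-- The arc from `a` to `b` has difference `v` modulo `t`. -/
def Arc (t v a b : ℕ) : Prop := b = a + v ∨ b + t = a + v

theorem Arc.cast {t v a b : ℕ} (h : Arc t v a b) : (b : ZMod t) = a + v := by
  rcases h with h | h
  · rw [h]; push_cast; rfl
  · have := congrArg (Nat.cast : ℕ → ZMod t) h
    push_cast at this
    rwa [ZMod.natCast_self, add_zero] at this

/-- The two paths and the short arcs are given by natural numbers below `t`. -/
theorem hasOPSolution_of_nat_paths {m₁ m₂ t u : ℕ} (h₁ : 2 ≤ m₁) (h₂ : 2 ≤ m₂)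
    (htu : t = m₁ + m₂ + u) (hsol : HasOPSolution [m₁, m₂]) {S : Set (ZMod t)}
    (hS : CovDiff S (m₁ + m₂ - 1)) (n n' : ℕ) (g g' : ℕ → ℕ) (E : List (ℕ × ℕ))
    (hn : 0 < n) (hn' : 0 < n') (hEl : E.length = m₁ % 2 + m₂ % 2)
    (hlen : n + n' + E.length = u + 2)
    (hg : ∀ i < n, g i < t) (hg' : ∀ i < n', g' i < t)
    (hgi : ∀ i < n, ∀ j < n, g i = g j → i = j) (hgi' : ∀ i < n', ∀ j < n', g' i = g' j → i = j)
    (hgg : ∀ i < n, ∀ j < n', g i ≠ g' j)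
    (hE : ∀ e ∈ E, e.1 < t ∧ e.2 < t ∧ (∀ i < n, g i ≠ e.1 ∧ g i ≠ e.2) ∧
      ∀ i < n', g' i ≠ e.1 ∧ g' i ≠ e.2)
    (hEn : (E.map fun e => [e.1, e.2]).flatten.Nodup)
    (hB : ∀ v, 0 < v → v < t → (v : ZMod t) ∉ S → (∃ i, i + 1 < n ∧ Arc t v (g i) (g (i + 1))) ∨
      (∃ i, i + 1 < n' ∧ Arc t v (g' i) (g' (i + 1))) ∨ ∃ e ∈ E, Arc t v e.1 e.2) :
    HasOPSolution [m₁, m₂, t] := by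
  have : NeZero t := ⟨by omega⟩
  set P := (List.range n).map g with hP
  set Q := (List.range n').map g' with hQ
  set F := E.map fun e => [e.1, e.2] with hF
  have hFE : ∀ x ∈ F.flatten, ∃ e ∈ E, x = e.1 ∨ x = e.2 := by
    intro x hx
    obtain ⟨l, hl, hxl⟩ := List.mem_flatten.1 hx
    obtain ⟨e, he, rfl⟩ := List.mem_map.1 hl
    exact ⟨e, he, by simpa using hxl⟩
  have hnd : (P ++ Q ++ F.flatten).Nodup := by
    rw [List.nodup_append', List.nodup_append', List.disjoint_append_left]
    refine ⟨⟨?_, ?_, ?_⟩, hEn, ?_, ?_⟩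
    · refine List.Nodup.map_on (fun x hx y hy => ?_) List.nodup_range
      exact hgi x (List.mem_range.1 hx) y (List.mem_range.1 hy)
    · refine List.Nodup.map_on (fun x hx y hy => ?_) List.nodup_range
      exact hgi' x (List.mem_range.1 hx) y (List.mem_range.1 hy)
    · intro x hx hx'
      obtain ⟨i, hi, rfl⟩ := List.mem_map.1 hx
      obtain ⟨j, hj, e⟩ := List.mem_map.1 hx'
      exact hgg i (List.mem_range.1 hi) j (List.mem_range.1 hj) e.symm
    · intro x hx hx'
      obtain ⟨i, hi, rfl⟩ := List.mem_map.1 hx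
      obtain ⟨e, he, h⟩ := hFE _ hx'
      have := (hE e he).2.2.1 i (List.mem_range.1 hi)
      tauto
    · intro x hx hx'
      obtain ⟨i, hi, rfl⟩ := List.mem_map.1 hx
      obtain ⟨e, he, h⟩ := hFE _ hx'
      have := (hE e he).2.2.2 i (List.mem_range.1 hi)
      tauto
  have hlt : ∀ x ∈ P ++ Q ++ F.flatten, x < t := by
    intro x hx
    simp only [List.mem_append] at hx
    rcases hx with (hx | hx) | hx
    · obtain ⟨i, hi, rfl⟩ := List.mem_map.1 hx
      exact hg i (List.mem_range.1 hi)
    · obtain ⟨i, hi, rfl⟩ := List.mem_map.1 hx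
      exact hg' i (List.mem_range.1 hi)
    · obtain ⟨e, he, rfl | rfl⟩ := hFE _ hx
      exacts [(hE e he).1, (hE e he).2.1]
  let c : ℕ → ZMod t := Nat.cast
  refine hasOPSolution_of_paths h₁ h₂ htu hsol hS (P.map c) (Q.map c) (F.map (List.map c))
    ?_ ?_ ?_ ?_ ?_ ?_ ?_
  · simp [hP, hn.ne']
  · simp [hQ, hn'.ne']
  · intro e he
    obtain ⟨l, hl, rfl⟩ := List.mem_map.1 he
    obtain ⟨e, he, rfl⟩ := List.mem_map.1 hl
    simp
  · simpa [hF] using hEl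
  · simpa [hP, hQ, hF] using hlen
  · rw [← List.map_flatten, ← List.map_append, ← List.map_append]
    refine List.Nodup.map_on (fun x hx y hy hxy => ?_) hnd
    have := congrArg ZMod.val hxy
    rwa [ZMod.val_natCast_of_lt (hlt x hx), ZMod.val_natCast_of_lt (hlt y hy)] at this
  · intro d hd hd0
    have hdv : d = (d.val : ZMod t) := (ZMod.natCast_zmod_val d).symm
    rcases hB d.val (Nat.pos_of_ne_zero fun h => hd0 ((ZMod.val_eq_zero d).1 h)) (ZMod.val_lt d)
      (by rwa [← hdv]) with ⟨i, hi, h⟩ | ⟨i, hi, h⟩ | ⟨e, he, h⟩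
    · refine ⟨c (g i), _, List.mem_cons_self, ?_⟩
      have := (infix_map_range g hi).map c
      rwa [List.map_cons, List.map_singleton, show c (g (i + 1)) = c (g i) + d by
        rw [hdv]; exact h.cast] at this
    · refine ⟨c (g' i), _, List.mem_cons_of_mem _ List.mem_cons_self, ?_⟩
      have := (infix_map_range g' hi).map c
      rwa [List.map_cons, List.map_singleton, show c (g' (i + 1)) = c (g' i) + d by
        rw [hdv]; exact h.cast] at this
    · refine ⟨c e.1, [c e.1, c e.2], List.mem_cons_of_mem _ (List.mem_cons_of_mem _
        (List.mem_map.2 ⟨[e.1, e.2], List.mem_map.2 ⟨e, he, rfl⟩, rfl⟩)), ?_⟩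
      rw [show c e.2 = c e.1 + d by rw [hdv]; exact h.cast]

theorem natCast_mem_symIoc {t lo hi v : ℕ} (hv : v ≤ t)
    (h : (lo < v ∧ v ≤ hi) ∨ (lo < t - v ∧ t - v ≤ hi)) : (v : ZMod t) ∈ symIoc t lo hi := by
  rcases h with h | h
  · exact ⟨v, h.1, h.2, Or.inl rfl⟩
  · refine ⟨t - v, h.1, h.2, Or.inr ?_⟩
    rw [Nat.cast_sub hv, ZMod.natCast_self]; ring

end

section

/-- The zigzag path realizing differences `m + J, m - (J - 1), m + (J - 2), …` modulo `2 * m`. -/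
def zig (m J i : ℕ) : ℕ := if i % 2 = 0 then i / 2 else m + J - i / 2

/-- The zigzag path on the vertices opposite to those of `zig`. -/
def zag (m J i : ℕ) : ℕ := if i % 2 = 0 then m + i / 2 else J - i / 2

theorem zig_injOn {m J i j : ℕ} (h : J < m) (hi : i ≤ J) (hj : j ≤ J)
    (e : zig m J i = zig m J j) : i = j := by
  unfold zig at e; split_ifs at e <;> omega

theorem zag_injOn {m J i j : ℕ} (h : J < m) (hi : i ≤ J) (hj : j ≤ J)
    (e : zag m J i = zag m J j) : i = j := by
  unfold zag at e; split_ifs at e <;> omega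

theorem zig_ne_zag {m J i j : ℕ} (h : J < m) (hi : i ≤ J) (hj : j ≤ J) :
    zig m J i ≠ zag m J j := by
  unfold zig zag; split_ifs <;> omega

theorem zig_lt {m J i : ℕ} (h : J < m) (hi : i ≤ J) : zig m J i < 2 * m := by
  unfold zig; split_ifs <;> omega

theorem zag_lt {m J i : ℕ} (h : J < m) (hi : i ≤ J) : zag m J i < 2 * m := by
  unfold zag; split_ifs <;> omega

theorem zig_notMem {m J i x : ℕ} (h : J < m) (hi : i ≤ J)
    (hx : J < x ∧ x < m ∨ m + J < x) : zig m J i ≠ x := by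
  unfold zig; split_ifs <;> omega

theorem zag_notMem {m J i x : ℕ} (hi : i ≤ J)
    (hx : J < x ∧ x < m ∨ m + J < x) : zag m J i ≠ x := by
  unfold zag; split_ifs <;> omega

theorem arc_zig {m J i v : ℕ} (h : J < m) (hi : i < J)
    (hv : if i % 2 = 0 then v = m + (J - i) else v = m - (J - i)) :
    Arc (2 * m) v (zig m J i) (zig m J (i + 1)) := by
  unfold Arc zig; split_ifs at hv ⊢ <;> omega

theorem arc_zag {m J i v : ℕ} (h : J < m) (hi : i < J)
    (hv : if i % 2 = 0 then v = m - (J - i) else v = m + (J - i)) :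
    Arc (2 * m) v (zag m J (i + 1)) (zag m J i) := by
  unfold Arc zag; split_ifs at hv ⊢ <;> omega

theorem exists_zig_or_zag {m J v : ℕ} (hv : m < v + J + 1) (hv' : v < m + J + 1)
    (hvm : v ≠ m) : ∃ i < J, (if i % 2 = 0 then v = m + (J - i) else v = m - (J - i)) ∨
      (if i % 2 = 0 then v = m - (J - i) else v = m + (J - i)) := by
  rcases Nat.lt_or_gt_of_ne hvm with hm | hm
  · refine ⟨J - (m - v), by omega, ?_⟩
    split_ifs <;> omega
  · refine ⟨J - (v - m), by omega, ?_⟩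
    split_ifs <;> omega

theorem exists_arc_reverse {t v N i : ℕ} {f : ℕ → ℕ} (hi : i < N) (h : Arc t v (f (i + 1)) (f i)) :
    ∃ j, j + 1 < N + 1 ∧ Arc t v (f (N - j)) (f (N - (j + 1))) := by
  refine ⟨N - (i + 1), by omega, ?_⟩
  rwa [show N - (N - (i + 1)) = i + 1 by omega, show N - (N - (i + 1) + 1) = i by omega]

theorem hasOPSolution_even_odd {m₁ m₂ m J : ℕ} (h₁ : 2 ≤ m₁) (h₂ : 2 ≤ m₂)
    (hsol : HasOPSolution [m₁, m₂]) (htu : 2 * m = m₁ + m₂ + (2 * J + 1))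
    (hδ : m₁ % 2 + m₂ % 2 = 1) : HasOPSolution [m₁, m₂, 2 * m] := by
  have hJ : J + 1 < m := by omega
  have hJ' : J < m := by omega
  have hS : CovDiff (symIoc (2 * m) 0 (m - 1 - J)) (m₁ + m₂ - 1) := by
    rw [show m₁ + m₂ - 1 = 2 * (m - 1 - J) by omega]
    exact covDiff_symIoc_of_even _ (by omega)
  refine hasOPSolution_of_nat_paths h₁ h₂ htu hsol hS (J + 1) (J + 1) (zig m J)
    (fun i => zag m J (J - i)) [(J + 1, J + 1 + m)] (by omega) (by omega) (by simp [hδ])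
    (by simp; omega) (fun i hi => zig_lt hJ' (by omega)) (fun i hi => zag_lt hJ' (by omega))
    (fun i hi j hj e => zig_injOn hJ' (by omega) (by omega) e)
    (fun i hi j hj e => by
      have := zag_injOn hJ' (by omega) (by omega) e
      omega)
    (fun i hi j hj => zig_ne_zag hJ' (by omega) (by omega)) ?_ ?_ ?_
  · intro e he
    rw [List.mem_singleton] at he
    subst he
    refine ⟨by simp only; omega, by simp only; omega, fun i hi => ⟨?_, ?_⟩,
          fun i hi => ⟨?_, ?_⟩⟩
    · exact zig_notMem hJ' (by omega) (by omega)
    · exact zig_notMem hJ' (by omega) (by omega)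
    · exact zag_notMem (by omega) (by omega)
    · exact zag_notMem (by omega) (by omega)
  · simp; omega
  · intro v hv hvt hvS
    by_cases hvm : v = m
    · exact Or.inr (Or.inr ⟨_, List.mem_singleton_self _, Or.inl (by simp only; omega)⟩)
    · have hv1 : ¬ ((0 < v ∧ v ≤ m - 1 - J) ∨ (0 < 2 * m - v ∧ 2 * m - v ≤ m - 1 - J)) :=
        fun h => hvS (natCast_mem_symIoc (by omega) h)
      obtain ⟨i, hi, h | h⟩ := exists_zig_or_zag (v := v) (J := J) (by omega) (by omega) hvm
      · exact Or.inl ⟨i, by omega, arc_zig hJ' hi h⟩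
      · exact Or.inr (Or.inl (exists_arc_reverse (by omega) (arc_zag hJ' hi h)))

theorem isUnit_near_half {m J : ℕ} (hm : Even m) (hm0 : 0 < m) :
    IsUnit ((if J % 2 = 0 then m + 1 else m - 1 : ℕ) : ZMod (2 * m)) := by
  have h := isUnit_half_add_one hm
  split_ifs
  · simpa using h
  · convert h.neg using 1
    rw [Nat.cast_sub hm0, eq_neg_iff_add_eq_zero]
    have := ZMod.natCast_self (2 * m)
    push_cast at this ⊢
    rw [← this]; ring

theorem covDiff_even_even {m J s : ℕ} (hm : Even m) (hJ : J < m)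
    (hs : s - 1 = 2 * (m - 1 - J) + 1) :
    CovDiff (symIoc (2 * m) 0 (m - 1 - J) ∪
      {((if J % 2 = 0 then m + 1 else m - 1 : ℕ) : ZMod (2 * m))}) (s - 1) := by
  have : NeZero (2 * m) := ⟨by omega⟩
  rw [hs]
  exact (covDiff_symIoc_of_even _ (by omega)).union_of_subset
    (covDiff_unit (isUnit_near_half hm (by omega))) subset_rfl rfl

theorem hasOPSolution_of_even_half_of_even {m₁ m₂ m J : ℕ} (h₁ : 2 ≤ m₁) (h₂ : 2 ≤ m₂)
    (hsol : HasOPSolution [m₁, m₂]) (htu : 2 * m = m₁ + m₂ + 2 * J) (hJ0 : 0 < J)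
    (hm : Even m) (hδ : m₁ % 2 + m₂ % 2 = 0) : HasOPSolution [m₁, m₂, 2 * m] := by
  have hJ : J < m := by omega
  refine hasOPSolution_of_nat_paths h₁ h₂ htu hsol
    (covDiff_even_even (J := J) (s := m₁ + m₂) hm hJ (by omega)) (J + 2) (J - 1 + 1)
    (fun i => if i ≤ J then zig m J i else zag m J J) (fun i => zag m J (J - 1 - i)) []
    (by omega) (by omega) (by simp [hδ]) (by simp; omega) (fun i hi => ?_)
    (fun i hi => zag_lt hJ (by omega)) (fun i hi j hj e => ?_)
    (fun i hi j hj e => by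
      have := zag_injOn hJ (by omega) (by omega) e
      omega)
    (fun i hi j hj => ?_) (by simp) (by simp) ?_
  · split_ifs with h
    exacts [zig_lt hJ h, zag_lt hJ le_rfl]
  · split_ifs at e with a b b
    · exact zig_injOn hJ a b e
    · exact absurd e (zig_ne_zag hJ a le_rfl)
    · exact absurd e.symm (zig_ne_zag hJ b le_rfl)
    · omega
  · split_ifs with a
    · exact zig_ne_zag hJ a (by omega)
    · intro e
      have := zag_injOn hJ (by omega) (by omega) e
      omega
  · intro v hv hvt hvS
    rw [Set.mem_union, not_or, Set.mem_singleton_iff] at hvS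
    by_cases hvm : v = m
    · refine Or.inl ⟨J, by omega, ?_⟩
      simp only [le_refl, if_true, show ¬ J + 1 ≤ J by omega, if_false]
      subst hvm
      unfold Arc zig zag
      split_ifs <;> omega
    · have hv1 : ¬ ((0 < v ∧ v ≤ m - 1 - J) ∨ (0 < 2 * m - v ∧ 2 * m - v ≤ m - 1 - J)) :=
        fun h => hvS.1 (natCast_mem_symIoc (by omega) h)
      have hv2 : v ≠ if J % 2 = 0 then m + 1 else m - 1 := fun h => hvS.2 (by rw [h])
      obtain ⟨i, hi, h | h⟩ := exists_zig_or_zag (v := v) (J := J) (by omega) (by omega) hvm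
      · refine Or.inl ⟨i, by omega, ?_⟩
        rw [if_pos hi.le, if_pos (Nat.succ_le_of_lt hi)]
        exact arc_zig hJ hi h
      · refine Or.inr (Or.inl (exists_arc_reverse ?_ (arc_zag hJ hi h)))
        by_contra hc
        split_ifs at h hv2 <;> omega

theorem hasOPSolution_of_even_half_of_odd {m₁ m₂ m J : ℕ} (h₁ : 2 ≤ m₁) (h₂ : 2 ≤ m₂)
    (hsol : HasOPSolution [m₁, m₂]) (htu : 2 * m = m₁ + m₂ + 2 * J) (hJ0 : 0 < J)
    (hm : Even m) (hδ : m₁ % 2 + m₂ % 2 = 2) : HasOPSolution [m₁, m₂, 2 * m] := by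
  have hJ : J < m := by omega
  refine hasOPSolution_of_nat_paths h₁ h₂ htu hsol
    (covDiff_even_even (J := J) (s := m₁ + m₂) hm hJ (by omega)) (J - 1 + 1) (J - 1 + 1)
    (zig m J) (fun i => zag m J (J - 1 - i))
    [(zig m J J, zag m J J), if J % 2 = 0 then (J + 2, J + 1 + m) else (J + 1, J + 2 + m)]
    (by omega) (by omega) (by simp [hδ]) (by simp; omega) (fun i hi => zig_lt hJ (by omega))
    (fun i hi => zag_lt hJ (by omega))
    (fun i hi j hj e => zig_injOn hJ (by omega) (by omega) e)
    (fun i hi j hj e => by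
      have := zag_injOn hJ (by omega) (by omega) e
      omega)
    (fun i hi j hj => zig_ne_zag hJ (by omega) (by omega)) ?_ ?_ ?_
  · intro e he
    rw [List.mem_cons, List.mem_singleton] at he
    rcases he with rfl | rfl
    · refine ⟨zig_lt hJ le_rfl, zag_lt hJ le_rfl,
        fun i hi => ⟨fun e => ?_, zig_ne_zag hJ (by omega) le_rfl⟩,
        fun i hi => ⟨(zig_ne_zag hJ le_rfl (by omega)).symm, fun e => ?_⟩⟩
      · have := zig_injOn hJ (by omega) (by omega) e
        omega
      · have := zag_injOn hJ (by omega) (by omega) e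
        omega
    · split_ifs
      all_goals
        refine ⟨by simp only; omega, by simp only; omega, fun i hi => ⟨?_, ?_⟩,
          fun i hi => ⟨?_, ?_⟩⟩
        · exact zig_notMem hJ (by omega) (by omega)
        · exact zig_notMem hJ (by omega) (by omega)
        · exact zag_notMem (by omega) (by omega)
        · exact zag_notMem (by omega) (by omega)
  · unfold zig zag
    split_ifs <;> simp <;> omega
  · intro v hv hvt hvS
    rw [Set.mem_union, not_or, Set.mem_singleton_iff] at hvS
    by_cases hvm : v = m
    · refine Or.inr (Or.inr ⟨_, List.mem_cons_self, ?_⟩)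
      subst hvm
      unfold Arc zig zag
      split_ifs <;> omega
    · have hv1 : ¬ ((0 < v ∧ v ≤ m - 1 - J) ∨ (0 < 2 * m - v ∧ 2 * m - v ≤ m - 1 - J)) :=
        fun h => hvS.1 (natCast_mem_symIoc (by omega) h)
      have hv2 : v ≠ if J % 2 = 0 then m + 1 else m - 1 := fun h => hvS.2 (by rw [h])
      obtain ⟨i, hi, h⟩ := exists_zig_or_zag (v := v) (J := J) (by omega) (by omega) hvm
      rcases Nat.lt_or_ge i (J - 1) with hi' | hi'
      · rcases h with h | h
        · exact Or.inl ⟨i, by omega, arc_zig hJ hi h⟩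
        · exact Or.inr (Or.inl (exists_arc_reverse hi' (arc_zag hJ hi h)))
      · refine Or.inr (Or.inr ⟨_, List.mem_cons_of_mem _ (List.mem_singleton_self _), ?_⟩)
        unfold Arc
        split_ifs at h hv2 ⊢ <;> simp only <;> omega

end

section

theorem covDiff_even_odd_half {m J s : ℕ} (hm : Odd m) (hJ : J < m) (hm2 : 2 ≤ m)
    (hs : s - 1 = 2 * (m - 1 - J) + 3) :
    CovDiff (symIoc (2 * m) 0 (m - 1 - J) ∪ {(m : ZMod (2 * m)) - 2, (m : ZMod (2 * m)),
      (m : ZMod (2 * m)) + 2}) (s - 1) := by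
  rw [hs]
  exact (covDiff_symIoc_of_even _ (by omega)).union_of_subset (covDiff_triple hm hm2) subset_rfl rfl

/-- What remains of a residue outside the set covered by `covDiff_even_odd_half`. -/
theorem exists_zig_or_zag_of_notMem {m J v : ℕ} (hJ : J < m) (hJ2 : 2 ≤ J) (hv : v < 2 * m)
    (hv0 : 0 < v)
    (hS : (v : ZMod (2 * m)) ∉ symIoc (2 * m) 0 (m - 1 - J) ∪ {(m : ZMod (2 * m)) - 2,
      (m : ZMod (2 * m)), (m : ZMod (2 * m)) + 2}) :
    (v = m + 1 ∨ v = m - 1) ∨ ∃ i < J - 2,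
      (if i % 2 = 0 then v = m + (J - i) else v = m - (J - i)) ∨
      (if i % 2 = 0 then v = m - (J - i) else v = m + (J - i)) := by
  simp only [Set.mem_union, Set.mem_insert_iff, Set.mem_singleton_iff, not_or] at hS
  obtain ⟨hS, h1, h2, h3⟩ := hS
  have hv1 : ¬ ((0 < v ∧ v ≤ m - 1 - J) ∨ (0 < 2 * m - v ∧ 2 * m - v ≤ m - 1 - J)) :=
    fun h => hS (natCast_mem_symIoc (by omega) h)
  have e2 : v ≠ m := fun h => h2 (by rw [h])
  have e3 : v ≠ m + 2 := fun h => h3 (by rw [h]; push_cast; rfl)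
  have e1 : v ≠ m - 2 := fun h => h1 (by rw [h, Nat.cast_sub (by omega)]; push_cast; rfl)
  obtain ⟨i, hi, h⟩ := exists_zig_or_zag (v := v) (J := J) (m := m) (by omega) (by omega) e2
  by_cases hi' : i < J - 2
  · exact Or.inr ⟨i, hi', h⟩
  · left
    split_ifs at h <;> omega

theorem hasOPSolution_of_odd_half_of_even {m₁ m₂ m J : ℕ} (h₁ : 2 ≤ m₁) (h₂ : 2 ≤ m₂)
    (hsol : HasOPSolution [m₁, m₂]) (hJ2 : 2 ≤ J) (htu : 2 * m = m₁ + m₂ + (2 * J - 2))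
    (hm : Odd m) (hδ : m₁ % 2 + m₂ % 2 = 0) : HasOPSolution [m₁, m₂, 2 * m] := by
  have hJ : J < m := by omega
  set f : ℕ → ℕ := fun i => if i ≤ J - 2 then zag m J i else zig m J J with hf
  refine hasOPSolution_of_nat_paths h₁ h₂ htu hsol
    (covDiff_even_odd_half (J := J) (s := m₁ + m₂) hm hJ (by omega) (by omega))
    (J - 1 + 1) (J - 1 + 1)
    (fun i => if i ≤ J - 2 then zig m J i else zag m J J) (fun i => f (J - 1 - i)) []
    (by omega) (by omega) (by simp [hδ]) (by simp; omega) (fun i hi => ?_)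
    (fun i hi => ?_) (fun i hi j hj e => ?_) (fun i hi j hj e => ?_)
    (fun i hi j hj => ?_) (by simp) (by simp) ?_
  · split_ifs with h
    exacts [zig_lt hJ (by omega), zag_lt hJ le_rfl]
  · simp only [hf]
    split_ifs with h
    exacts [zag_lt hJ (by omega), zig_lt hJ le_rfl]
  · split_ifs at e with a b b
    · exact zig_injOn hJ (by omega) (by omega) e
    · exact absurd e (zig_ne_zag hJ (by omega) le_rfl)
    · exact absurd e.symm (zig_ne_zag hJ (by omega) le_rfl)
    · omega
  · simp only [hf] at e
    split_ifs at e with a b b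
    · have := zag_injOn hJ (by omega) (by omega) e
      omega
    · exact absurd e.symm (zig_ne_zag hJ le_rfl (by omega))
    · exact absurd e (zig_ne_zag hJ le_rfl (by omega))
    · omega
  · simp only [hf]
    split_ifs with a b b
    · exact zig_ne_zag hJ (by omega) (by omega)
    · intro e
      have := zig_injOn hJ (by omega) (by omega) e
      omega
    · intro e
      have := zag_injOn hJ (by omega) (by omega) e
      omega
    · exact (zig_ne_zag hJ le_rfl le_rfl).symm
  · intro v hv hvt hvS
    have last : (if J % 2 = 0 then v = m + 1 else v = m - 1) ∨
        (if J % 2 = 0 then v = m - 1 else v = m + 1) ∨ ¬ (v = m + 1 ∨ v = m - 1) := by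
      split_ifs <;> omega
    rcases exists_zig_or_zag_of_notMem hJ hJ2 hvt hv hvS with h | ⟨i, hi, h | h⟩
    · rcases last with l | l | l
      · refine Or.inl ⟨J - 2, by omega, ?_⟩
        rw [if_pos le_rfl, if_neg (by omega)]
        unfold Arc zig zag
        split_ifs at l ⊢ <;> omega
      · refine Or.inr (Or.inl (exists_arc_reverse (i := J - 2) (by omega) ?_))
        simp only [hf]
        rw [if_pos le_rfl, if_neg (by omega)]
        unfold Arc zig zag
        split_ifs at l ⊢ <;> omega
      · exact absurd h l
    · refine Or.inl ⟨i, by omega, ?_⟩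
      rw [if_pos hi.le, if_pos (Nat.succ_le_of_lt hi)]
      exact arc_zig hJ (by omega) h
    · refine Or.inr (Or.inl (exists_arc_reverse (i := i) (by omega) ?_))
      simp only [hf]
      rw [if_pos hi.le, if_pos (Nat.succ_le_of_lt hi)]
      exact arc_zag hJ (by omega) h

theorem hasOPSolution_of_odd_half_of_odd {m₁ m₂ m J : ℕ} (h₁ : 2 ≤ m₁) (h₂ : 2 ≤ m₂)
    (hsol : HasOPSolution [m₁, m₂]) (hJ2 : 2 ≤ J) (htu : 2 * m = m₁ + m₂ + (2 * J - 2))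
    (hm : Odd m) (hδ : m₁ % 2 + m₂ % 2 = 2) : HasOPSolution [m₁, m₂, 2 * m] := by
  have hJ : J < m := by omega
  refine hasOPSolution_of_nat_paths h₁ h₂ htu hsol
    (covDiff_even_odd_half (J := J) (s := m₁ + m₂) hm hJ (by omega) (by omega))
    (J - 2 + 1) (J - 2 + 1)
    (zig m J) (fun i => zag m J (J - 2 - i))
    [(zig m J J, zig m J (J - 1)), (zag m J (J - 1), zag m J J)]
    (by omega) (by omega) (by simp [hδ]) (by simp; omega) (fun i hi => zig_lt hJ (by omega))
    (fun i hi => zag_lt hJ (by omega))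
    (fun i hi j hj e => zig_injOn hJ (by omega) (by omega) e)
    (fun i hi j hj e => by
      have := zag_injOn hJ (by omega) (by omega) e
      omega)
    (fun i hi j hj => zig_ne_zag hJ (by omega) (by omega)) ?_ ?_ ?_
  · intro e he
    rw [List.mem_cons, List.mem_singleton] at he
    rcases he with rfl | rfl
    · refine ⟨zig_lt hJ le_rfl, zig_lt hJ (by omega), fun i hi => ⟨fun e => ?_, fun e => ?_⟩,
        fun i hi => ⟨(zig_ne_zag hJ le_rfl (by omega)).symm,
          (zig_ne_zag hJ (by omega) (by omega)).symm⟩⟩ <;>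
      · have := zig_injOn hJ (by omega) (by omega) e
        omega
    · refine ⟨zag_lt hJ (by omega), zag_lt hJ le_rfl,
        fun i hi => ⟨zig_ne_zag hJ (by omega) (by omega), zig_ne_zag hJ (by omega) le_rfl⟩,
        fun i hi => ⟨fun e => ?_, fun e => ?_⟩⟩ <;>
      · have := zag_injOn hJ (by omega) (by omega) e
        omega
  · unfold zig zag
    split_ifs <;> simp <;> omega
  · intro v hv hvt hvS
    have last : (if J % 2 = 0 then v = m + 1 else v = m - 1) ∨
        (if J % 2 = 0 then v = m - 1 else v = m + 1) ∨ ¬ (v = m + 1 ∨ v = m - 1) := by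
      split_ifs <;> omega
    rcases exists_zig_or_zag_of_notMem hJ hJ2 hvt hv hvS with h | ⟨i, hi, h | h⟩
    · rcases last with l | l | l
      · refine Or.inr (Or.inr ⟨_, List.mem_cons_self, ?_⟩)
        unfold Arc zig
        split_ifs at l ⊢ <;> omega
      · refine Or.inr (Or.inr ⟨_, List.mem_cons_of_mem _ List.mem_cons_self, ?_⟩)
        unfold Arc zag
        split_ifs at l ⊢ <;> omega
      · exact absurd h l
    · exact Or.inl ⟨i, by omega, arc_zig hJ (by omega) h⟩
    · exact Or.inr (Or.inl (exists_arc_reverse (by omega) (arc_zag hJ (by omega) h)))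

end

section

/-- The zigzag path realizing differences `k, -(k - 1), k - 2, …`. -/
def zigzag (k i : ℕ) : ℕ := if i % 2 = 0 then i / 2 else k - i / 2

theorem zigzag_injOn {k i j : ℕ} (hi : i ≤ k) (hj : j ≤ k)
    (e : zigzag k i = zigzag k j) : i = j := by
  unfold zigzag at e; split_ifs at e <;> omega

theorem zigzag_le {k i : ℕ} (hi : i ≤ k) : zigzag k i ≤ k := by
  unfold zigzag; split_ifs <;> omega

theorem arc_zigzag {t k i v : ℕ} (h : k < t) (hi : i < k)
    (hv : if i % 2 = 0 then v = k - i else v = t - (k - i)) :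
    Arc t v (zigzag k i) (zigzag k (i + 1)) := by
  unfold Arc zigzag; split_ifs at hv ⊢ <;> omega

theorem arc_zigzag_reverse {t k i v : ℕ} (c : ℕ) (h : k < t) (hi : i < k)
    (hv : if i % 2 = 0 then v = t - (k - i) else v = k - i) :
    Arc t v (c + zigzag k (i + 1)) (c + zigzag k i) := by
  unfold Arc zigzag; split_ifs at hv ⊢ <;> omega

theorem exists_zigzag {t k v : ℕ} (hv : 0 < v) (hvt : v < t) (hk : v ≤ k ∨ t ≤ v + k) :
    ∃ i < k, (if i % 2 = 0 then v = k - i else v = t - (k - i)) ∨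
      (if i % 2 = 0 then v = t - (k - i) else v = k - i) := by
  rcases hk with h | h
  · refine ⟨k - v, by omega, ?_⟩
    split_ifs <;> omega
  · refine ⟨k - (t - v), by omega, ?_⟩
    split_ifs <;> omega

theorem hasOPSolution_odd_of_odd {m₁ m₂ M k : ℕ} (h₁ : 2 ≤ m₁) (h₂ : 2 ≤ m₂)
    (hsol : HasOPSolution [m₁, m₂]) (hk0 : 0 < k) (htu : 2 * M + 1 = m₁ + m₂ + 2 * k)
    (hδ : m₁ % 2 + m₂ % 2 = 1) : HasOPSolution [m₁, m₂, 2 * M + 1] := by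
  have hk : k < M := by omega
  have hS : CovDiff (symIoc (2 * M + 1) k M) (m₁ + m₂ - 1) := by
    have := covDiff_symIoc_of_odd (M := M) (M - k) (by omega)
    rwa [show M - (M - k) = k by omega, show 2 * (M - k) = m₁ + m₂ - 1 by omega] at this
  refine hasOPSolution_of_nat_paths h₁ h₂ htu hsol hS (k - 1 + 1) (k + 1)
    (zigzag k) (fun i => k + 1 + zigzag k (k - i))
    [if k % 2 = 0 then (2 * k + 3, 2 * k + 2) else (2 * k + 2, 2 * k + 3)]
    (by omega) (by omega) (by simp [hδ]) (by simp; omega)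
    (fun i hi => by have := zigzag_le (k := k) (i := i) (by omega); omega)
    (fun i hi => by have := zigzag_le (k := k) (i := k - i) (by omega); omega)
    (fun i hi j hj e => zigzag_injOn (k := k) (by omega) (by omega) e)
    (fun i hi j hj e => by
      have := zigzag_injOn (k := k) (i := k - i) (j := k - j) (by omega) (by omega) (by omega)
      omega)
    (fun i hi j hj => by have := zigzag_le (k := k) (i := i) (by omega); omega) ?_ ?_ ?_
  · intro e he
    rw [List.mem_singleton] at he
    subst he
    have a : ∀ i < k - 1 + 1, zigzag k i ≤ k := fun i hi => zigzag_le (by omega)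
    have b : ∀ i < k + 1, zigzag k (k - i) ≤ k := fun i hi => zigzag_le (by omega)
    split_ifs <;>
    · refine ⟨by simp only; omega, by simp only; omega, fun i hi => ?_, fun i hi => ?_⟩
      · have := a i hi
        simp only; omega
      · have := b i hi
        simp only; omega
  · split_ifs <;> simp
  · intro v hv hvt hvS
    have hv1 : ¬ ((k < v ∧ v ≤ M) ∨ (k < 2 * M + 1 - v ∧ 2 * M + 1 - v ≤ M)) :=
      fun h => hvS (natCast_mem_symIoc (by omega) h)
    obtain ⟨i, hi, h | h⟩ := exists_zigzag (k := k) hv hvt (by omega)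
    · by_cases hi' : i < k - 1
      · exact Or.inl ⟨i, by omega, arc_zigzag (by omega) hi h⟩
      · refine Or.inr (Or.inr ⟨_, List.mem_singleton_self _, ?_⟩)
        unfold Arc
        split_ifs at h ⊢ <;> simp only <;> omega
    · exact Or.inr (Or.inl (exists_arc_reverse (f := fun i => k + 1 + zigzag k i) hi
        (arc_zigzag_reverse _ (by omega) hi h)))

theorem covDiff_odd {M k s : ℕ} (hk : k ≤ M) (hs : s - 1 = 2 * (M - k) + 1) :
    CovDiff (symIoc (2 * M + 1) k M ∪
      {((if k % 2 = 0 then 2 * M else 1 : ℕ) : ZMod (2 * M + 1))}) (s - 1) := by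
  have hu : IsUnit ((if k % 2 = 0 then 2 * M else 1 : ℕ) : ZMod (2 * M + 1)) := by
    split_ifs
    · have : ((2 * M : ℕ) : ZMod (2 * M + 1)) = -1 := by
        rw [eq_neg_iff_add_eq_zero]
        exact_mod_cast ZMod.natCast_self (2 * M + 1)
      rw [this]
      exact isUnit_one.neg
    · simp
  have := covDiff_symIoc_of_odd (M := M) (M - k) (by omega)
  rw [show M - (M - k) = k by omega] at this
  exact this.union_of_subset (covDiff_unit hu) subset_rfl hs

theorem exists_zigzag_of_notMem {M k v : ℕ} (hk0 : 0 < k) (hv : 0 < v)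
    (hvt : v < 2 * M + 1) (hvS : (v : ZMod (2 * M + 1)) ∉ symIoc (2 * M + 1) k M ∪
      {((if k % 2 = 0 then 2 * M else 1 : ℕ) : ZMod (2 * M + 1))}) :
    (∃ i < k - 1, if i % 2 = 0 then v = k - i else v = 2 * M + 1 - (k - i)) ∨
      ∃ i < k, if i % 2 = 0 then v = 2 * M + 1 - (k - i) else v = k - i := by
  rw [Set.mem_union, not_or, Set.mem_singleton_iff] at hvS
  have hv1 : ¬ ((k < v ∧ v ≤ M) ∨ (k < 2 * M + 1 - v ∧ 2 * M + 1 - v ≤ M)) :=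
    fun h => hvS.1 (natCast_mem_symIoc (by omega) h)
  have hv2 : v ≠ if k % 2 = 0 then 2 * M else 1 := fun h => hvS.2 (by rw [h])
  obtain ⟨i, hi, h | h⟩ := exists_zigzag (k := k) hv hvt (by omega)
  · refine Or.inl ⟨i, ?_, h⟩
    by_contra hc
    split_ifs at h hv2 <;> omega
  · exact Or.inr ⟨i, hi, h⟩

theorem hasOPSolution_odd_of_even {m₁ m₂ M k : ℕ} (h₁ : 2 ≤ m₁) (h₂ : 2 ≤ m₂)
    (hsol : HasOPSolution [m₁, m₂]) (hk0 : 0 < k) (htu : 2 * M + 1 = m₁ + m₂ + (2 * k - 1))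
    (hδ : m₁ % 2 + m₂ % 2 = 0) : HasOPSolution [m₁, m₂, 2 * M + 1] := by
  have hk : k < M := by omega
  refine hasOPSolution_of_nat_paths h₁ h₂ htu hsol
    (covDiff_odd (s := m₁ + m₂) hk.le (by omega)) (k - 1 + 1) (k + 1)
    (zigzag k) (fun i => k + 1 + zigzag k (k - i)) []
    (by omega) (by omega) (by simp [hδ]) (by simp; omega)
    (fun i hi => by have := zigzag_le (k := k) (i := i) (by omega); omega)
    (fun i hi => by have := zigzag_le (k := k) (i := k - i) (by omega); omega)
    (fun i hi j hj e => zigzag_injOn (k := k) (by omega) (by omega) e)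
    (fun i hi j hj e => by
      have := zigzag_injOn (k := k) (i := k - i) (j := k - j) (by omega) (by omega) (by omega)
      omega)
    (fun i hi j hj => by have := zigzag_le (k := k) (i := i) (by omega); omega) (by simp)
    (by simp) ?_
  intro v hv hvt hvS
  rcases exists_zigzag_of_notMem hk0 hv hvt hvS with ⟨i, hi, h⟩ | ⟨i, hi, h⟩
  · exact Or.inl ⟨i, by omega, arc_zigzag (by omega) (by omega) h⟩
  · exact Or.inr (Or.inl (exists_arc_reverse (f := fun i => k + 1 + zigzag k i) hi
      (arc_zigzag_reverse _ (by omega) hi h)))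

theorem hasOPSolution_odd_of_odd_odd {m₁ m₂ M k : ℕ} (h₁ : 2 ≤ m₁) (h₂ : 2 ≤ m₂)
    (hsol : HasOPSolution [m₁, m₂]) (hk2 : 2 ≤ k) (htu : 2 * M + 1 = m₁ + m₂ + (2 * k - 1))
    (hδ : m₁ % 2 + m₂ % 2 = 2) : HasOPSolution [m₁, m₂, 2 * M + 1] := by
  have hk : k + 1 < M := by omega
  refine hasOPSolution_of_nat_paths h₁ h₂ htu hsol
    (covDiff_odd (M := M) (k := k) (s := m₁ + m₂) (by omega) (by omega))
    (k - 2 + 1) (k - 1 + 1)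
    (zigzag k) (fun i => k + 1 + zigzag k (k - 1 - i))
    [(zigzag k k, zigzag k (k - 1)), if k % 2 = 0 then (2 * k + 2, 2 * k + 4)
      else (2 * k + 4, 2 * k + 2)]
    (by omega) (by omega) (by simp [hδ]) (by simp; omega)
    (fun i hi => by have := zigzag_le (k := k) (i := i) (by omega); omega)
    (fun i hi => by have := zigzag_le (k := k) (i := k - 1 - i) (by omega); omega)
    (fun i hi j hj e => zigzag_injOn (k := k) (by omega) (by omega) e)
    (fun i hi j hj e => by
      have := zigzag_injOn (k := k) (i := k - 1 - i) (j := k - 1 - j) (by omega) (by omega)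
        (by omega)
      omega)
    (fun i hi j hj => by have := zigzag_le (k := k) (i := i) (by omega); omega) ?_ ?_ ?_
  · intro e he
    have a : ∀ i < k - 2 + 1, zigzag k i ≤ k := fun i hi => zigzag_le (by omega)
    have b : ∀ i < k - 1 + 1, zigzag k (k - 1 - i) ≤ k := fun i hi => zigzag_le (by omega)
    have c : zigzag k k ≤ k := zigzag_le le_rfl
    have d : zigzag k (k - 1) ≤ k := zigzag_le (by omega)
    rw [List.mem_cons, List.mem_singleton] at he
    rcases he with rfl | rfl
    · refine ⟨by simp only; omega, by simp only; omega, fun i hi => ⟨fun e => ?_, fun e => ?_⟩,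
        fun i hi => ?_⟩
      · have := zigzag_injOn (by omega) (by omega) e
        omega
      · have := zigzag_injOn (by omega) (by omega) e
        omega
      · have := b i hi
        simp only; omega
    · split_ifs <;>
      · refine ⟨by simp only; omega, by simp only; omega, fun i hi => ?_, fun i hi => ?_⟩
        · have := a i hi
          simp only; omega
        · have := b i hi
          simp only; omega
  · unfold zigzag
    split_ifs <;> simp <;> omega
  · intro v hv hvt hvS
    rcases exists_zigzag_of_notMem (by omega) hv hvt hvS with ⟨i, hi, h⟩ | ⟨i, hi, h⟩
    · by_cases hi' : i < k - 2
      · exact Or.inl ⟨i, by omega, arc_zigzag (by omega) (by omega) h⟩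
      · refine Or.inr (Or.inr ⟨_, List.mem_cons_of_mem _ (List.mem_singleton_self _), ?_⟩)
        unfold Arc
        split_ifs at h ⊢ <;> simp only <;> omega
    · by_cases hi' : i < k - 1
      · exact Or.inr (Or.inl (exists_arc_reverse (f := fun i => k + 1 + zigzag k i) hi'
          (arc_zigzag_reverse _ (by omega) hi h)))
      · refine Or.inr (Or.inr ⟨_, List.mem_cons_self, ?_⟩)
        have := arc_zigzag_reverse (v := v) 0 (show k < 2 * M + 1 by omega) hi h
        rw [show i = k - 1 by omega] at this
        simpa [show k - 1 + 1 = k by omega] using this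

end

section

/-- The vertex at distance `m + d - 2` after `x`, modulo `2 * m`. -/
def jump (m d x : ℕ) : ℕ := if x + d < m + 2 then x + m + d - 2 else x + d - m - 2

/-- The equivalence relation generated by the arcs of `F` that start below `n`. -/
def Linked (F : ℕ → ℕ) (n : ℕ) : ℕ → ℕ → Prop := Relation.EqvGen fun a b => a < n ∧ F a = b

theorem Linked.symm {F : ℕ → ℕ} {n x y : ℕ} (h : Linked F n x y) : Linked F n y x :=
  Relation.EqvGen.symm _ _ h

theorem Linked.trans {F : ℕ → ℕ} {n x y z : ℕ} (h : Linked F n x y) (h' : Linked F n y z) :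
    Linked F n x z := Relation.EqvGen.trans _ _ _ h h'

theorem Linked.refl (F : ℕ → ℕ) (n x : ℕ) : Linked F n x x := Relation.EqvGen.refl _

theorem Linked.of_eq {F : ℕ → ℕ} {n x y : ℕ} (hx : x < n) (h : F x = y) : Linked F n x y :=
  Relation.EqvGen.rel _ _ ⟨hx, h⟩

/-- The displacements `R` define a cyclic permutation of the natural numbers below `2 * m`. -/
def Cyclic (m : ℕ) (R : ℕ → ℕ) : Prop :=
  (∀ x < 2 * m, ∀ y < 2 * m, jump m (R x) x = jump m (R y) y → x = y) ∧
    ∀ x < 2 * m, Linked (fun x => jump m (R x) x) (2 * m) 0 x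

/-- Displacements whose composite is a shift by `±2` or `±4` without overshooting. -/
def StepPair (d d' : ℕ) : Prop :=
  d = 4 ∧ d' = 4 ∨ d = 4 ∧ d' = 2 ∨ d = 2 ∧ d' = 4 ∨ d = 3 ∧ d' = 3 ∨
    d = 0 ∧ d' = 2 ∨ d = 2 ∧ d' = 0 ∨ d = 1 ∧ d' = 1 ∨ d = 0 ∧ d' = 0

/-- Two alternating kinds of steps whose composite is a shift by `±2` or `±4`. -/
theorem link_four {L : ℕ → ℕ → Prop} (hs : ∀ {x y}, L x y → L y x)
    (ht : ∀ {x y z}, L x y → L y z → L x z) {f g : ℕ → ℕ} {p p' d d' r : ℕ}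
    (h : ∀ x y, x % 2 = p → x ≤ 7 → y ≤ 7 → x + d = y + 2 → L (f x) (g y))
    (h' : ∀ x y, x % 2 = p' → x ≤ 7 → y ≤ 7 → x + d' = y + 2 → L (g x) (f y))
    (hr : r ≤ 3) (hp : r % 2 = p) (hp' : (p + d) % 2 = p')
    (hd : StepPair d d') :
    L (f r) (f (r + 4)) := by
  have two : ∀ x y z, x % 2 = p → x ≤ 7 → y ≤ 7 → z ≤ 7 → x + d = y + 2 →
      y + d' = z + 2 → L (f x) (f z) := fun x y z h1 h2 h3 h4 h5 h6 =>
    ht (h x y h1 h2 h3 h5) (h' y z (by omega) h3 h4 h6)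
  rcases hd with ⟨rfl, rfl⟩ | ⟨rfl, rfl⟩ | ⟨rfl, rfl⟩ | ⟨rfl, rfl⟩ | ⟨rfl, rfl⟩ | ⟨rfl, rfl⟩ |
    ⟨rfl, rfl⟩ | ⟨rfl, rfl⟩
  · apply two r (r + 2) (r + 4) <;> omega
  · apply ht (two r (r + 2) (r + 2) _ _ _ _ _ _) (two (r + 2) (r + 4) (r + 4) _ _ _ _ _ _) <;> omega
  · apply ht (two r r (r + 2) _ _ _ _ _ _) (two (r + 2) (r + 2) (r + 4) _ _ _ _ _ _) <;> omega
  · apply ht (two r (r + 1) (r + 2) _ _ _ _ _ _) (two (r + 2) (r + 3) (r + 4) _ _ _ _ _ _) <;> omega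
  · apply hs
    apply ht (two (r + 4) (r + 2) (r + 2) _ _ _ _ _ _) (two (r + 2) r r _ _ _ _ _ _) <;> omega
  · apply hs
    apply ht (two (r + 4) (r + 4) (r + 2) _ _ _ _ _ _) (two (r + 2) (r + 2) r _ _ _ _ _ _) <;> omega
  · apply hs
    apply ht (two (r + 4) (r + 3) (r + 2) _ _ _ _ _ _) (two (r + 2) (r + 1) r _ _ _ _ _ _) <;> omega
  · apply hs
    apply two (r + 4) (r + 2) r <;> omega

/-- Four further rows may be inserted into a periodic run of rows. -/
theorem Cyclic.stretch {m a b c e : ℕ} {R R' : ℕ → ℕ} (h : Cyclic m R) (hm : 4 ≤ m)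
    (hcol : (a, b, c, e) ∈ [(3, 1, 1, 3), (1, 3, 3, 1), (4, 0, 2, 2), (0, 4, 0, 4), (2, 2, 4, 0)])
    (hR : ∀ x < 2 * m, R x ≤ 4) (h0 : ∀ r < m, R' (r + 4) = R r)
    (h1 : ∀ r < m, R' (m + 4 + (r + 4)) = R (m + r)) (h2 : ∀ r < 4, R' r = R r)
    (h3 : ∀ r < 4, R' (m + 4 + r) = R (m + r))
    (h4 : ∀ r < 8, R' r = if r % 2 = 0 then a else b)
    (h5 : ∀ r < 8, R' (m + 4 + r) = if r % 2 = 0 then c else e) : Cyclic (m + 4) R' := by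
  obtain ⟨hi, hc⟩ := h
  set K := Linked (fun x => jump (m + 4) (R' x) x) (2 * (m + 4)) with hK
  have hsy : ∀ {x y}, K x y → K y x := fun h => h.symm
  have htr : ∀ {x y z}, K x y → K y z → K x z := fun h h' => h.trans h'
  have hF : ∀ x < 2 * (m + 4), ∀ y, jump (m + 4) (R' x) x = y → K x y :=
    fun x hx y hxy => .of_eq hx hxy
  have hop0 : ∀ p d, (∀ r < 8, r % 2 = p → R' r = d) →
      ∀ x y, x % 2 = p → x ≤ 7 → y ≤ 7 → x + d = y + 2 → K x (m + 4 + y) := by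
    intro p d H x y hx hx7 hy hxy
    refine hF x (by omega) _ ?_
    rw [H x (by omega) hx, jump, if_pos (by omega)]
    omega
  have hop1 : ∀ p d, (∀ r < 8, r % 2 = p → R' (m + 4 + r) = d) →
      ∀ x y, x % 2 = p → x ≤ 7 → y ≤ 7 → x + d = y + 2 → K (m + 4 + x) y := by
    intro p d H x y hx hx7 hy hxy
    refine hF _ (by omega) _ ?_
    rw [H x (by omega) hx, jump, if_neg (by omega)]
    omega
  have ha : ∀ r < 8, r % 2 = 0 → R' r = a := fun r hr hp => by rw [h4 r hr, if_pos hp]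
  have hb : ∀ r < 8, r % 2 = 1 → R' r = b := fun r hr hp => by rw [h4 r hr, if_neg (by omega)]
  have hc' : ∀ r < 8, r % 2 = 0 → R' (m + 4 + r) = c := fun r hr hp => by rw [h5 r hr, if_pos hp]
  have he : ∀ r < 8, r % 2 = 1 → R' (m + 4 + r) = e := fun r hr hp => by
    rw [h5 r hr, if_neg (by omega)]
  obtain ⟨fa, fb, fc, fe, hab, hce⟩ : (StepPair a (if a % 2 = 0 then c else e)) ∧
      (StepPair b (if b % 2 = 0 then e else c)) ∧ (StepPair c (if c % 2 = 0 then a else b)) ∧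
      (StepPair e (if e % 2 = 0 then b else a)) ∧ a % 2 = b % 2 ∧ c % 2 = e % 2 := by
    simp only [List.mem_cons, Prod.mk.injEq, List.not_mem_nil, or_false] at hcol
    rcases hcol with ⟨rfl, rfl, rfl, rfl⟩ | ⟨rfl, rfl, rfl, rfl⟩ | ⟨rfl, rfl, rfl, rfl⟩ |
      ⟨rfl, rfl, rfl, rfl⟩ | ⟨rfl, rfl, rfl, rfl⟩ <;> simp [StepPair]
  clear hcol
  have hrun0 : ∀ r ≤ 3, K r (r + 4) := by
    intro r hr
    rcases Nat.mod_two_eq_zero_or_one r with hp | hp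
    · by_cases h' : a % 2 = 0
      · rw [if_pos h'] at fa
        exact link_four (L := K) (f := id) (g := fun y => m + 4 + y) hsy htr (hop0 0 a ha)
          (hop1 0 c hc') hr hp (by omega) fa
      · rw [if_neg h'] at fa
        exact link_four (L := K) (f := id) (g := fun y => m + 4 + y) hsy htr (hop0 0 a ha)
          (hop1 1 e he) hr hp (by omega) fa
    · by_cases h' : b % 2 = 0
      · rw [if_pos h'] at fb
        exact link_four (L := K) (f := id) (g := fun y => m + 4 + y) hsy htr (hop0 1 b hb)
          (hop1 1 e he) hr hp (by omega) fb
      · rw [if_neg h'] at fb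
        exact link_four (L := K) (f := id) (g := fun y => m + 4 + y) hsy htr (hop0 1 b hb)
          (hop1 0 c hc') hr hp (by omega) fb
  have hrun1 : ∀ r ≤ 3, K (m + 4 + r) (m + 4 + (r + 4)) := by
    intro r hr
    rcases Nat.mod_two_eq_zero_or_one r with hp | hp
    · by_cases h' : c % 2 = 0
      · rw [if_pos h'] at fc
        exact link_four (L := K) (f := fun y => m + 4 + y) (g := id) hsy htr (hop1 0 c hc')
          (hop0 0 a ha) hr hp (by omega) fc
      · rw [if_neg h'] at fc
        exact link_four (L := K) (f := fun y => m + 4 + y) (g := id) hsy htr (hop1 0 c hc')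
          (hop0 1 b hb) hr hp (by omega) fc
    · by_cases h' : e % 2 = 0
      · rw [if_pos h'] at fe
        exact link_four (L := K) (f := fun y => m + 4 + y) (g := id) hsy htr (hop1 1 e he)
          (hop0 1 b hb) hr hp (by omega) fe
      · rw [if_neg h'] at fe
        exact link_four (L := K) (f := fun y => m + 4 + y) (g := id) hsy htr (hop1 1 e he)
          (hop0 0 a ha) hr hp (by omega) fe
  constructor
  · intro x hx y hy hxy
    have src : ∀ z < 2 * (m + 4), ∃ z₀ < 2 * m, R' z = R z₀ ∧
        (z = z₀ ∧ z₀ < 4 ∨ z = z₀ + 4 ∧ z₀ < m ∨ z = z₀ + 4 ∧ m ≤ z₀ ∧ z₀ < m + 4 ∨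
          z = z₀ + 8 ∧ m ≤ z₀) := by
      intro z hz
      by_cases hz4 : z < 4
      · exact ⟨z, by omega, h2 z hz4, by omega⟩
      by_cases hzm : z < m + 4
      · obtain ⟨r, rfl⟩ := Nat.exists_eq_add_of_le' (not_lt.1 hz4)
        exact ⟨r, by omega, h0 r (by omega), by omega⟩
      obtain ⟨r, rfl⟩ := Nat.exists_eq_add_of_le (not_lt.1 hzm)
      by_cases hr4 : r < 4
      · exact ⟨m + r, by omega, h3 r hr4, by omega⟩
      · obtain ⟨r, rfl⟩ := Nat.exists_eq_add_of_le' (not_lt.1 hr4)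
        exact ⟨m + r, by omega, h1 r (by omega), by omega⟩
    have key : ∀ z < 2 * (m + 4), ∀ T, jump (m + 4) (R' z) z = T → ∃ z₀ < 2 * m,
        (T ≤ 1 → jump m (R z₀) z₀ = T ∧ z = z₀ + 4) ∧
        (6 ≤ T → T < m + 6 → jump m (R z₀) z₀ = T - 4 ∧ z = if z₀ < m then z₀ else z₀ + 8) ∧
        (m + 10 ≤ T → jump m (R z₀) z₀ = T - 8 ∧ z = z₀ + 4) := by
      intro z hz T hT
      obtain ⟨z₀, hz₀, e, hzz⟩ := src z hz
      have hd := hR z₀ hz₀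
      rw [e, jump] at hT
      refine ⟨z₀, hz₀, ?_⟩
      rw [jump]
      split_ifs at hT ⊢ <;> omega
    have mid : ∀ z < 2 * (m + 4), ∀ T, jump (m + 4) (R' z) z = T →
        (2 ≤ T → T ≤ 5 → ∃ r < 8, z = m + 4 + r ∧ r + (if r % 2 = 0 then c else e) = T + 2) ∧
        (m + 6 ≤ T → T ≤ m + 9 →
          ∃ r < 8, z = r ∧ r + (if r % 2 = 0 then a else b) + m + 2 = T) := by
      intro z hz T hT
      obtain ⟨z₀, hz₀, e, -⟩ := src z hz
      have hd := hR z₀ hz₀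
      rw [← e] at hd
      constructor
      · intro h h'
        have : m + 4 ≤ z ∧ z < m + 12 ∧ z + R' z = T + m + 6 := by
          unfold jump at hT; split_ifs at hT <;> omega
        obtain ⟨r, rfl⟩ := Nat.exists_eq_add_of_le this.1
        exact ⟨r, by omega, rfl, by rw [← h5 r (by omega)]; omega⟩
      · intro h h'
        have : z < 8 ∧ z + R' z + m + 2 = T := by
          unfold jump at hT; split_ifs at hT <;> omega
        exact ⟨z, this.1, rfl, by rw [← h4 z (by omega)]; omega⟩
    obtain ⟨T, hT⟩ : ∃ T, jump (m + 4) (R' y) y = T := ⟨_, rfl⟩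
    rw [hT] at hxy
    obtain ⟨x₀, hx₀, kx⟩ := key x hx T hxy
    obtain ⟨y₀, hy₀, ky⟩ := key y hy T hT
    have hinj := hi x₀ hx₀ y₀ hy₀
    obtain ⟨mx, mx'⟩ := mid x hx T hxy
    obtain ⟨my, my'⟩ := mid y hy T hT
    by_cases c1 : T ≤ 1
    · have := hinj (by rw [(kx.1 c1).1, (ky.1 c1).1])
      rw [(kx.1 c1).2, (ky.1 c1).2, this]
    by_cases c2 : T ≤ 5
    · obtain ⟨r, hr, rfl, er⟩ := mx (by omega) c2
      obtain ⟨q, hq, rfl, eq⟩ := my (by omega) c2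
      split_ifs at er eq <;> omega
    by_cases c3 : T < m + 6
    · have := hinj (by rw [(kx.2.1 (by omega) c3).1, (ky.2.1 (by omega) c3).1])
      rw [(kx.2.1 (by omega) c3).2, (ky.2.1 (by omega) c3).2, this]
    by_cases c4 : T ≤ m + 9
    · obtain ⟨r, hr, rfl, er⟩ := mx' (by omega) c4
      obtain ⟨q, hq, rfl, eq⟩ := my' (by omega) c4
      split_ifs at er eq <;> omega
    · have := hinj (by rw [(kx.2.2 (by omega)).1, (ky.2.2 (by omega)).1])
      rw [(kx.2.2 (by omega)).2, (ky.2.2 (by omega)).2, this]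
  · obtain ⟨ι, hι⟩ : ∃ ι : ℕ → ℕ, ∀ x,
        ι x = if x < 2 then x else if x < m + 2 then x + 4 else x + 8 := ⟨_, fun _ => rfl⟩
    have off : ∀ s y, (y = s ∨ y = s + 4 ∧ (s ≤ 3 ∨ m + 4 ≤ s ∧ s ≤ m + 7)) → K s y := by
      rintro s y (rfl | ⟨rfl, h | ⟨h, h'⟩⟩)
      · exact .refl _ _ _
      · exact hrun0 s h
      · obtain ⟨r, rfl⟩ := Nat.exists_eq_add_of_le h
        exact hrun1 r (by omega)
    have emb : ∀ x < 2 * m, K 0 (ι x) := by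
      intro x hx
      have := Relation.EqvGen.rec (motive := fun x y _ => K (ι x) (ι y))
        ?_ ?_ ?_ ?_ (hc x hx)
      · rwa [hι 0] at this
      · rintro x y ⟨hx, hxy⟩
        have hd := hR x hx
        have hx' : ι x < 2 * (m + 4) ∧ R' (ι x) = R x := by
          rw [hι]
          split_ifs with p q
          · exact ⟨by omega, h2 x (by omega)⟩
          · by_cases hxm : x < m
            · exact ⟨by omega, h0 x hxm⟩
            · obtain ⟨r, rfl⟩ := Nat.exists_eq_add_of_le (not_lt.1 hxm)
              refine ⟨by omega, ?_⟩
              rw [← h3 r (by omega)]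
              congr 1
              omega
          · obtain ⟨r, rfl⟩ := Nat.exists_eq_add_of_le (show m ≤ x by omega)
            refine ⟨by omega, ?_⟩
            rw [← h1 r (by omega)]
            congr 1
            omega
        refine htr (hF _ hx'.1 _ rfl) ?_
        rw [hx'.2]
        dsimp only at hxy
        have : ∀ s y', s = jump (m + 4) (R x) (ι x) → y' = ι y →
            y' = s ∨ y' = s + 4 ∧ (s ≤ 3 ∨ m + 4 ≤ s ∧ s ≤ m + 7) ∨
              s = y' + 4 ∧ (y' ≤ 3 ∨ m + 4 ≤ y' ∧ y' ≤ m + 7) := by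
          intro s y' hs hy'
          rw [← hxy, hι] at hy'
          rw [hι] at hs
          unfold jump at hs hy'
          clear * - hs hy' hd hx hm
          split_ifs at hs hy' <;> omega
        rcases this _ _ rfl rfl with h | h | h
        · exact off _ _ (Or.inl h)
        · exact off _ _ (Or.inr h)
        · exact (off _ _ (Or.inr h)).symm
      · exact fun x => .refl _ _ _
      · exact fun x y _ h => h.symm
      · exact fun x y z _ _ h h' => h.trans h'
    intro x hx
    by_cases c1 : x < 2
    · have := emb x (by omega)
      rwa [hι, if_pos c1] at this
    by_cases c2 : x < 4
    · have := emb x (by omega)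
      rw [hι, if_neg c1, if_pos (by omega)] at this
      exact this.trans (hrun0 x (by omega)).symm
    by_cases c3 : x < 6
    · obtain ⟨r, rfl⟩ := Nat.exists_eq_add_of_le' (not_lt.1 c2)
      have := emb r (by omega)
      rw [hι, if_pos (by omega)] at this
      exact this.trans (hrun0 r (by omega))
    by_cases c4 : x < m + 6
    · obtain ⟨r, rfl⟩ := Nat.exists_eq_add_of_le' (show 4 ≤ x by omega)
      have := emb r (by omega)
      rwa [hι, if_neg (by omega), if_pos (by omega)] at this
    by_cases c5 : x < m + 8
    · obtain ⟨r, rfl⟩ := Nat.exists_eq_add_of_le (show m + 4 ≤ x by omega)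
      have := emb (m + r) (by omega)
      rw [hι, if_neg (by omega), if_neg (by omega),
        show m + r + 8 = m + 4 + (r + 4) by ring] at this
      exact this.trans (hrun1 r (by omega)).symm
    by_cases c6 : x < m + 10
    · obtain ⟨r, rfl⟩ := Nat.exists_eq_add_of_le (show m + 8 ≤ x by omega)
      have := emb (m + r) (by omega)
      rw [hι, if_neg (by omega), if_pos (by omega), show m + r + 4 = m + 4 + r by ring] at this
      rw [show m + 8 + r = m + 4 + (r + 4) by ring]
      exact this.trans (hrun1 r (by omega))
    · obtain ⟨r, rfl⟩ := Nat.exists_eq_add_of_le' (show 8 ≤ x by omega)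
      have := emb r (by omega)
      rwa [hι, if_neg (by omega), if_neg (by omega)] at this

end

section

/-- The entry in row `i` and column `j` of a table. -/
def entry (T : List (List ℕ)) (i j : ℕ) : ℕ := (T.getD i []).getD j 0

/-- The periodic rows: two for the first half of the vertices, two for the second half. -/
def runRows : List (List ℕ) := [[3, 1, 4, 0, 2], [1, 3, 0, 4, 2], [1, 3, 2, 0, 4], [3, 1, 2, 4, 0]]

/-- Displacements that are periodic except for the last `w` rows of either half. -/
def displ (W V : List (List ℕ)) (w m j x : ℕ) : ℕ :=
  if x < m then
    if x + w < m then entry runRows (x % 2) j else entry W (x + w - m) j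
  else
    if x + w < 2 * m then entry runRows (2 + (x - m) % 2) j else entry V (x + w - 2 * m) j

/-- The first `n` rows of a table are permutations of `0, …, 4`. -/
def RowPerms (T : List (List ℕ)) (n : ℕ) : Prop :=
  ∀ i < n, (∀ j < 5, entry T i j ≤ 4) ∧ ∀ d < 5, ∃ j < 5, entry T i j = d

instance (T : List (List ℕ)) (n : ℕ) : Decidable (RowPerms T n) := by
  unfold RowPerms; infer_instance

theorem rowPerms_runRows : RowPerms runRows 4 := by decide

theorem exists_displ_eq_entry {W V : List (List ℕ)} {w m x : ℕ} (hx : x < 2 * m) :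
    ∃ T i n, i < n ∧ (T = runRows ∧ n = 4 ∨ T = W ∧ n = w ∨ T = V ∧ n = w) ∧
      ∀ j, displ W V w m j x = entry T i j := by
  by_cases h : x < m
  · by_cases h' : x + w < m
    · exact ⟨runRows, x % 2, 4, by omega, by simp, fun j => by simp [displ, h, h']⟩
    · exact ⟨W, x + w - m, w, by omega, by simp, fun j => by simp [displ, h, h']⟩
  · by_cases h' : x + w < 2 * m
    · exact ⟨runRows, 2 + (x - m) % 2, 4, by omega, by simp, fun j => by simp [displ, h, h']⟩
    · exact ⟨V, x + w - 2 * m, w, by omega, by simp, fun j => by simp [displ, h, h']⟩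

theorem displ_spec {W V : List (List ℕ)} {w m x : ℕ} (hW : RowPerms W w) (hV : RowPerms V w)
    (hx : x < 2 * m) : (∀ j < 5, displ W V w m j x ≤ 4) ∧
      ∀ d < 5, ∃ j < 5, displ W V w m j x = d := by
  obtain ⟨T, i, n, hi, h, he⟩ := exists_displ_eq_entry (W := W) (V := V) (w := w) hx
  simp only [he]
  rcases h with ⟨rfl, rfl⟩ | ⟨rfl, rfl⟩ | ⟨rfl, rfl⟩
  exacts [rowPerms_runRows i hi, hW i hi, hV i hi]

theorem displ_left {W V : List (List ℕ)} {w m j r : ℕ} (hr : r < m) : displ W V w m j r =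
    if r + w < m then entry runRows (r % 2) j else entry W (r + w - m) j := by
  rw [displ, if_pos hr]

theorem displ_right {W V : List (List ℕ)} {w m j r : ℕ} : displ W V w m j (m + r) =
    if r + w < m then entry runRows (2 + r % 2) j else entry V (r + w - m) j := by
  rw [displ, if_neg (by omega), Nat.add_sub_cancel_left,
    show m + r + w - 2 * m = r + w - m by omega]
  split_ifs <;> first | rfl | omega

theorem cyclic_displ_add_four {W V : List (List ℕ)} {w m j : ℕ} (hW : RowPerms W w)
    (hV : RowPerms V w) (hj : j < 5) (hm : 4 ≤ m) (hwm : w + 4 ≤ m)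
    (h : Cyclic m (displ W V w m j)) : Cyclic (m + 4) (displ W V w (m + 4) j) := by
  refine h.stretch (a := entry runRows 0 j) (b := entry runRows 1 j) (c := entry runRows 2 j)
    (e := entry runRows 3 j) hm ?_ (fun x hx => (displ_spec hW hV hx).1 j hj) ?_ ?_ ?_ ?_ ?_ ?_
  · interval_cases j <;> decide
  · intro r hr
    rw [displ_left hr, displ_left (by omega), show (r + 4) % 2 = r % 2 by omega,
      show r + 4 + w - (m + 4) = r + w - m by omega]
    split_ifs <;> first | rfl | omega
  · intro r hr
    rw [displ_right, displ_right, show (r + 4) % 2 = r % 2 by omega,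
      show r + 4 + w - (m + 4) = r + w - m by omega]
    split_ifs <;> first | rfl | omega
  · intro r hr
    rw [displ_left (by omega), displ_left (by omega), if_pos (by omega), if_pos (by omega)]
  · intro r hr
    rw [displ_right, displ_right, if_pos (by omega), if_pos (by omega)]
  · intro r hr
    rw [displ_left (by omega), if_pos (by omega)]
    split_ifs with h'
    · rw [h']
    · rw [show r % 2 = 1 by omega]
  · intro r hr
    rw [displ_right, if_pos (by omega)]
    split_ifs with h'
    · rw [h']
    · rw [show r % 2 = 1 by omega]

theorem cyclic_displ_of_base {W V : List (List ℕ)} {w m j : ℕ} (hW : RowPerms W w)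
    (hV : RowPerms V w) (hj : j < 5) (hm : 4 ≤ m) (hwm : w + 4 ≤ m)
    (h : Cyclic m (displ W V w m j)) (k : ℕ) :
    Cyclic (m + 4 * k) (displ W V w (m + 4 * k) j) := by
  induction k with
  | zero => exact h
  | succ k ih =>
    have h1 : 4 ≤ m + 4 * k := by omega
    have h2 : w + 4 ≤ m + 4 * k := by omega
    exact cyclic_displ_add_four hW hV hj h1 h2 ih

/-- The walk from `0` returns after `2 * m` steps and visits every vertex. -/
theorem cyclic_of_iterate {m : ℕ} {R : ℕ → ℕ}
    (h : ∀ x < 2 * m, x ∈ List.iterate (fun x => jump m (R x) x) 0 (2 * m))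
    (h' : (fun x => jump m (R x) x)^[2 * m] 0 = 0)
    (hlt : ∀ x < 2 * m, jump m (R x) x < 2 * m) : Cyclic m R := by
  set F := fun x => jump m (R x) x with hF
  have hmem : ∀ x < 2 * m, ∃ i < 2 * m, F^[i] 0 = x := fun x hx => by
    simpa [eq_comm] using h x hx
  have hit : ∀ i, 0 < m → F^[i] 0 < 2 * m := by
    intro i hm
    induction i with
    | zero => simpa using hm
    | succ i ih => rw [Function.iterate_succ_apply']; exact hlt _ ih
  refine ⟨fun x hx y hy hxy => ?_, fun x hx => ?_⟩
  · have hsurj : Function.Surjective fun x : Fin (2 * m) => (⟨F x, hlt x x.2⟩ : Fin (2 * m)) := by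
      rintro ⟨y, hy⟩
      obtain ⟨i, hi, e⟩ := hmem y hy
      rcases i with _ | i
      · refine ⟨⟨F^[2 * m - 1] 0, hit _ (by omega)⟩, Fin.ext ?_⟩
        dsimp only
        rw [← Function.iterate_succ_apply' F, show (2 * m - 1).succ = 2 * m by omega, h', ← e]
        rfl
      · refine ⟨⟨F^[i] 0, hit _ (by omega)⟩, Fin.ext ?_⟩
        dsimp only
        rw [← Function.iterate_succ_apply' F, e]
    have := (Finite.injective_iff_surjective.2 hsurj) (a₁ := ⟨x, hx⟩) (a₂ := ⟨y, hy⟩)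
      (Fin.ext hxy)
    simpa using this
  · obtain ⟨i, hi, rfl⟩ := hmem x hx
    clear hi
    induction i with
    | zero => exact .refl _ _ _
    | succ i ih =>
      exact (ih (hit i (by omega))).trans
        (.of_eq (hit i (by omega)) (Function.iterate_succ_apply' F i 0).symm)

/-- A decidable form of the hypotheses of `cyclic_of_iterate`. -/
def CyclicTable (W V : List (List ℕ)) (w m : ℕ) : Prop :=
  RowPerms W w ∧ RowPerms V w ∧ ∀ j < 5,
    (∀ x < 2 * m, x ∈ List.iterate (fun x => jump m (displ W V w m j x) x) 0 (2 * m)) ∧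
    (fun x => jump m (displ W V w m j x) x)^[2 * m] 0 = 0

instance (W V : List (List ℕ)) (w m : ℕ) : Decidable (CyclicTable W V w m) := by
  unfold CyclicTable; infer_instance

theorem jump_lt {m d x : ℕ} (hx : x < 2 * m) (hd : d ≤ 4) (hm : 4 ≤ m) : jump m d x < 2 * m := by
  unfold jump; split_ifs <;> omega

theorem CyclicTable.cyclic {W V : List (List ℕ)} {w m : ℕ} (h : CyclicTable W V w m) (hm : 4 ≤ m)
    {j : ℕ} (hj : j < 5) : Cyclic m (displ W V w m j) :=
  cyclic_of_iterate (h.2.2 j hj).1 (h.2.2 j hj).2 fun _ hx =>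
    jump_lt hx ((displ_spec h.1 h.2.1 hx).1 j hj) hm

/-- The differences `m - 2, …, m + 2` modulo `2 * m`. -/
def middle (m : ℕ) : Set (ZMod (2 * m)) := {d | ∃ j : ℕ, j < 5 ∧ d + 2 = m + j}

theorem jump_cast {m d x : ℕ} (hm : 4 ≤ m) :
    ((jump m d x : ℕ) : ZMod (2 * m)) + 2 = x + (m + d) := by
  have h0 : (m : ZMod (2 * m)) + m = 0 := by
    rw [← two_mul]; exact_mod_cast ZMod.natCast_self (2 * m)
  unfold jump
  split_ifs with h
  · have : x + m + d - 2 + 2 = x + (m + d) := by omega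
    exact_mod_cast congrArg (Nat.cast : ℕ → ZMod (2 * m)) this
  · have : x + d - m - 2 + 2 + m = x + d := by omega
    have := congrArg (Nat.cast : ℕ → ZMod (2 * m)) this
    push_cast at this ⊢
    linear_combination this - h0

theorem exists_full_of_cyclic {m : ℕ} {R : ℕ → ℕ} (h : Cyclic m R) (hm : 4 ≤ m)
    (hR : ∀ x < 2 * m, R x ≤ 4) :
    ∃ σ : Equiv.Perm (ZMod (2 * m)), Full σ ∧ ∀ x, σ x = (jump m (R x.val) x.val : ℕ) := by
  have : NeZero (2 * m) := ⟨by omega⟩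
  have hlt : ∀ x < 2 * m, jump m (R x) x < 2 * m := fun x hx => jump_lt hx (hR x hx) hm
  let f : ZMod (2 * m) → ZMod (2 * m) := fun x => (jump m (R x.val) x.val : ℕ)
  have hf : Function.Injective f := by
    intro x y hxy
    have := congrArg ZMod.val hxy
    rw [ZMod.val_cast_of_lt (hlt _ x.val_lt), ZMod.val_cast_of_lt (hlt _ y.val_lt)] at this
    exact ZMod.val_injective _ (h.1 _ x.val_lt _ y.val_lt this)
  let σ : Equiv.Perm (ZMod (2 * m)) := Equiv.ofBijective f (Finite.injective_iff_bijective.1 hf)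
  have hz : ∀ x < 2 * m, σ.SameCycle 0 (x : ℕ) := by
    intro x hx
    have := Relation.EqvGen.rec (motive := fun x y _ => σ.SameCycle (x : ℕ) (y : ℕ))
      ?_ ?_ ?_ ?_ (h.2 x hx)
    · simpa using this
    · rintro x y ⟨hx, hxy⟩
      refine Adj.sameCycle (Or.inl ?_)
      show f x = y
      simp only [f]
      rw [ZMod.val_cast_of_lt hx, ← hxy]
    · exact fun x => .refl _ _
    · exact fun x y _ h => h.symm
    · exact fun x y z _ _ h h' => h.trans h'
  refine ⟨σ, fun u v => ?_, fun x => rfl⟩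
  have hu := hz _ u.val_lt
  have hv := hz _ v.val_lt
  rw [ZMod.natCast_zmod_val] at hu hv
  exact hu.symm.trans hv

theorem covDiff_middle {W V : List (List ℕ)} {w m : ℕ} (hm : 4 ≤ m) (hW : RowPerms W w)
    (hV : RowPerms V w) (h : ∀ j < 5, Cyclic m (displ W V w m j)) : CovDiff (middle m) 5 := by
  have : NeZero (2 * m) := ⟨by omega⟩
  choose! σ hσ hσe using fun j (hj : j < 5) => exists_full_of_cyclic (h j hj) hm
    fun x hx => (displ_spec hW hV hx).1 j hj
  refine ⟨(List.range 5).map σ, by simp, ?_, ?_⟩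
  · intro τ hτ
    obtain ⟨j, hj, rfl⟩ := List.mem_map.1 hτ
    exact hσ j (List.mem_range.1 hj)
  · rintro x y ⟨d, hd, hxy⟩
    obtain ⟨j, hj, e⟩ := (displ_spec hW hV x.val_lt).2 d hd
    refine ⟨σ j, List.mem_map.2 ⟨j, List.mem_range.2 hj, rfl⟩, ?_⟩
    have := jump_cast (d := displ W V w m j x.val) (x := x.val) hm
    rw [e, ZMod.natCast_zmod_val] at this
    rw [hσe j hj, e]
    linear_combination this - hxy

theorem covDiff_middle_of_table {W V : List (List ℕ)} {w m : ℕ} (hm : 4 ≤ m)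
    (h : CyclicTable W V w m) : CovDiff (middle m) 5 :=
  covDiff_middle hm h.1 h.2.1 fun _ hj => h.cyclic hm hj

theorem covDiff_middle_of_base {W V : List (List ℕ)} {w m : ℕ} (hm : 4 ≤ m) (hwm : w + 4 ≤ m)
    (h : CyclicTable W V w m) (k : ℕ) : CovDiff (middle (m + 4 * k)) 5 :=
  covDiff_middle (by omega) h.1 h.2.1 fun _ hj =>
    cyclic_displ_of_base h.1 h.2.1 hj hm hwm (h.cyclic hm hj) k

theorem covDiff_middle_of_le {m : ℕ} (hm : 4 ≤ m) : CovDiff (middle m) 5 := by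
  by_cases h8 : m < 8
  · interval_cases m
    · exact covDiff_middle_of_table (w := 4)
        (W := [[3, 1, 4, 0, 2], [3, 1, 4, 2, 0], [3, 4, 1, 0, 2], [3, 1, 4, 2, 0]])
        (V := [[4, 1, 2, 0, 3], [2, 3, 4, 1, 0], [4, 1, 2, 3, 0], [2, 4, 3, 0, 1]])
        (by decide) (by decide +kernel)
    · exact covDiff_middle_of_table (w := 5)
        (W := [[3, 1, 4, 0, 2], [3, 1, 4, 0, 2], [3, 1, 0, 4, 2], [3, 1, 0, 2, 4],
          [3, 1, 4, 0, 2]])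
        (V := [[3, 1, 2, 4, 0], [3, 1, 0, 2, 4], [4, 2, 3, 0, 1], [2, 0, 1, 4, 3],
          [3, 1, 2, 4, 0]])
        (by decide) (by decide +kernel)
    · exact covDiff_middle_of_table (w := 6)
        (W := [[3, 1, 4, 0, 2], [3, 1, 4, 0, 2], [3, 1, 0, 4, 2], [3, 1, 0, 2, 4],
          [3, 1, 4, 0, 2], [3, 4, 1, 2, 0]])
        (V := [[3, 0, 1, 2, 4], [3, 0, 2, 4, 1], [3, 0, 2, 1, 4], [3, 2, 4, 1, 0],
          [3, 0, 2, 4, 1], [3, 1, 0, 4, 2]])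
        (by decide) (by decide +kernel)
    · exact covDiff_middle_of_table (w := 7)
        (W := [[3, 1, 4, 0, 2], [3, 1, 4, 0, 2], [3, 1, 4, 0, 2], [3, 1, 0, 4, 2],
          [3, 1, 4, 0, 2], [3, 1, 4, 0, 2], [4, 2, 1, 0, 3]])
        (V := [[2, 0, 3, 1, 4], [4, 1, 3, 2, 0], [2, 1, 3, 0, 4], [4, 2, 3, 1, 0],
          [2, 0, 4, 1, 3], [3, 2, 4, 1, 0], [3, 0, 1, 4, 2]])
        (by decide) (by decide +kernel)
  · have hodd : ∀ m, m = 9 ∨ m = 11 → CyclicTable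
        [[3, 4, 0, 1, 2], [0, 2, 1, 4, 3], [2, 0, 3, 1, 4], [3, 2, 1, 4, 0]]
        [[4, 3, 2, 1, 0], [2, 0, 3, 4, 1], [0, 2, 4, 1, 3], [2, 3, 0, 4, 1]] 4 m := by
      rintro m (rfl | rfl) <;> decide +kernel
    obtain ⟨k, rfl | rfl | rfl | rfl⟩ : ∃ k, m = 8 + 4 * k ∨ m = 9 + 4 * k ∨ m = 10 + 4 * k ∨
        m = 11 + 4 * k := ⟨(m - 8) / 4, by omega⟩
    · exact covDiff_middle_of_base (w := 4)
        (W := [[3, 1, 4, 0, 2], [3, 4, 0, 1, 2], [0, 2, 1, 3, 4], [3, 0, 2, 4, 1]])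
        (V := [[1, 2, 4, 0, 3], [3, 2, 1, 4, 0], [3, 4, 1, 0, 2], [0, 1, 3, 4, 2]])
        (by decide) (by decide) (by decide +kernel) k
    · exact covDiff_middle_of_base (by decide) (by decide) (hodd 9 (by simp)) k
    · exact covDiff_middle_of_base (w := 5)
        (W := [[3, 4, 0, 1, 2], [0, 1, 3, 2, 4], [3, 1, 0, 4, 2], [4, 3, 2, 1, 0],
          [0, 1, 2, 4, 3]])
        (V := [[3, 4, 2, 1, 0], [4, 0, 2, 3, 1], [0, 1, 2, 4, 3], [3, 2, 4, 0, 1],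
          [0, 3, 1, 4, 2]])
        (by decide) (by decide) (by decide +kernel) k
    · exact covDiff_middle_of_base (by decide) (by decide) (hodd 11 (by simp)) k

/-- The complete symmetric digraph on `2 * m ≥ 8` vertices has a Hamiltonian decomposition. -/
theorem covDiff_ne_zero {m : ℕ} (hm : 4 ≤ m) : CovDiff {d : ZMod (2 * m) | d ≠ 0} (2 * m - 1) := by
  have : NeZero (2 * m) := ⟨by omega⟩
  refine (covDiff_symIoc_of_even (m := m) (m - 3) (by omega)).union_of_subset
    (covDiff_middle_of_le hm) (fun d hd => ?_) (by omega)
  have hd0 : d.val ≠ 0 := fun h => hd ((ZMod.val_eq_zero d).1 h)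
  have hdl := d.val_lt
  have hdv := ZMod.natCast_zmod_val d
  by_cases h1 : d.val ≤ m - 3
  · exact Or.inl ⟨d.val, by omega, h1, Or.inl hdv.symm⟩
  by_cases h2 : m + 3 ≤ d.val
  · refine Or.inl ⟨2 * m - d.val, by omega, by omega, Or.inr ?_⟩
    rw [Nat.cast_sub hdl.le, ZMod.natCast_self, hdv, zero_sub, neg_neg]
  · refine Or.inr ⟨d.val + 2 - m, by omega, ?_⟩
    rw [Nat.cast_sub (by omega)]
    push_cast
    rw [hdv]
    ring

theorem hasOPSolution_of_sum_eq {m₁ m₂ m : ℕ} (h₁ : 2 ≤ m₁) (h₂ : 2 ≤ m₂)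
    (hsol : HasOPSolution [m₁, m₂]) (hm : 4 ≤ m) (htu : 2 * m = m₁ + m₂)
    (hδ : m₁ % 2 + m₂ % 2 = 0) : HasOPSolution [m₁, m₂, 2 * m] := by
  have hS := covDiff_ne_zero hm
  rw [show 2 * m - 1 = m₁ + m₂ - 1 by omega] at hS
  refine hasOPSolution_of_nat_paths (u := 0) h₁ h₂ (by omega) hsol hS 1 1 (fun _ => 0) (fun _ => 1)
    [] one_pos one_pos (by simpa using hδ.symm) rfl ?_ ?_ ?_ ?_ ?_ ?_ ?_ ?_
  · intros; omega
  · intros; omega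
  · intros; omega
  · intros; omega
  · simp
  · simp
  · simp
  · intro v hv hvt h
    exact absurd (natCast_ne_zero hv hvt) (by simpa using h)

end

section

open Equiv Equiv.Perm

/-- A solution given by three lists for each permutation. -/
theorem hasOPSolution_of_lists {ι V : Type*} [Fintype ι] [Fintype V] [DecidableEq V]
    {m₁ m₂ m₃ : ℕ} (h₁ : 2 ≤ m₁) (h₂ : 2 ≤ m₂) (h₃ : 2 ≤ m₃)
    (hV : Fintype.card V = [m₁, m₂, m₃].sum) (hι : Fintype.card ι = [m₁, m₂, m₃].sum - 1)
    (A B C : ι → List V) (hlen : ∀ i, (A i).length = m₁ ∧ (B i).length = m₂ ∧ (C i).length = m₃)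
    (hnd : ∀ i, (A i ++ B i ++ C i).Nodup)
    (hcov : ∀ x y, x ≠ y → ∃ i, ((A i).formPerm * (B i).formPerm * (C i).formPerm) x = y) :
    HasOPSolution [m₁, m₂, m₃] := by
  refine hasOPSolution_of_cover hV hι _ (fun i => ?_) hcov
  obtain ⟨a, b, c⟩ := hlen i
  rw [cycleType_formPerm_three (hnd i) (by omega) (by omega) (by omega), a, b, c]

theorem hasOPSolution_two_two_four : HasOPSolution [2, 2, 4] :=
  hasOPSolution_of_lists (ι := Fin 7) (V := Fin 8) le_rfl le_rfl (by decide) rfl rfl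
    ![[2, 7], [2, 6], [0, 2], [0, 7], [0, 3], [1, 5], [1, 7]]
    ![[4, 6], [3, 7], [5, 7], [2, 4], [1, 2], [2, 3], [2, 5]]
    ![[0, 1, 3, 5], [0, 5, 4, 1], [1, 4, 3, 6], [1, 6, 5, 3], [4, 5, 6, 7], [0, 4, 7, 6],
      [0, 6, 3, 4]]
    (by decide) (by decide) (by decide +kernel)

theorem hasOPSolution_two_four_six : HasOPSolution [2, 4, 6] :=
  hasOPSolution_of_lists (ι := ZMod 11) (V := Option (ZMod 11)) le_rfl (by decide) (by decide)
    rfl rfl (fun i => [none, some i])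
    (fun i => ([1, 2, 4, 7] : List (ZMod 11)).map fun x => some (x + i))
    (fun i => ([3, 10, 5, 9, 8, 6] : List (ZMod 11)).map fun x => some (x + i))
    (fun _ => ⟨rfl, rfl, rfl⟩) (by decide +kernel) (by decide +kernel)

end

end OP

/-- Corollary: if 2 ≤ m₁ ≤ m₂ ≤ m₃, OP*(m₁,m₂) has a solution, and
m₃ ≥ m₁ + m₂ + δ(m₁) + δ(m₂), then OP*(m₁,m₂,m₃) has a solution. -/
theorem stmt5 (m₁ m₂ m₃ : ℕ) (h1 : 2 ≤ m₁) (h12 : m₁ ≤ m₂) (h23 : m₂ ≤ m₃)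
    (hsol : HasOPSolution [m₁, m₂])
    (h3 : m₁ + m₂ + deltaOdd m₁ + deltaOdd m₂ ≤ m₃) :
    HasOPSolution [m₁, m₂, m₃] := by
  have h2 : 2 ≤ m₂ := h1.trans h12
  unfold deltaOdd at h3
  have hδ : m₁ % 2 + m₂ % 2 = 0 ∨ m₁ % 2 + m₂ % 2 = 1 ∨ m₁ % 2 + m₂ % 2 = 2 := by omega
  obtain ⟨u, hu⟩ := Nat.exists_eq_add_of_le (show m₁ + m₂ ≤ m₃ by omega)
  rcases Nat.even_or_odd' m₃ with ⟨m, rfl | rfl⟩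
  · rcases hδ with hδ | hδ | hδ
    · obtain ⟨J, rfl⟩ : ∃ J, u = 2 * J := ⟨u / 2, by omega⟩
      rcases Nat.eq_zero_or_pos J with rfl | hJ
      · by_cases hm : 4 ≤ m
        · exact OP.hasOPSolution_of_sum_eq h1 h2 hsol hm (by omega) hδ
        · obtain ⟨rfl, rfl, rfl⟩ | ⟨rfl, rfl, rfl⟩ :
              (m₁ = 2 ∧ m₂ = 2 ∧ m = 2) ∨ (m₁ = 2 ∧ m₂ = 4 ∧ m = 3) := by omega
          exacts [OP.hasOPSolution_two_two_four, OP.hasOPSolution_two_four_six]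
      · rcases Nat.even_or_odd m with hm | hm
        · exact OP.hasOPSolution_of_even_half_of_even h1 h2 hsol hu hJ hm hδ
        · exact OP.hasOPSolution_of_odd_half_of_even (J := J + 1) h1 h2 hsol (by omega) (by omega)
            hm hδ
    · exact OP.hasOPSolution_even_odd (J := u / 2) h1 h2 hsol (by omega) hδ
    · obtain ⟨J, rfl⟩ : ∃ J, u = 2 * J := ⟨u / 2, by omega⟩
      rcases Nat.even_or_odd m with hm | hm
      · exact OP.hasOPSolution_of_even_half_of_odd h1 h2 hsol hu (by omega) hm hδ
      · exact OP.hasOPSolution_of_odd_half_of_odd (J := J + 1) h1 h2 hsol (by omega) (by omega)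
          hm hδ
  · rcases hδ with hδ | hδ | hδ
    · exact OP.hasOPSolution_odd_of_even (k := (u + 1) / 2) h1 h2 hsol (by omega) (by omega) hδ
    · exact OP.hasOPSolution_odd_of_odd (k := u / 2) h1 h2 hsol (by omega) (by omega) hδ
    · exact OP.hasOPSolution_odd_of_odd_odd (k := (u + 1) / 2) h1 h2 hsol (by omega) (by omega) hδ
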